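/- arXiv:1010.1073 — 3 statements merged into one kernel-verified Lean document; each statement's English description precedes it below -/
import Mathlib

section
/- For every ε > 0, −I_−(T) = (1/2) ∫_T^{2T} |ζ(1/2+it)| dt + O_ε(T^{1/4+ε}) as T → ∞. -/
open MeasureTheory

/-- The phase factor `e^{iθ(t)} = π^{-it/2} Γ(1/4+it/2)/|Γ(1/4+it/2)|`. -/
noncomputable def eTheta (t : ℝ) : ℂ :=
  (Real.pi : ℂ) ^ (-(Complex.I * (t : ℂ)) / 2) *
    (Complex.Gamma (1 / 4 + Complex.I * (t : ℂ) / 2) /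
      ‖Complex.Gamma (1 / 4 + Complex.I * (t : ℂ) / 2)‖)

/-- Hardy's function `Z(t) = e^{iθ(t)} ζ(1/2+it)` (a real number for real `t`). -/
noncomputable def HardyZ (t : ℝ) : ℝ :=
  (eTheta t * riemannZeta (1 / 2 + Complex.I * (t : ℂ))).re

/-- `I₋(T) = ∫_{t ∈ (T,2T], Z(t)<0} Z(t) dt`. -/
noncomputable def Iminus (T : ℝ) : ℝ :=
  ∫ t in {t : ℝ | t ∈ Set.Ioc T (2 * T) ∧ HardyZ t < 0}, HardyZ t

namespace HardyFirstMoment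

section Stirling

open Complex Filter Topology

/-- The quotient of `Γ(z)` by the exponential part of Stirling's formula. -/
noncomputable def stirlingQuot (z : ℂ) : ℂ := Gamma z * exp (z - (z - 1 / 2) * log z)

lemma log_add_one_sub_log {z : ℂ} (hz : 0 < z.re) : log (z + 1) - log z = log (1 + 1 / z) := by
  have hz0 : z ≠ 0 := fun h => by simp [h] at hz
  have h1 : 0 < (1 + 1 / z).re := by
    simp only [add_re, one_re, one_div, inv_re]
    have : 0 < normSq z := normSq_pos.2 hz0
    positivity
  have h2 : z + 1 = z * (1 + 1 / z) := by field_simp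
  rw [h2, log_mul hz0 (fun h => h1.ne' (by rw [h]; rfl))]
  · ring
  · have a1 := abs_arg_lt_pi_div_two_iff.2 (Or.inl hz)
    have a2 := abs_arg_lt_pi_div_two_iff.2 (Or.inl h1)
    rw [abs_lt] at a1 a2
    constructor <;> linarith

lemma stirlingQuot_add_one {z : ℂ} (hz : 0 < z.re) :
    stirlingQuot (z + 1) = stirlingQuot z * exp (1 - (z + 1 / 2) * log (1 + 1 / z)) := by
  have hz0 : z ≠ 0 := fun h => by simp [h] at hz
  rw [← log_add_one_sub_log hz, stirlingQuot, stirlingQuot, Gamma_add_one z hz0]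
  have : z * exp (z + 1 - (z + 1 - 1 / 2) * log (z + 1)) =
      exp (z - (z - 1 / 2) * log z) * exp (1 - (z + 1 / 2) * (log (z + 1) - log z)) := by
    nth_rewrite 1 [← exp_log hz0]
    rw [← exp_add, ← exp_add]
    congr 1
    ring
  rw [mul_assoc (Gamma z), ← this]
  ring

lemma norm_one_sub_mul_log_le {z : ℂ} (hz : 2 ≤ ‖z‖) :
    ‖1 - (z + 1 / 2) * log (1 + 1 / z)‖ ≤ 2 / ‖z‖ ^ 2 := by
  have hz0 : z ≠ 0 := fun h => by norm_num [h] at hz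
  set w : ℂ := 1 / z with hw
  have hw0 : w ≠ 0 := by simp [hw, hz0]
  have hzw : z = 1 / w := by simp [hw]
  have hwn : ‖w‖ ≤ 1 / 2 := by
    rw [hw, norm_div, norm_one]
    exact one_div_le_one_div_of_le (by norm_num) hz
  have hb := norm_log_sub_logTaylor_le 2 (z := w) (by linarith)
  set e := log (1 + w) - logTaylor (2 + 1) w with he
  have hlog : log (1 + w) = w - w ^ 2 / 2 + e := by
    rw [he]; simp [logTaylor_succ, logTaylor_zero]; ring
  have hen : ‖e‖ ≤ 2 / 3 * ‖w‖ ^ 3 := by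
    refine hb.trans ?_
    have : (1 - ‖w‖)⁻¹ ≤ 2 := by
      rw [inv_le_comm₀ (by linarith) (by norm_num)]; linarith
    have h3 : 0 ≤ ‖w‖ ^ 3 := by positivity
    norm_num
    nlinarith
  have h1 : 1 - (z + 1 / 2) * log (1 + w) = w ^ 2 / 4 - (1 / w + 1 / 2) * e := by
    rw [hlog, hzw]; field_simp; ring
  rw [h1]
  have hwp : 0 < ‖w‖ := norm_pos_iff.2 hw0
  have h2 : ‖(1 / w + 1 / 2) * e‖ ≤ (1 / ‖w‖ + 1 / 2) * (2 / 3 * ‖w‖ ^ 3) := by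
    rw [norm_mul]
    gcongr
    refine (norm_add_le _ _).trans ?_
    simp
  have h3 : ‖w ^ 2 / 4‖ = ‖w‖ ^ 2 / 4 := by simp
  have h4 : 2 / ‖z‖ ^ 2 = 2 * ‖w‖ ^ 2 := by rw [hzw]; simp
  rw [h4]
  refine (norm_sub_le _ _).trans ?_
  rw [h3]
  refine (add_le_add le_rfl h2).trans ?_
  have : (1 / ‖w‖ + 1 / 2) * (2 / 3 * ‖w‖ ^ 3) = 2 / 3 * ‖w‖ ^ 2 + 1 / 3 * ‖w‖ ^ 3 := by
    field_simp
  rw [this]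
  nlinarith [sq_nonneg ‖w‖]

lemma stirlingQuot_add_nat {z : ℂ} (hz : 0 < z.re) (n : ℕ) :
    stirlingQuot (z + n) = stirlingQuot z *
      exp (∑ k ∈ Finset.range n, (1 - (z + k + 1 / 2) * log (1 + 1 / (z + k)))) := by
  induction n with
  | zero => simp
  | succ n ih =>
    have h : z + ((n + 1 : ℕ) : ℂ) = (z + n) + 1 := by push_cast; ring
    rw [h, stirlingQuot_add_one (by simp; positivity), ih, Finset.sum_range_succ, exp_add,
      mul_assoc]

lemma sum_inv_norm_sq_le {z : ℂ} (hz : 0 < z.re) (hy : 2 ≤ |z.im|) (n : ℕ) :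
    ∑ k ∈ Finset.range n, 2 / ‖z + k‖ ^ 2 ≤ 8 / |z.im| := by
  set y := |z.im| with hyd
  have h1 : ∀ k : ℕ, 2 / ‖z + k‖ ^ 2 ≤ 4 / (y - 1 + k) - 4 / (y - 1 + (k + 1 : ℕ)) := by
    intro k
    have e1 : ‖z + k‖ ^ 2 = (z.re + k) ^ 2 + y ^ 2 := by
      rw [Complex.sq_norm, normSq_apply, hyd, sq_abs]; simp; ring
    have hk : (0 : ℝ) ≤ k := Nat.cast_nonneg k
    have e2 : (k + y) ^ 2 / 2 ≤ ‖z + k‖ ^ 2 := by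
      rw [e1]; nlinarith [sq_nonneg ((k : ℝ) - y)]
    have hp : 0 < y - 1 + k := by linarith
    have hp' : 0 < y - 1 + ((k + 1 : ℕ) : ℝ) := by push_cast; linarith
    calc 2 / ‖z + k‖ ^ 2 ≤ 2 / ((k + y) ^ 2 / 2) := by gcongr
      _ ≤ 4 / ((y - 1 + k) * (y - 1 + (k + 1 : ℕ))) := by
        rw [div_le_div_iff₀ (by positivity) (by positivity)]
        push_cast
        nlinarith
      _ = _ := by
        field_simp
        push_cast
        ring
  have h2 := Finset.sum_le_sum (s := Finset.range n) (fun k _ => h1 k)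
  rw [Finset.sum_range_sub' (fun k : ℕ => 4 / (y - 1 + (k : ℝ)))] at h2
  refine h2.trans ?_
  have h3 : 0 ≤ 4 / (y - 1 + (n : ℝ)) := by
    have : 0 < y - 1 + (n : ℝ) := by have : (0 : ℝ) ≤ n := Nat.cast_nonneg n; linarith
    positivity
  have h4 : 4 / (y - 1 + ((0 : ℕ) : ℝ)) ≤ 8 / y := by
    rw [div_le_div_iff₀ (by simp; linarith) (by linarith)]
    push_cast; linarith
  linarith

lemma tendsto_stirlingQuot_add_nat {z : ℂ} (hz : 0 < z.re) :
    Tendsto (fun n : ℕ => stirlingQuot (z + n)) atTop (𝓝 (Real.sqrt (2 * Real.pi) : ℂ)) := by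
  rw [← tendsto_add_atTop_iff_nat 1]
  have hΓ := Gamma_ne_zero_of_re_pos hz
  have hseq : Tendsto (fun n => Gamma z / GammaSeq z n) atTop (𝓝 1) := by
    have := (tendsto_const_nhds (x := Gamma z)).div (GammaSeq_tendsto_Gamma z) hΓ
    rwa [div_self hΓ] at this
  have hst : Tendsto (fun n : ℕ => ((Real.sqrt 2 * Stirling.stirlingSeq n : ℝ) : ℂ)) atTop
      (𝓝 (Real.sqrt (2 * Real.pi) : ℂ)) := by
    have := (Stirling.tendsto_stirlingSeq_sqrt_pi).const_mul (Real.sqrt 2)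
    rw [← Real.sqrt_mul (by norm_num)] at this
    exact (continuous_ofReal.tendsto _).comp this
  have hexp : Tendsto (fun n : ℕ => exp (z + 1 - (n + z + 1 / 2 : ℂ) * log (1 + (z + 1) / n)))
      atTop (𝓝 1) := by
    have l0 : Tendsto (fun n : ℕ => (z + 1) / (n : ℂ)) atTop (𝓝 0) := by
      simpa using tendsto_const_div_atTop_nhds_zero_nat (𝕜 := ℂ) (z + 1)
    have l1 : Tendsto (fun n : ℕ => (n : ℂ) * log (1 + (z + 1) / n)) atTop (𝓝 (z + 1)) := by
      apply tendsto_nat_mul_log_one_add_of_tendsto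
      refine tendsto_const_nhds.congr' ?_
      filter_upwards [eventually_ne_atTop 0] with n hn
      have : (n : ℂ) ≠ 0 := by exact_mod_cast hn
      field_simp
    have l2 : Tendsto (fun n : ℕ => log (1 + (z + 1) / (n : ℂ))) atTop (𝓝 0) := by
      have : Tendsto (fun n : ℕ => 1 + (z + 1) / (n : ℂ)) atTop (𝓝 1) := by
        simpa using l0.const_add 1
      have := this.clog (by simp)
      simpa using this
    have l3 : Tendsto (fun n : ℕ => z + 1 - (n : ℂ) * log (1 + (z + 1) / n) -
        (z + 1 / 2) * log (1 + (z + 1) / n)) atTop (𝓝 0) := by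
      have := (l1.const_sub (z + 1)).sub (l2.const_mul (z + 1 / 2))
      simpa using this
    have := (continuous_exp.tendsto _).comp l3
    rw [exp_zero] at this
    refine this.congr fun n => ?_
    simp only [Function.comp]
    congr 1
    ring
  have := (hseq.mul hst).mul hexp
  rw [one_mul, mul_one] at this
  refine this.congr' ?_
  filter_upwards [eventually_ne_atTop 0] with n hn
  have hnC : (n : ℂ) ≠ 0 := by exact_mod_cast hn
  have hnR : (0 : ℝ) < n := by exact_mod_cast Nat.pos_of_ne_zero hn
  have hpos : ∀ j : ℕ, z + j ≠ 0 := fun j h => by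
    have := congrArg re h
    simp at this
    have : (0 : ℝ) ≤ j := Nat.cast_nonneg j
    linarith
  have hG : ∀ m : ℕ, Gamma (z + m) = (∏ j ∈ Finset.range m, (z + j)) * Gamma z := by
    intro m
    induction m with
    | zero => simp
    | succ m ih =>
      rw [Finset.prod_range_succ, mul_right_comm, ← ih]
      push_cast
      rw [← add_assoc, Gamma_add_one _ (hpos m)]
      ring
  have hfac : ((n.factorial : ℝ) : ℂ) = ((Real.sqrt 2 * Stirling.stirlingSeq n : ℝ) : ℂ) *
      exp ((n + 1 / 2) * log n - n) := by
    have : (n.factorial : ℝ) = Real.sqrt 2 * Stirling.stirlingSeq n *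
        Real.exp ((n + 1 / 2) * Real.log n - n) := by
      rw [Stirling.stirlingSeq]
      have e1 : Real.exp ((n + 1 / 2) * Real.log n - n) = (n / Real.exp 1) ^ n * Real.sqrt n := by
        have e2 : (n : ℝ) / Real.exp 1 = Real.exp (Real.log n - 1) := by
          rw [Real.exp_sub, Real.exp_log hnR]
        rw [Real.sqrt_eq_rpow, Real.rpow_def_of_pos hnR, e2, ← Real.exp_nat_mul, ← Real.exp_add]
        congr 1
        ring
      rw [e1, Real.sqrt_mul (by norm_num)]
      have : Real.sqrt n ≠ 0 := by positivity
      have : Real.sqrt 2 ≠ 0 := by positivity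
      field_simp
    rw [this]
    push_cast
    rfl
  have hP : (∏ j ∈ Finset.range (n + 1), (z + j)) ≠ 0 := Finset.prod_ne_zero_iff.2 fun j _ => hpos j
  have hlog : log (z + (n + 1 : ℕ)) = log n + log (1 + (z + 1) / n) := by
    have e : z + (n + 1 : ℕ) = (n : ℝ) * (1 + (z + 1) / n) := by
      push_cast; field_simp; ring
    rw [e, log_ofReal_mul hnR]
    · simp [natCast_log]
    · intro h
      have := hpos (n + 1)
      rw [e, h] at this
      simp at this
  rw [stirlingQuot, hG, GammaSeq, hlog]
  have hfac' : (n.factorial : ℂ) = ((Real.sqrt 2 * Stirling.stirlingSeq n : ℝ) : ℂ) *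
      exp ((n + 1 / 2) * log n - n) := by rw [← hfac]; norm_cast
  have hpow : (n : ℂ) ^ z = exp (log n * z) := by rw [cpow_def_of_ne_zero hnC]
  have hfne : (n.factorial : ℂ) ≠ 0 := by exact_mod_cast n.factorial_ne_zero
  have hS : ((Real.sqrt 2 * Stirling.stirlingSeq n : ℝ) : ℂ) =
      n.factorial * exp (-((n + 1 / 2) * log n - n)) := by
    rw [hfac', mul_assoc, ← exp_add]; simp
  rw [hS, hpow]
  rw [div_div_eq_mul_div]
  have hEE : exp (-((n + 1 / 2) * log n - n)) *
      exp (z + 1 - (n + z + 1 / 2 : ℂ) * log (1 + (z + 1) / n)) =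
      exp (log n * z) * exp (z + (n + 1 : ℕ) - (z + (n + 1 : ℕ) - 1 / 2) *
        (log n + log (1 + (z + 1) / n))) := by
    rw [← exp_add, ← exp_add]
    congr 1
    push_cast
    ring
  have hx := exp_ne_zero (log n * z)
  rw [show ∀ a b c d e f : ℂ, a * b / (c * d) * (d * e) * f = a * b / (c * d) * d * (e * f) by
    intros; ring, hEE]
  field_simp

/-- Stirling's formula for the complex Gamma function, with an error term. -/
lemma norm_stirlingQuot_sub_le {z : ℂ} (hz : 0 < z.re) (hy : 8 ≤ |z.im|) :
    ‖stirlingQuot z - Real.sqrt (2 * Real.pi)‖ ≤ 16 * Real.sqrt (2 * Real.pi) / |z.im| := by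
  have hlim := tendsto_stirlingQuot_add_nat hz
  have h1 : Tendsto (fun n : ℕ => ‖stirlingQuot z - stirlingQuot (z + n)‖) atTop
      (𝓝 ‖stirlingQuot z - Real.sqrt (2 * Real.pi)‖) := (hlim.const_sub _).norm
  have h2 : Tendsto (fun n : ℕ => ‖stirlingQuot (z + n)‖ * (16 / |z.im|)) atTop
      (𝓝 (‖(Real.sqrt (2 * Real.pi) : ℂ)‖ * (16 / |z.im|))) := hlim.norm.mul_const _
  have h3 : ‖(Real.sqrt (2 * Real.pi) : ℂ)‖ * (16 / |z.im|) =
      16 * Real.sqrt (2 * Real.pi) / |z.im| := by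
    rw [norm_real, Real.norm_of_nonneg (Real.sqrt_nonneg _)]; ring
  rw [← h3]
  refine le_of_tendsto_of_tendsto' h1 h2 fun n => ?_
  set S := ∑ k ∈ Finset.range n, (1 - (z + k + 1 / 2) * log (1 + 1 / (z + k)))
  have hS : ‖S‖ ≤ 8 / |z.im| := by
    refine (norm_sum_le _ _).trans (le_trans (Finset.sum_le_sum fun k _ => ?_)
      (sum_inv_norm_sq_le hz (by linarith) n))
    apply norm_one_sub_mul_log_le
    have := abs_im_le_norm (z + k)
    simp at this
    linarith
  have hS1 : ‖S‖ ≤ 1 := hS.trans (by rw [div_le_one (by linarith)]; exact hy)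
  have h4 : stirlingQuot z = stirlingQuot (z + n) * exp (-S) := by
    rw [stirlingQuot_add_nat hz, mul_assoc, ← exp_add, add_neg_cancel, exp_zero, mul_one]
  have h5 : stirlingQuot z - stirlingQuot (z + n) = stirlingQuot (z + n) * (exp (-S) - 1) := by
    rw [mul_sub, ← h4, mul_one]
  rw [h5, norm_mul]
  gcongr
  refine (norm_exp_sub_one_le (by rwa [norm_neg])).trans ?_
  rw [norm_neg]
  calc 2 * ‖S‖ ≤ 2 * (8 / |z.im|) := by gcongr
    _ = 16 / |z.im| := by ring

end Stirling

section GammaAsymptotics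

open Complex

lemma Gamma_eq_stirlingQuot_mul (z : ℂ) :
    Gamma z = stirlingQuot z * exp ((z - 1 / 2) * log z - z) := by
  rw [stirlingQuot, mul_assoc, ← exp_add]
  simp

lemma norm_Gamma_le {x : ℝ} (hx : 1 / 2 ≤ x) :
    ∃ C > 0, ∀ y : ℝ, 8 ≤ |y| → ‖Gamma (x + I * y)‖ ≤
      C * (1 + |y|) ^ (x - 1 / 2) * Real.exp (-(Real.pi * |y| / 2)) := by
  have key : ∀ y : ℝ, 8 ≤ y → ‖Gamma (x + I * y)‖ ≤
      (3 * Real.sqrt (2 * Real.pi) * (1 + x) ^ (x - 1 / 2)) * (1 + y) ^ (x - 1 / 2) *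
        Real.exp (-(Real.pi * y / 2)) := by
    intro y hy
    have hx0 : 0 < x := by linarith
    have hy0 : 0 < y := by linarith
    set z : ℂ := x + I * y with hz
    have hre : z.re = x := by simp [hz]
    have him : z.im = y := by simp [hz]
    have hS : ‖stirlingQuot z‖ ≤ 3 * Real.sqrt (2 * Real.pi) := by
      have h := norm_stirlingQuot_sub_le (z := z) (by linarith)
        (by rw [him, abs_of_pos hy0]; exact hy)
      have h2 : 16 * Real.sqrt (2 * Real.pi) / |z.im| ≤ 2 * Real.sqrt (2 * Real.pi) := by
        rw [him, abs_of_pos hy0, div_le_iff₀ hy0]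
        nlinarith [Real.sqrt_nonneg (2 * Real.pi)]
      have h3 := norm_le_norm_add_norm_sub' (stirlingQuot z) (Real.sqrt (2 * Real.pi) : ℂ)
      rw [norm_real, Real.norm_of_nonneg (Real.sqrt_nonneg _)] at h3
      linarith
    have hz0 : z ≠ 0 := fun h => by rw [h] at hre; simp at hre; linarith
    have hnz : ‖z‖ ≤ (1 + x) * (1 + y) := by
      refine (norm_le_abs_re_add_abs_im z).trans ?_
      rw [hre, him, abs_of_pos hx0, abs_of_pos hy0]
      nlinarith
    have harg : Real.pi / 2 - x / y ≤ arg z := by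
      have h1 : arg z = Real.pi / 2 - Real.arctan (x / y) := by
        have : arg z = Real.arctan (y / x) := by
          rw [arg, if_pos (by linarith), Real.arctan_eq_arcsin, him]
          congr 1
          have hn : ‖z‖ = Real.sqrt (x ^ 2 + y ^ 2) := by
            rw [Complex.norm_def, normSq_apply, hre, him]; ring_nf
          rw [hn]
          have : 1 + (y / x) ^ 2 = (x ^ 2 + y ^ 2) / x ^ 2 := by field_simp
          rw [this, Real.sqrt_div' _ (by positivity), Real.sqrt_sq hx0.le]
          field_simp
        rw [this, ← inv_div, Real.arctan_inv_of_pos (by positivity)]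
      rw [h1]
      have h2 : Real.arctan (x / y) ≤ x / y := by
        have h3 : 0 ≤ Real.arctan (x / y) := Real.arctan_nonneg.2 (by positivity)
        have h4 := Real.le_tan h3 (Real.arctan_lt_pi_div_two _)
        rwa [Real.tan_arctan] at h4
      linarith
    rw [Gamma_eq_stirlingQuot_mul, norm_mul, norm_exp]
    have hre2 : ((z - 1 / 2) * log z - z).re = (x - 1 / 2) * Real.log ‖z‖ - y * arg z - x := by
      have h12 : (z - 1 / 2).re = x - 1 / 2 := by simp [hre]
      have h12' : (z - 1 / 2).im = y := by simp [him]
      rw [sub_re, mul_re, log_re, log_im, h12, h12', hre]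
    rw [hre2]
    have h5 : (x - 1 / 2) * Real.log ‖z‖ - y * arg z - x ≤
        (x - 1 / 2) * Real.log ((1 + x) * (1 + y)) + -(Real.pi * y / 2) := by
      have a1 : Real.log ‖z‖ ≤ Real.log ((1 + x) * (1 + y)) :=
        Real.log_le_log (norm_pos_iff.2 hz0) hnz
      have a2 : (x - 1 / 2) * Real.log ‖z‖ ≤ (x - 1 / 2) * Real.log ((1 + x) * (1 + y)) :=
        mul_le_mul_of_nonneg_left a1 (by linarith)
      have a3 : y * (Real.pi / 2 - x / y) ≤ y * arg z := mul_le_mul_of_nonneg_left harg hy0.le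
      have a4 : y * (Real.pi / 2 - x / y) = Real.pi * y / 2 - x := by field_simp
      linarith
    calc ‖stirlingQuot z‖ * Real.exp ((x - 1 / 2) * Real.log ‖z‖ - y * arg z - x)
        ≤ (3 * Real.sqrt (2 * Real.pi)) * Real.exp ((x - 1 / 2) * Real.log ((1 + x) * (1 + y)) +
          -(Real.pi * y / 2)) := by gcongr
      _ = _ := by
        rw [Real.exp_add, mul_comm (x - 1 / 2), ← Real.rpow_def_of_pos (by positivity),
          Real.mul_rpow (by positivity) (by positivity)]
        ring
  refine ⟨3 * Real.sqrt (2 * Real.pi) * (1 + x) ^ (x - 1 / 2), by positivity, fun y hy => ?_⟩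
  rcases le_total 0 y with h | h
  · rw [abs_of_nonneg h] at hy ⊢
    exact key y hy
  · rw [abs_of_nonpos h] at hy ⊢
    have := key (-y) hy
    rw [← norm_conj, ← Gamma_conj]
    convert this using 3
    simp

/-- The main term `exp(i (t/2) (log (t/2π) - 1))` of the phase factor. -/
noncomputable def phase (t : ℝ) : ℂ :=
  exp (I * ((t / 2 * (Real.log t - (1 + Real.log (2 * Real.pi))) : ℝ) : ℂ))

lemma norm_exp_I_mul_sub_le (x y : ℝ) : ‖exp (I * x) - exp (I * y)‖ ≤ |x - y| := by
  have : exp (I * x) - exp (I * y) = exp (I * y) * (exp (I * ((x - y : ℝ) : ℂ)) - 1) := by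
    rw [mul_sub, ← exp_add]; push_cast; ring_nf
  rw [this, norm_mul, mul_comm I (y : ℂ), norm_exp_ofReal_mul_I, one_mul]
  exact Real.norm_exp_I_mul_ofReal_sub_one_le

lemma norm_eTheta_sub_le :
    ∀ t : ℝ, 100 ≤ t → ‖eTheta t - exp (I * ((-(Real.pi / 8) : ℝ) : ℂ)) * phase t‖ ≤ 100 / t := by
  intro t ht
  have ht0 : 0 < t := by linarith
  set z : ℂ := 1 / 4 + I * t / 2 with hz
  have hre : z.re = 1 / 4 := by simp [hz]
  have him : z.im = t / 2 := by simp [hz]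
  set D := stirlingQuot z with hD
  set s := Real.sqrt (2 * Real.pi) with hs
  have hs0 : 0 < s := by positivity
  have hDs : ‖D - s‖ ≤ 32 * s / t := by
    have h := norm_stirlingQuot_sub_le (z := z) (by rw [hre]; norm_num)
      (by rw [him, abs_of_pos (by positivity)]; linarith)
    rw [him, abs_of_pos (by positivity)] at h
    convert h using 1
    rw [← hs]
    field_simp
    norm_num
  have hDlow : s / 2 ≤ ‖D‖ := by
    have h1 := norm_sub_norm_le (s : ℂ) D
    rw [norm_sub_rev, norm_real, Real.norm_of_nonneg hs0.le] at h1
    have : 32 * s / t ≤ s / 2 := by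
      rw [div_le_div_iff₀ ht0 (by norm_num)]; nlinarith
    linarith
  have hD0 : (‖D‖ : ℂ) ≠ 0 := by
    have : 0 < ‖D‖ := by linarith
    exact_mod_cast this.ne'
  have hDph : ‖D / ‖D‖ - 1‖ ≤ 64 / t * 1.5 := by
    have e1 : D / ‖D‖ - 1 = (D - ‖D‖) / ‖D‖ := by field_simp
    have e2 : ‖D - ‖D‖‖ ≤ 2 * ‖D - s‖ := by
      have e3 : D - ‖D‖ = (D - s) + ((s - ‖D‖ : ℝ) : ℂ) := by push_cast; ring
      have e4 : ‖((s - ‖D‖ : ℝ) : ℂ)‖ ≤ ‖D - s‖ := by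
        rw [norm_real, Real.norm_eq_abs, norm_sub_rev]
        have := abs_norm_sub_norm_le (s : ℂ) D
        rwa [norm_real, Real.norm_of_nonneg hs0.le] at this
      rw [e3]
      refine (norm_add_le _ _).trans ?_
      linarith
    have hDlow2 : 2 / 3 * s ≤ ‖D‖ := by
      have h1 := norm_sub_norm_le (s : ℂ) D
      rw [norm_sub_rev, norm_real, Real.norm_of_nonneg hs0.le] at h1
      have : 32 * s / t ≤ s / 3 := by
        rw [div_le_div_iff₀ ht0 (by norm_num)]; nlinarith
      linarith
    rw [e1, norm_div, norm_real, norm_norm]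
    calc ‖D - ‖D‖‖ / ‖D‖ ≤ (2 * (32 * s / t)) / (2 / 3 * s) := by gcongr; linarith
      _ = 64 / t * 1.5 := by field_simp; norm_num
  set P : ℝ := ((z - 1 / 2) * log z - z).im - t / 2 * Real.log Real.pi with hP
  have hE : eTheta t = D / ‖D‖ * exp (I * P) := by
    have g1 : ((Real.pi : ℝ) : ℂ) ^ (-(I * (t : ℂ)) / 2) =
        exp (I * ((-(t / 2 * Real.log Real.pi) : ℝ) : ℂ)) := by
      rw [cpow_def_of_ne_zero (by exact_mod_cast Real.pi_ne_zero), ← ofReal_log Real.pi_pos.le]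
      congr 1
      push_cast; ring
    have g2 : exp ((z - 1 / 2) * log z - z) =
        ‖exp ((z - 1 / 2) * log z - z)‖ * exp (I * (((z - 1 / 2) * log z - z).im : ℂ)) := by
      rw [norm_exp, ofReal_exp, ← exp_add, mul_comm I, re_add_im]
    have hne : (‖exp ((z - 1 / 2) * log z - z)‖ : ℂ) ≠ 0 := by
      exact_mod_cast (norm_pos_iff.2 (exp_ne_zero _)).ne'
    rw [eTheta, g1, ← hz, Gamma_eq_stirlingQuot_mul, norm_mul, ← hD, ofReal_mul]
    rw [show P = ((z - 1 / 2) * log z - z).im + -(t / 2 * Real.log Real.pi) from sub_eq_add_neg _ _,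
      ofReal_add, mul_add, exp_add]
    nth_rewrite 1 [g2]
    field_simp
  set Q : ℝ := -(Real.pi / 8) + t / 2 * (Real.log t - (1 + Real.log (2 * Real.pi))) with hQ
  have hEQ : exp (I * ((-(Real.pi / 8) : ℝ) : ℂ)) * phase t = exp (I * Q) := by
    rw [phase, ← exp_add, hQ, ofReal_add, mul_add]
  have hPQ : |P - Q| ≤ 2 / t := by
    set w : ℂ := -I / (2 * t) with hw
    have htC : (t : ℂ) ≠ 0 := by exact_mod_cast ht0.ne'
    have hwn : ‖w‖ = 1 / (2 * t) := by
      rw [hw, norm_div, norm_neg, norm_I, norm_mul, norm_real, Real.norm_of_nonneg ht0.le]; simp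
    have hw1 : ‖w‖ ≤ 1 / 2 := by
      rw [hwn]; exact one_div_le_one_div_of_le (by norm_num) (by linarith)
    have hzw : z = ((t / 2 : ℝ) : ℂ) * (I * (1 + w)) := by
      have hII : I * I = -1 := I_mul_I
      rw [hz, hw]
      push_cast
      field_simp
      linear_combination (4 : ℂ) * hII
    have h1w : 0 < (1 + w).re := by
      have := abs_re_le_norm w
      rw [abs_le] at this
      simp only [add_re, one_re]; linarith
    have h1w0 : 1 + w ≠ 0 := fun h => h1w.ne' (by rw [h]; rfl)
    have hlog : log z = Real.log (t / 2) + Real.pi / 2 * I + log (1 + w) := by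
      rw [hzw, log_ofReal_mul (by positivity) (mul_ne_zero I_ne_zero h1w0),
        log_mul I_ne_zero h1w0, log_I]
      · ring
      · have h2 : (1 + w).im < 0 := by
          have : w = ((-1 / (2 * t) : ℝ) : ℂ) * I := by rw [hw]; push_cast; ring
          rw [this, add_im, one_im, zero_add, im_ofReal_mul, I_im, mul_one]
          exact div_neg_of_neg_of_pos (by norm_num) (by positivity)
        have a1 := arg_neg_iff.2 h2
        have a2 := abs_arg_lt_pi_div_two_iff.2 (Or.inl h1w)
        rw [abs_lt] at a2
        rw [arg_I]
        constructor <;> linarith [Real.pi_pos]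
    set e := log (1 + w) - w with he
    have hen : ‖e‖ ≤ 1 / (4 * t ^ 2) := by
      refine (norm_log_one_add_sub_self_le (by linarith)).trans ?_
      have : (1 - ‖w‖)⁻¹ ≤ 2 := by
        rw [inv_le_comm₀ (by linarith) (by norm_num)]; linarith
      calc ‖w‖ ^ 2 * (1 - ‖w‖)⁻¹ / 2 ≤ ‖w‖ ^ 2 * 2 / 2 := by gcongr
        _ = 1 / (4 * t ^ 2) := by rw [hwn]; field_simp; norm_num
    have hlw : log (1 + w) = w + e := by rw [he]; ring
    have hexp : (z - 1 / 2) * log z - z =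
        ((-1 / 4 * Real.log (t / 2) - Real.pi / 2 * (t / 2) : ℝ) : ℂ)
        + ((t / 2 * Real.log (t / 2) - Real.pi / 8 - t / 2 + 1 / (8 * t) : ℝ) : ℂ) * I
        + (z - 1 / 2) * e := by
      have hII : I * I = -1 := I_mul_I
      have h4 : z - 1 / 2 = -1 / 4 + I * t / 2 := by rw [hz]; ring
      have h5 : (-1 / 4 + I * t / 2) * (Real.log (t / 2) + Real.pi / 2 * I + w) - z =
          ((-1 / 4 * Real.log (t / 2) - Real.pi / 2 * (t / 2) : ℝ) : ℂ)
          + ((t / 2 * Real.log (t / 2) - Real.pi / 8 - t / 2 + 1 / (8 * t) : ℝ) : ℂ) * I := by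
        rw [hw, hz]
        push_cast
        field_simp
        ring_nf
        rw [I_sq]
        ring
      rw [← h5, hlog, hlw, h4]
      ring
    have hPe : P - Q = 1 / (8 * t) + ((z - 1 / 2) * e).im := by
      rw [hP, hexp, add_im, add_im, ofReal_im, im_ofReal_mul, I_im, hQ,
        Real.log_div ht0.ne' (by norm_num), Real.log_mul (by norm_num) Real.pi_ne_zero]
      ring
    have hze : |((z - 1 / 2) * e).im| ≤ 1 / t := by
      refine (abs_im_le_norm _).trans ?_
      rw [norm_mul]
      have : ‖z - 1 / 2‖ ≤ t := by
        refine (norm_le_abs_re_add_abs_im _).trans ?_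
        have a : (z - 1 / 2).re = -1 / 4 := by simp [hre]; norm_num
        have b : (z - 1 / 2).im = t / 2 := by simp [him]
        rw [a, b, abs_of_pos (by positivity : 0 < t / 2)]
        norm_num; linarith
      calc ‖z - 1 / 2‖ * ‖e‖ ≤ t * (1 / (4 * t ^ 2)) := by gcongr
        _ ≤ 1 / t := by
          rw [mul_one_div, div_le_div_iff₀ (by positivity) ht0]; nlinarith
    rw [hPe]
    refine (abs_add_le _ _).trans ?_
    have : |1 / (8 * t)| ≤ 1 / t := by
      rw [abs_of_pos (by positivity)]
      exact one_div_le_one_div_of_le ht0 (by linarith)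
    calc _ ≤ 1 / t + 1 / t := add_le_add this hze
      _ = 2 / t := by ring
  rw [hEQ, hE]
  have : D / ‖D‖ * exp (I * P) - exp (I * Q) =
      (D / ‖D‖ - 1) * exp (I * P) + (exp (I * P) - exp (I * Q)) := by ring
  rw [this]
  refine (norm_add_le _ _).trans ?_
  rw [norm_mul, mul_comm I (P : ℂ), norm_exp_ofReal_mul_I, mul_one, mul_comm (P : ℂ) I]
  calc _ ≤ 64 / t * 1.5 + 2 / t := add_le_add hDph ((norm_exp_I_mul_sub_le P Q).trans hPQ)
    _ = 98 / t := by ring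
    _ ≤ 100 / t := by gcongr; norm_num

end GammaAsymptotics

section Reality

open Complex ComplexConjugate

lemma half_add_ne_one (t : ℝ) : (1 / 2 + I * t : ℂ) ≠ 1 := fun h => by
  have := congrArg re h
  norm_num at this

lemma quarter_re_pos (t : ℝ) : 0 < (1 / 4 + I * t / 2 : ℂ).re := by simp

lemma eTheta_mul_zeta (t : ℝ) : eTheta t * riemannZeta (1 / 2 + I * t) =
    (Real.pi : ℂ) ^ (1 / 4 : ℂ) * completedRiemannZeta (1 / 2 + I * t) /
      ‖Gamma (1 / 4 + I * t / 2)‖ := by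
  have hne : (1 / 2 + I * t : ℂ) ≠ 0 := fun h => by
    have := congrArg re h
    norm_num at this
  have hG := Gamma_ne_zero_of_re_pos (quarter_re_pos t)
  have hpi : (Real.pi : ℂ) ≠ 0 := by exact_mod_cast Real.pi_ne_zero
  rw [riemannZeta_def_of_ne_zero hne, eTheta, Gammaℝ_def,
    show (1 / 2 + I * t : ℂ) / 2 = 1 / 4 + I * t / 2 by ring,
    show -(1 / 2 + I * t : ℂ) / 2 = -(I * t) / 2 - 1 / 4 by ring, cpow_sub _ _ hpi]
  have h1 : (Real.pi : ℂ) ^ (1 / 4 : ℂ) ≠ 0 := by simp [cpow_eq_zero_iff, hpi]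
  have h2 : (Real.pi : ℂ) ^ (-(I * t) / 2 : ℂ) ≠ 0 := by simp [cpow_eq_zero_iff, hpi]
  have h3 : (‖Gamma (1 / 4 + I * t / 2)‖ : ℂ) ≠ 0 := by
    exact_mod_cast (norm_pos_iff.2 hG).ne'
  generalize Gamma (1 / 4 + I * t / 2) = G at hG h3
  generalize (Real.pi : ℂ) ^ (1 / 4 : ℂ) = p at h1
  generalize (Real.pi : ℂ) ^ (-(I * t) / 2 : ℂ) = q at h2
  field_simp

lemma conj_completedRiemannZeta_half (t : ℝ) :
    conj (completedRiemannZeta (1 / 2 + I * t)) = completedRiemannZeta (1 / 2 + I * t) := by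
  have hne : ∀ u : ℝ, (1 / 2 + I * u : ℂ) ≠ 0 := fun u h => by
    have := congrArg re h
    norm_num at this
  have hform : ∀ u : ℝ, completedRiemannZeta (1 / 2 + I * u) =
      riemannZeta (1 / 2 + I * u) * Gammaℝ (1 / 2 + I * u) := fun u => by
    rw [riemannZeta_def_of_ne_zero (hne u), div_mul_cancel₀]
    exact Gammaℝ_ne_zero_of_re_pos (by simp)
  have hc : conj (1 / 2 + I * t : ℂ) = 1 / 2 + I * ((-t : ℝ) : ℂ) := by
    apply Complex.ext <;> simp
  rw [hform t, map_mul, ← riemannZeta_conj]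
  have hGc : conj (Gammaℝ (1 / 2 + I * t)) = Gammaℝ (conj (1 / 2 + I * t : ℂ)) := by
    rw [Gammaℝ_def, Gammaℝ_def, map_mul, ← Gamma_conj]
    have hp : ∀ w : ℂ, conj ((Real.pi : ℂ) ^ w) = (Real.pi : ℂ) ^ (conj w) := fun w => by
      rw [cpow_conj _ _ (by rw [arg_ofReal_of_nonneg Real.pi_pos.le]; exact Real.pi_pos.ne),
        conj_ofReal]
    have h2 : conj (2 : ℂ) = 2 := conj_ofNat 2
    rw [hp, map_div₀, map_div₀, map_neg, h2]
  rw [hGc, hc, ← hform, ← completedRiemannZeta_one_sub, ← hform]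
  congr 1
  push_cast
  ring

lemma ofReal_HardyZ (t : ℝ) : (HardyZ t : ℂ) = eTheta t * riemannZeta (1 / 2 + I * t) := by
  rw [HardyZ]
  apply conj_eq_iff_re.1
  have : (Real.pi : ℂ) ^ (1 / 4 : ℂ) = ((Real.pi ^ (1 / 4 : ℝ) : ℝ) : ℂ) := by
    rw [ofReal_cpow Real.pi_pos.le]; push_cast; rfl
  rw [eTheta_mul_zeta, this, map_div₀, map_mul, conj_completedRiemannZeta_half, conj_ofReal,
    conj_ofReal]

lemma norm_eTheta (t : ℝ) : ‖eTheta t‖ = 1 := by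
  have hG := norm_pos_iff.2 (Gamma_ne_zero_of_re_pos (quarter_re_pos t))
  rw [eTheta, norm_mul, norm_div, norm_real, norm_norm, div_self hG.ne', mul_one,
    norm_cpow_eq_rpow_re_of_pos Real.pi_pos]
  simp

lemma abs_HardyZ (t : ℝ) : |HardyZ t| = ‖riemannZeta (1 / 2 + I * t)‖ := by
  rw [← Real.norm_eq_abs, ← norm_real, ofReal_HardyZ, norm_mul, norm_eTheta, one_mul]

lemma continuous_eTheta : Continuous eTheta := by
  unfold eTheta
  have h1 : Continuous fun t : ℝ => Gamma (1 / 4 + I * t / 2) := by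
    refine continuous_iff_continuousAt.2 fun t => ?_
    have : ContinuousAt Gamma (1 / 4 + I * t / 2) := by
      refine (differentiableAt_Gamma _ fun m h => ?_).continuousAt
      have h2 := congrArg re h
      simp at h2
      have : (0 : ℝ) ≤ m := Nat.cast_nonneg m
      linarith
    exact ContinuousAt.comp (f := fun t : ℝ => (1 / 4 + I * t / 2 : ℂ)) this
      (by fun_prop)
  refine Continuous.mul ?_ (h1.div (by fun_prop) fun t => ?_)
  · refine Continuous.const_cpow (by fun_prop) (Or.inl ?_)
    exact_mod_cast Real.pi_ne_zero
  · exact_mod_cast (norm_pos_iff.2 (Gamma_ne_zero_of_re_pos (quarter_re_pos t))).ne'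

lemma continuous_zeta_half : Continuous fun t : ℝ => riemannZeta (1 / 2 + I * t) :=
  continuous_iff_continuousAt.2 fun t =>
    ContinuousAt.comp (f := fun t : ℝ => (1 / 2 + I * t : ℂ))
      (differentiableAt_riemannZeta (half_add_ne_one t)).continuousAt (by fun_prop)

lemma continuous_HardyZ : Continuous HardyZ :=
  continuous_re.comp (continuous_eTheta.mul continuous_zeta_half)

lemma neg_Iminus_sub {T : ℝ} (hT : 0 ≤ T) :
    (-Iminus T) - (1 / 2) * ∫ t in T..(2 * T), ‖riemannZeta (1 / 2 + Complex.I * (t : ℂ))‖ =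
      -(1 / 2) * ∫ t in T..(2 * T), HardyZ t := by
  have hI : Iminus T = ∫ t in T..(2 * T), (HardyZ t - |HardyZ t|) / 2 := by
    rw [Iminus, intervalIntegral.integral_of_le (by linarith)]
    have hset : {t : ℝ | t ∈ Set.Ioc T (2 * T) ∧ HardyZ t < 0} =
        Set.Ioc T (2 * T) ∩ {t | HardyZ t < 0} := rfl
    have hm : MeasurableSet {t | HardyZ t < 0} :=
      (isOpen_lt continuous_HardyZ continuous_const).measurableSet
    rw [hset, ← setIntegral_indicator hm]
    congr 1
    ext t
    by_cases h : HardyZ t < 0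
    · rw [Set.indicator_of_mem (by exact h), abs_of_neg h]; ring
    · rw [Set.indicator_of_notMem (by exact h), abs_of_nonneg (not_lt.1 h)]; ring
  have hc := continuous_HardyZ
  rw [hI, intervalIntegral.integral_div, intervalIntegral.integral_sub
    (hc.intervalIntegrable _ _) (hc.abs.intervalIntegrable _ _)]
  simp_rw [abs_HardyZ]
  ring

lemma abs_neg_Iminus_sub_le {T : ℝ} (hT : 0 ≤ T) :
    |(-Iminus T) - (1 / 2) * ∫ t in T..(2 * T), ‖riemannZeta (1 / 2 + Complex.I * (t : ℂ))‖| ≤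
      ‖∫ t in T..(2 * T), eTheta t * riemannZeta (1 / 2 + I * t)‖ := by
  simp_rw [neg_Iminus_sub hT, ← ofReal_HardyZ, intervalIntegral.integral_ofReal, norm_real,
    abs_mul, Real.norm_eq_abs]
  norm_num
  linarith [abs_nonneg (∫ t in T..(2 * T), HardyZ t)]

end Reality

section Convexity

open Complex Set Filter Asymptotics

lemma mellin_bounded_of_mellinConvergent {f : ℝ → ℂ} {a b : ℝ}
    (ha : MellinConvergent f a) (hb : MellinConvergent f b) :
    ∃ C : ℝ, ∀ s : ℂ, a ≤ s.re → s.re ≤ b → ‖mellin f s‖ ≤ C := by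
  refine ⟨∫ t in Ioi (0 : ℝ), (‖(t : ℂ) ^ ((a : ℂ) - 1) • f t‖ + ‖(t : ℂ) ^ ((b : ℂ) - 1) • f t‖),
    fun s h1 h2 => ?_⟩
  rw [mellin]
  refine norm_integral_le_of_norm_le (ha.norm.add hb.norm) ?_
  filter_upwards [ae_restrict_mem measurableSet_Ioi] with t ht
  have ht : 0 < t := ht
  rw [norm_smul, norm_smul, norm_smul, norm_cpow_eq_rpow_re_of_pos ht,
    norm_cpow_eq_rpow_re_of_pos ht, norm_cpow_eq_rpow_re_of_pos ht, ← add_mul]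
  refine mul_le_mul_of_nonneg_right ?_ (norm_nonneg _)
  simp only [sub_re, ofReal_re, one_re]
  rcases le_total t 1 with h | h
  · have := Real.rpow_le_rpow_of_exponent_ge ht h (show a - 1 ≤ s.re - 1 by linarith)
    have := Real.rpow_nonneg ht.le (b - 1)
    linarith
  · have := Real.rpow_le_rpow_of_exponent_le h (show s.re - 1 ≤ b - 1 by linarith)
    have := Real.rpow_nonneg ht.le (a - 1)
    linarith

lemma completedRiemannZeta₀_bounded (a b : ℝ) :
    ∃ C : ℝ, ∀ s : ℂ, a ≤ s.re → s.re ≤ b → ‖completedRiemannZeta₀ s‖ ≤ C := by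
  set P := HurwitzZeta.hurwitzEvenFEPair 0
  have hc : ∀ s : ℂ, MellinConvergent P.f_modif s := fun s =>
    (P.isStrongFEPair_toStrongFEPair.hasMellin s).1
  obtain ⟨C, hC⟩ := mellin_bounded_of_mellinConvergent (hc (a / 2 : ℝ)) (hc (b / 2 : ℝ))
  refine ⟨C / 2, fun s h1 h2 => ?_⟩
  have h3 : (s / 2).re = s.re / 2 := by simp
  have := hC (s / 2) (by rw [h3]; linarith) (by rw [h3]; linarith)
  rw [completedRiemannZeta₀, HurwitzZeta.completedHurwitzZetaEven₀, norm_div, norm_ofNat]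
  gcongr
  exact this

lemma norm_Gamma_le_Gamma_re {z : ℂ} (hz : 0 < z.re) : ‖Gamma z‖ ≤ Real.Gamma z.re := by
  rw [Gamma_eq_integral hz, Real.Gamma_eq_integral hz, GammaIntegral]
  refine (norm_integral_le_integral_norm _).trans (le_of_eq ?_)
  refine setIntegral_congr_fun measurableSet_Ioi fun t ht => ?_
  have ht : 0 < t := ht
  simp only [norm_mul, norm_real, norm_cpow_eq_rpow_re_of_pos ht, sub_re, one_re]
  rw [Real.norm_of_nonneg (Real.exp_pos _).le]

lemma norm_sin_le_exp (z : ℂ) : ‖sin z‖ ≤ Real.exp |z.im| := by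
  rw [sin]
  have h1 : ‖exp (-z * I)‖ ≤ Real.exp |z.im| := by
    rw [norm_exp]; gcongr; simp [le_abs_self]
  have h2 : ‖exp (z * I)‖ ≤ Real.exp |z.im| := by
    rw [norm_exp]; gcongr; simp [neg_le_abs]
  rw [norm_div, norm_mul, norm_I, mul_one, norm_ofNat]
  have := norm_sub_le (exp (-z * I)) (exp (z * I))
  linarith

lemma norm_cos_le_exp (z : ℂ) : ‖cos z‖ ≤ Real.exp |z.im| := by
  rw [cos]
  have h1 : ‖exp (-z * I)‖ ≤ Real.exp |z.im| := by
    rw [norm_exp]; gcongr; simp [le_abs_self]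
  have h2 : ‖exp (z * I)‖ ≤ Real.exp |z.im| := by
    rw [norm_exp]; gcongr; simp [neg_le_abs]
  rw [norm_div, norm_ofNat]
  have := norm_add_le (exp (z * I)) (exp (-z * I))
  linarith

lemma exists_norm_riemannZeta_le_exp : ∃ C : ℝ, ∀ s : ℂ, -(1 / 2) ≤ s.re → s.re ≤ 3 / 2 →
    1 ≤ |s.im| → ‖riemannZeta s‖ ≤ C * Real.exp (2 * |s.im|) := by
  obtain ⟨C, hC⟩ := completedRiemannZeta₀_bounded (-(1 / 2)) (3 / 2)
  set M := max (Real.Gamma (1 / 4)) (Real.Gamma (5 / 4))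
  refine ⟨Real.pi * (M / Real.pi) * (C + 1 + 1), fun s h1 h2 h3 => ?_⟩
  have him : s.im ≠ 0 := fun h => by rw [h, abs_zero] at h3; linarith
  have hs0 : s ≠ 0 := fun h => him (by rw [h]; rfl)
  have hs1 : 1 ≤ ‖s‖ := h3.trans (abs_im_le_norm s)
  have hs2 : 1 ≤ ‖1 - s‖ := by
    refine h3.trans ?_
    have := abs_im_le_norm (1 - s)
    simpa using this
  have e1 : ‖completedRiemannZeta s‖ ≤ C + 1 + 1 := by
    rw [completedRiemannZeta_eq]
    refine (norm_sub_le _ _).trans (add_le_add ((norm_sub_le _ _).trans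
      (add_le_add (hC s h1 h2) ?_)) ?_)
    · rw [norm_div, norm_one]; exact div_le_one_of_le₀ hs1 (norm_nonneg _)
    · rw [norm_div, norm_one]; exact div_le_one_of_le₀ hs2 (norm_nonneg _)
  have hsin : sin (Real.pi * (s / 2)) ≠ 0 := fun h => by
    obtain ⟨k, hk⟩ := sin_eq_zero_iff.1 h
    have := congrArg im hk
    rw [im_ofReal_mul] at this
    simp at this
    exact him this
  have hpi : (Real.pi : ℂ) ≠ 0 := by exact_mod_cast Real.pi_ne_zero
  have e2 : (Gamma (s / 2))⁻¹ = Gamma (1 - s / 2) * sin (Real.pi * (s / 2)) / Real.pi := by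
    have := Gamma_mul_Gamma_one_sub (s / 2)
    have hne : Gamma (s / 2) ≠ 0 := fun h => by
      rw [h, zero_mul] at this
      exact div_ne_zero hpi hsin this.symm
    rw [eq_div_iff hsin] at this
    rw [eq_div_iff hpi, inv_mul_eq_iff_eq_mul₀ hne]
    exact this.symm.trans (mul_assoc _ _ _)
  have hre : (1 - s / 2).re = 1 - s.re / 2 := by simp
  have e3 : ‖Gamma (1 - s / 2)‖ ≤ M := by
    refine (norm_Gamma_le_Gamma_re (by rw [hre]; linarith)).trans ?_
    rw [hre]
    exact Real.convexOn_Gamma.le_max_of_mem_Icc (by norm_num) (by norm_num)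
      ⟨by linarith, by linarith⟩
  have hM : 0 ≤ M := (norm_nonneg _).trans e3
  have e4 : ‖sin (Real.pi * (s / 2))‖ ≤ Real.exp (2 * |s.im|) := by
    refine (norm_sin_le_exp _).trans ?_
    gcongr
    rw [im_ofReal_mul, abs_mul, abs_of_pos Real.pi_pos]
    simp only [div_ofNat_im, abs_div, Nat.abs_ofNat]
    nlinarith [abs_nonneg s.im, Real.pi_lt_four]
  have e5 : ‖((Real.pi : ℂ) ^ (-s / 2))⁻¹‖ ≤ Real.pi := by
    rw [norm_inv, norm_cpow_eq_rpow_re_of_pos Real.pi_pos, ← Real.rpow_neg Real.pi_pos.le]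
    refine (Real.rpow_le_rpow_of_exponent_le (by linarith [Real.pi_gt_three])
      (y := -(-s / 2).re) (z := 1) ?_).trans (by rw [Real.rpow_one])
    simp
    linarith
  rw [riemannZeta_def_of_ne_zero hs0, Gammaℝ_def, div_eq_mul_inv, mul_inv, e2, norm_mul, norm_mul,
    norm_div, norm_mul, norm_real, Real.norm_of_nonneg Real.pi_pos.le]
  have hC0 : 0 ≤ C + 1 + 1 := (norm_nonneg _).trans e1
  have := Real.pi_pos
  calc _ ≤ (C + 1 + 1) * (Real.pi * (M * Real.exp (2 * |s.im|) / Real.pi)) := by gcongr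
    _ = _ := by ring

end Convexity

section ConvexityBound

open Complex Set Filter Asymptotics

lemma exists_norm_riemannZeta_right_le {δ : ℝ} (hδ : 0 < δ) :
    ∃ C > 0, ∀ s : ℂ, s.re = 1 + δ → ‖riemannZeta s‖ ≤ C := by
  have hsum : Summable fun n : ℕ => 1 / ((n : ℝ) + 1) ^ (1 + δ) := by
    have := (summable_nat_add_iff 1).2
      (Real.summable_one_div_nat_rpow.2 (show 1 < 1 + δ by linarith))
    simpa using this
  refine ⟨(∑' n : ℕ, 1 / ((n : ℝ) + 1) ^ (1 + δ)) + 1, by positivity, fun s hs => ?_⟩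
  rw [zeta_eq_tsum_one_div_nat_add_one_cpow (by linarith)]
  refine (tsum_of_norm_bounded hsum.hasSum fun n => le_of_eq ?_).trans (by linarith)
  rw [norm_div, norm_one, show (n : ℂ) + 1 = ((n + 1 : ℝ) : ℂ) by push_cast; rfl,
    norm_cpow_eq_rpow_re_of_pos (by positivity), hs]

lemma exists_norm_riemannZeta_left_le {δ : ℝ} (hδ : 0 < δ) :
    ∃ C > 0, ∀ s : ℂ, s.re = -δ → ‖riemannZeta s‖ ≤ C * (1 + |s.im|) ^ (1 / 2 + δ) := by
  obtain ⟨C₁, hC₁, h₁⟩ := norm_Gamma_le (show 1 / 2 ≤ 1 + δ by linarith)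
  obtain ⟨C₂, hC₂, h₂⟩ := exists_norm_riemannZeta_right_le hδ
  have hcont : ContinuousOn (fun y : ℝ => ‖riemannZeta (-δ + I * y)‖) (Icc (-8) 8) := by
    refine ContinuousOn.norm fun y _ => ContinuousAt.continuousWithinAt ?_
    refine ContinuousAt.comp (f := fun y : ℝ => (-δ + I * y : ℂ))
      (differentiableAt_riemannZeta fun h => ?_).continuousAt (by fun_prop)
    have := congrArg re h
    simp at this
    linarith
  obtain ⟨M, hM⟩ := isCompact_Icc.bddAbove_image hcont
  refine ⟨2 * C₁ * C₂ + |M|, by positivity, fun s hs => ?_⟩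
  have hpow : 1 ≤ (1 + |s.im|) ^ (1 / 2 + δ) :=
    Real.one_le_rpow (by linarith [abs_nonneg s.im]) (by linarith)
  have hs' : s = -δ + I * s.im := by
    apply Complex.ext <;> simp [hs]
  rcases le_total |s.im| 8 with h | h
  · have : ‖riemannZeta (-δ + I * s.im)‖ ≤ M := hM ⟨s.im, abs_le.1 h, rfl⟩
    rw [← hs'] at this
    have h3 := this.trans (le_abs_self M)
    have : 0 ≤ 2 * C₁ * C₂ := by positivity
    nlinarith [abs_nonneg M]
  · set w : ℂ := (1 + δ : ℝ) + I * ((-s.im : ℝ) : ℂ) with hw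
    have hsw : s = 1 - w := by
      rw [hw]; apply Complex.ext <;> simp [hs]
    have hwre : w.re = 1 + δ := by simp [hw]
    have hwim : w.im = -s.im := by simp [hw]
    have e1 : ‖riemannZeta w‖ ≤ C₂ := h₂ w hwre
    have e2 := h₁ (-s.im) (by rwa [abs_neg])
    rw [abs_neg, ← hw] at e2
    have e3 : ‖cos (Real.pi * w / 2)‖ ≤ Real.exp (Real.pi * |s.im| / 2) := by
      refine (norm_cos_le_exp _).trans (le_of_eq ?_)
      rw [div_ofNat_im, im_ofReal_mul, hwim, abs_div, abs_mul, abs_neg, abs_of_pos Real.pi_pos]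
      simp
    have e4 : ‖((2 : ℂ) * Real.pi) ^ (-w)‖ ≤ 1 := by
      rw [show (2 : ℂ) * Real.pi = ((2 * Real.pi : ℝ) : ℂ) by push_cast; rfl,
        norm_cpow_eq_rpow_re_of_pos (by positivity)]
      refine Real.rpow_le_one_of_one_le_of_nonpos (by linarith [Real.pi_gt_three]) ?_
      rw [neg_re, hwre]; linarith
    have e5 : Real.exp (-(Real.pi * |s.im| / 2)) * Real.exp (Real.pi * |s.im| / 2) = 1 := by
      rw [← Real.exp_add]; simp
    rw [hsw, riemannZeta_one_sub, ← hsw]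
    · simp only [norm_mul, norm_ofNat]
      calc _ ≤ 2 * 1 * (C₁ * (1 + |s.im|) ^ (1 + δ - 1 / 2) *
            Real.exp (-(Real.pi * |s.im| / 2))) * Real.exp (Real.pi * |s.im| / 2) * C₂ := by
            gcongr
        _ = 2 * C₁ * C₂ * (1 + |s.im|) ^ (1 + δ - 1 / 2) *
            (Real.exp (-(Real.pi * |s.im| / 2)) * Real.exp (Real.pi * |s.im| / 2)) := by ring
        _ ≤ _ := by
            rw [e5, mul_one, show 1 + δ - 1 / 2 = 1 / 2 + δ by ring]
            gcongr
            linarith [abs_nonneg M]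
    · intro n h3
      have := congrArg re h3
      rw [hwre] at this
      simp at this
      have h4 : (0 : ℝ) ≤ n := Nat.cast_nonneg n
      linarith
    · intro h3
      have := congrArg re h3
      rw [hwre] at this
      simp at this
      linarith

lemma one_add_mul_exp_neg_sq_le {x : ℝ} : (1 + x) * Real.exp (-x ^ 2) ≤ 2 := by
  have h := Real.add_one_le_exp (x ^ 2)
  rw [Real.exp_neg, ← div_eq_mul_inv, div_le_iff₀ (Real.exp_pos _)]
  nlinarith [sq_nonneg (x - 1 / 4)]

lemma exists_norm_riemannZeta_strip_le {δ : ℝ} (hδ : 0 < δ) (hδ' : δ ≤ 1 / 2) :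
    ∃ C > 0, ∀ t : ℝ, 1 ≤ t → ∀ σ : ℝ, -δ ≤ σ → σ ≤ 1 + δ →
      ‖riemannZeta (σ + I * t)‖ ≤ C * t ^ ((1 + δ - σ) / 2) := by
  obtain ⟨C₁, hC₁, h₁⟩ := exists_norm_riemannZeta_left_le hδ
  obtain ⟨C₂, hC₂, h₂⟩ := exists_norm_riemannZeta_right_le hδ
  obtain ⟨C₃, h₃⟩ := exists_norm_riemannZeta_le_exp
  refine ⟨5 * (12 * C₁ * Real.exp 4 + C₂ * Real.exp 4), by positivity, fun t₀ ht₀ σ hσ hσ' => ?_⟩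
  have ht0 : 0 < t₀ := by linarith
  set G : ℂ → ℂ := fun s => riemannZeta₁ s / (s + 2) * (t₀ : ℂ) ^ (s / 2) * exp ((s - I * t₀) ^ 2)
    with hG
  have hz1 : ∀ s : ℂ, s ≠ 1 → riemannZeta₁ s = (s - 1) * riemannZeta s := fun s hs => by
    rw [riemannZeta_eq_inv_sub_mul hs, mul_inv_cancel_left₀ (sub_ne_zero.2 hs)]
  have hexp : ∀ s : ℂ, ‖exp ((s - I * t₀) ^ 2)‖ = Real.exp (s.re ^ 2 - (s.im - t₀) ^ 2) :=
    fun s => by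
      rw [norm_exp]
      congr 1
      simp [pow_two]
  have hpow : ∀ s : ℂ, ‖(t₀ : ℂ) ^ (s / 2)‖ = t₀ ^ (s.re / 2) := fun s => by
    rw [norm_cpow_eq_rpow_re_of_pos ht0]; simp
  have hnormG : ∀ s : ℂ, s ≠ 1 → ‖G s‖ = ‖s - 1‖ / ‖s + 2‖ * ‖riemannZeta s‖ * t₀ ^ (s.re / 2) *
      Real.exp (s.re ^ 2 - (s.im - t₀) ^ 2) := fun s hs => by
    rw [hG]
    simp only [norm_mul, norm_div, hexp, hpow, hz1 s hs]
    ring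
  have hratio : ∀ s : ℂ, -(1 / 2) ≤ s.re → ‖s - 1‖ / ‖s + 2‖ ≤ 3 := fun s hs => by
    have h4 : 3 / 2 ≤ ‖s + 2‖ := by
      refine le_trans ?_ (re_le_norm _)
      simp; linarith
    rw [div_le_iff₀ (by linarith)]
    have := norm_sub_le (s + 2) 3
    rw [show s + 2 - 3 = s - 1 by ring, norm_ofNat] at this
    linarith
  have hB0 : 0 < t₀ ^ ((1 + δ) / 2) := by positivity
  have hmain : ‖G (σ + I * t₀)‖ ≤
      (12 * C₁ * Real.exp 4 + C₂ * Real.exp 4) * t₀ ^ ((1 + δ) / 2) := by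
    refine PhragmenLindelof.vertical_strip (a := -δ) (b := 1 + δ) ?_ ?_ ?_ ?_ ?_ ?_
    · apply DifferentiableOn.diffContOnCl
      have hcl : closure (re ⁻¹' Ioo (-δ) (1 + δ)) ⊆ re ⁻¹' Icc (-δ) (1 + δ) :=
        closure_minimal (preimage_mono Ioo_subset_Icc_self) (isClosed_Icc.preimage continuous_re)
      intro s hs
      have hs1 : -δ ≤ s.re := (hcl hs).1
      have hs2 : s + 2 ≠ 0 := fun h => by
        have := congrArg re h
        simp at this
        linarith
      refine DifferentiableAt.differentiableWithinAt ?_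
      refine DifferentiableAt.mul (DifferentiableAt.mul ?_ ?_) (by fun_prop)
      · exact (differentiable_riemannZeta₁ s).div (by fun_prop) hs2
      · exact DifferentiableAt.const_cpow (by fun_prop) (Or.inl (by exact_mod_cast ht0.ne'))
    · refine ⟨1, ?_, 2, ?_⟩
      · rw [lt_div_iff₀ (by linarith)]
        linarith [Real.pi_gt_three]
      · refine IsBigO.of_bound (3 * C₃ * t₀ ^ (3 / 4 : ℝ) * Real.exp 4) ?_
        have hev : ∀ᶠ s : ℂ in comap (_root_.abs ∘ im) atTop, 1 ≤ |s.im| :=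
          tendsto_comap.eventually (eventually_ge_atTop 1)
        filter_upwards [hev.filter_mono inf_le_left,
          (mem_principal_self (re ⁻¹' Ioo (-δ) (1 + δ)) |> mem_inf_of_right :
            re ⁻¹' Ioo (-δ) (1 + δ) ∈ _)] with s hs hs2
        have hs2 : -δ < s.re ∧ s.re < 1 + δ := hs2
        have hne : s ≠ 1 := fun h => by rw [h] at hs; norm_num at hs
        have e1 := h₃ s (by linarith) (by linarith) hs
        have e2 := hratio s (by linarith)
        have e3 : t₀ ^ (s.re / 2) ≤ t₀ ^ (3 / 4 : ℝ) :=
          Real.rpow_le_rpow_of_exponent_le ht₀ (by linarith)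
        have e4 : Real.exp (s.re ^ 2 - (s.im - t₀) ^ 2) ≤ Real.exp 4 := by
          gcongr; nlinarith [sq_nonneg (s.im - t₀)]
        have e5 : Real.exp (2 * |s.im|) ≤ Real.exp (2 * Real.exp (1 * |s.im|)) := by
          gcongr; linarith [Real.add_one_le_exp (1 * |s.im|)]
        rw [hnormG s hne, Real.norm_of_nonneg (Real.exp_pos _).le]
        have hC₃ : 0 ≤ C₃ * Real.exp (2 * |s.im|) := (norm_nonneg _).trans e1
        calc _ ≤ 3 * (C₃ * Real.exp (2 * |s.im|)) * t₀ ^ (3 / 4 : ℝ) * Real.exp 4 := by gcongr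
          _ = 3 * C₃ * t₀ ^ (3 / 4 : ℝ) * Real.exp 4 * Real.exp (2 * |s.im|) := by ring
          _ ≤ _ := by
            have : 0 ≤ C₃ := nonneg_of_mul_nonneg_left hC₃ (Real.exp_pos _)
            gcongr
    · intro s hs
      have hne : s ≠ 1 := fun h => by rw [h] at hs; norm_num at hs; linarith
      rw [hnormG s hne, hs]
      have e1 := h₁ s hs
      have e2 := hratio s (by linarith)
      set x := |s.im - t₀| with hx
      have hx0 : 0 ≤ x := abs_nonneg _
      have hx2 : (s.im - t₀) ^ 2 = x ^ 2 := (sq_abs _).symm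
      have e3 : (1 + |s.im|) ^ (1 / 2 + δ) ≤ 2 * t₀ ^ (1 / 2 + δ) * (1 + x) := by
        have hle : 1 + |s.im| ≤ (2 * t₀) * (1 + x) := by
          have : |s.im| ≤ x + t₀ := by
            have := abs_add_le (s.im - t₀) t₀
            rw [sub_add_cancel, abs_of_pos ht0] at this
            exact this
          nlinarith
        refine (Real.rpow_le_rpow (by positivity) hle (by linarith)).trans ?_
        rw [Real.mul_rpow (by positivity) (by positivity), Real.mul_rpow (by norm_num) ht0.le]
        have a1 : (2 : ℝ) ^ (1 / 2 + δ) ≤ 2 := by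
          have := Real.rpow_le_rpow_of_exponent_le (x := 2) (by norm_num)
            (show 1 / 2 + δ ≤ 1 by linarith)
          rwa [Real.rpow_one] at this
        have a2 : (1 + x) ^ (1 / 2 + δ) ≤ 1 + x := by
          have := Real.rpow_le_rpow_of_exponent_le (x := 1 + x) (by linarith)
            (show 1 / 2 + δ ≤ 1 by linarith)
          rwa [Real.rpow_one] at this
        gcongr
      have e4 : Real.exp ((-δ) ^ 2 - (s.im - t₀) ^ 2) ≤ Real.exp 4 * Real.exp (-x ^ 2) := by
        rw [← Real.exp_add, hx2]; gcongr; nlinarith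
      have e5 : t₀ ^ (1 / 2 + δ) * t₀ ^ (-δ / 2) = t₀ ^ ((1 + δ) / 2) := by
        rw [← Real.rpow_add ht0]; congr 1; ring
      have e6 : (1 + x) * Real.exp (-x ^ 2) ≤ 2 := one_add_mul_exp_neg_sq_le
      calc _ ≤ 3 * (C₁ * (2 * t₀ ^ (1 / 2 + δ) * (1 + x))) * t₀ ^ (-δ / 2) *
            (Real.exp 4 * Real.exp (-x ^ 2)) := by
            gcongr
            exact e1.trans (by gcongr)
        _ = 6 * C₁ * Real.exp 4 * (t₀ ^ (1 / 2 + δ) * t₀ ^ (-δ / 2)) *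
            ((1 + x) * Real.exp (-x ^ 2)) := by ring
        _ ≤ 6 * C₁ * Real.exp 4 * t₀ ^ ((1 + δ) / 2) * 2 := by rw [e5]; gcongr
        _ ≤ _ := by
          have : 0 ≤ C₂ * Real.exp 4 * t₀ ^ ((1 + δ) / 2) := by positivity
          linarith
    · intro s hs
      have hne : s ≠ 1 := fun h => by rw [h] at hs; norm_num at hs; linarith
      rw [hnormG s hne, hs]
      have e1 := h₂ s hs
      have e2 : ‖s - 1‖ / ‖s + 2‖ ≤ 1 := by
        refine div_le_one_of_le₀ ?_ (norm_nonneg _)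
        rw [← sq_le_sq₀ (norm_nonneg _) (norm_nonneg _), ← normSq_eq_norm_sq,
          ← normSq_eq_norm_sq, normSq_apply, normSq_apply]
        simp [hs]
        nlinarith
      have e4 : Real.exp ((1 + δ) ^ 2 - (s.im - t₀) ^ 2) ≤ Real.exp 4 := by
        gcongr; nlinarith [sq_nonneg (s.im - t₀)]
      calc _ ≤ 1 * C₂ * t₀ ^ ((1 + δ) / 2) * Real.exp 4 := by gcongr
        _ ≤ _ := by
          have : 0 ≤ 12 * C₁ * Real.exp 4 * t₀ ^ ((1 + δ) / 2) := by positivity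
          linarith
    · simpa using hσ
    · simpa using hσ'
  set s : ℂ := σ + I * t₀ with hs
  have hre : s.re = σ := by simp [hs]
  have him : s.im = t₀ := by simp [hs]
  have hne : s ≠ 1 := fun h => by rw [h] at him; simp at him; linarith
  rw [hnormG s hne, hre, him, sub_self] at hmain
  have e1 : 1 / 5 ≤ ‖s - 1‖ / ‖s + 2‖ := by
    have a1 : t₀ ≤ ‖s - 1‖ := by
      refine le_trans ?_ (im_le_norm _)
      simp [him]
    have a2 : ‖s + 2‖ ≤ 4 + t₀ := by
      refine (norm_le_abs_re_add_abs_im _).trans ?_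
      simp only [add_re, re_ofNat, add_im, im_ofNat, hre, him, add_zero, abs_of_pos ht0]
      rw [abs_of_nonneg (by linarith)]
      linarith
    have a3 : 0 < ‖s + 2‖ := by
      refine lt_of_lt_of_le ?_ (im_le_norm _)
      simp [him, ht0]
    rw [div_le_div_iff₀ (by norm_num) a3]
    linarith
  have e2 : 1 ≤ Real.exp (σ ^ 2 - 0 ^ 2) := Real.one_le_exp (by nlinarith [sq_nonneg σ])
  have e3 : t₀ ^ ((1 + δ - σ) / 2) * t₀ ^ (σ / 2) = t₀ ^ ((1 + δ) / 2) := by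
    rw [← Real.rpow_add ht0]; congr 1; ring
  have e4 : 0 < t₀ ^ (σ / 2) := by positivity
  refine le_of_mul_le_mul_right ?_ e4
  rw [mul_assoc _ _ (t₀ ^ (σ / 2)), e3]
  have e5 : 1 / 5 * ‖riemannZeta s‖ * t₀ ^ (σ / 2) * 1 ≤
      ‖s - 1‖ / ‖s + 2‖ * ‖riemannZeta s‖ * t₀ ^ (σ / 2) * Real.exp (σ ^ 2 - 0 ^ 2) := by
    gcongr
  linarith

end ConvexityBound

section ContourShift

open Complex Set

/-- The holomorphic continuation of `phase` to the slit plane. -/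
noncomputable def cphase (w : ℂ) : ℂ := exp (I / 2 * (w * (log w - (1 + Real.log (2 * Real.pi)))))

lemma cphase_ofReal {t : ℝ} (ht : 0 < t) : cphase t = phase t := by
  rw [cphase, phase, ← ofReal_log ht.le]
  congr 1
  push_cast
  ring

lemma norm_phase (t : ℝ) : ‖phase t‖ = 1 := by
  rw [phase, mul_comm, norm_exp_ofReal_mul_I]

lemma exists_cphase_eq {t η : ℝ} (ht : 2 ≤ t) (hη : 0 ≤ η) (hη' : η ≤ 1) :
    ∃ r : ℂ, ‖r‖ ≤ 2 / t ∧ cphase (t - I * η) =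
      phase t * (((t / (2 * Real.pi)) ^ (η / 2) : ℝ) : ℂ) * exp r := by
  have ht0 : 0 < t := by linarith
  have htc : (t : ℂ) ≠ 0 := by exact_mod_cast ht0.ne'
  set u : ℂ := -I * (η / t : ℝ) with hu
  have hun : ‖u‖ = η / t := by
    rw [hu, norm_mul, norm_neg, norm_I, one_mul, norm_real, Real.norm_of_nonneg (by positivity)]
  have hu2 : ‖u‖ ≤ 1 / 2 := by
    rw [hun, div_le_div_iff₀ ht0 (by norm_num)]; linarith
  have htu : (t : ℂ) * u = -I * η := by
    rw [hu]; push_cast; field_simp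
  clear_value u
  have hw : (t : ℂ) - I * η = t * (1 + u) := by linear_combination -htu
  have h1u : 1 + u ≠ 0 := fun h => by
    have : u = -1 := by linear_combination h
    rw [this, norm_neg, norm_one] at hu2
    norm_num at hu2
  have hlog : log (t - I * η) = Real.log t + log (1 + u) := by
    rw [hw, log_ofReal_mul ht0 h1u]
  have hl := norm_log_one_add_sub_self_le (z := u) (by linarith)
  have hl2 : ‖log (1 + u) - u‖ ≤ ‖u‖ ^ 2 := by
    refine hl.trans ?_
    have : (1 - ‖u‖)⁻¹ ≤ 2 := by
      rw [inv_le_comm₀ (by linarith) (by norm_num)]; linarith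
    nlinarith [sq_nonneg ‖u‖]
  refine ⟨I / 2 * (t * (u ^ 2 + (1 + u) * (log (1 + u) - u))), ?_, ?_⟩
  · have h3 : ‖u ^ 2 + (1 + u) * (log (1 + u) - u)‖ ≤ 4 * ‖u‖ ^ 2 := by
      refine (norm_add_le _ _).trans ?_
      rw [norm_pow, norm_mul]
      have h4 : ‖1 + u‖ ≤ 3 / 2 := (norm_add_le _ _).trans (by rw [norm_one]; linarith)
      have : ‖1 + u‖ * ‖log (1 + u) - u‖ ≤ 3 / 2 * ‖u‖ ^ 2 := by gcongr
      nlinarith [sq_nonneg ‖u‖]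
    rw [norm_mul, norm_mul, norm_div, norm_I, norm_ofNat, norm_real, Real.norm_of_nonneg ht0.le]
    calc _ ≤ 1 / 2 * (t * (4 * ‖u‖ ^ 2)) := by gcongr
      _ = 2 * η ^ 2 / t := by rw [hun]; field_simp; norm_num
      _ ≤ _ := by
        gcongr
        nlinarith
  · have hpi := Real.pi_pos
    rw [Real.rpow_def_of_pos (by positivity), Real.log_div ht0.ne' (by positivity), ofReal_exp,
      phase, cphase, ← exp_add, ← exp_add, hlog]
    congr 1
    have hII : I * I = -1 := I_mul_I
    push_cast
    linear_combination (I / 2 * log (1 + u)) * hw + I / 2 * htu -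
      (η / 2 * (Real.log t - Real.log (2 * Real.pi))) * hII

lemma norm_cphase_le {t η : ℝ} (ht : 2 ≤ t) (hη : 0 ≤ η) (hη' : η ≤ 1) :
    ‖cphase (t - I * η)‖ ≤ 3 * t ^ (η / 2) := by
  obtain ⟨r, hr, h⟩ := exists_cphase_eq ht hη hη'
  have hpi := Real.pi_gt_three
  rw [h, norm_mul, norm_mul, norm_phase, one_mul, norm_real,
    Real.norm_of_nonneg (by positivity), norm_exp, mul_comm]
  have h1 : Real.exp r.re ≤ 3 := by
    have h2 : r.re ≤ 1 := ((re_le_norm r).trans hr).trans (by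
      rw [div_le_one (by linarith)]; exact ht)
    linarith [Real.exp_le_exp.2 h2, Real.exp_one_lt_d9]
  have h2 : (t / (2 * Real.pi)) ^ (η / 2) ≤ t ^ (η / 2) := by
    apply Real.rpow_le_rpow (by positivity) _ (by linarith)
    exact div_le_self (by linarith) (by linarith)
  gcongr

lemma norm_cphase_sub_le {t η : ℝ} (ht : 2 ≤ t) (hη : 0 ≤ η) (hη' : η ≤ 1) :
    ‖cphase (t - I * η) - phase t * (((t / (2 * Real.pi)) ^ (η / 2) : ℝ) : ℂ)‖ ≤
      t ^ (η / 2) * (4 / t) := by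
  obtain ⟨r, hr, h⟩ := exists_cphase_eq ht hη hη'
  have hpi := Real.pi_gt_three
  have h2 : (t / (2 * Real.pi)) ^ (η / 2) ≤ t ^ (η / 2) := by
    apply Real.rpow_le_rpow (by positivity) _ (by linarith)
    exact div_le_self (by linarith) (by linarith)
  have h3 : ‖exp r - 1‖ ≤ 4 / t := by
    refine (norm_exp_sub_one_le (hr.trans (by rw [div_le_one (by linarith)]; exact ht))).trans ?_
    calc 2 * ‖r‖ ≤ 2 * (2 / t) := by gcongr
      _ = _ := by ring
  rw [h, ← mul_sub_one, norm_mul, norm_mul, norm_phase, one_mul, norm_real,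
    Real.norm_of_nonneg (by positivity)]
  gcongr

lemma continuousOn_phase : ContinuousOn phase (Ioi 0) := by
  unfold phase
  refine ContinuousOn.cexp (continuousOn_const.mul (continuous_ofReal.comp_continuousOn ?_))
  refine ContinuousOn.mul (by fun_prop) (ContinuousOn.sub ?_ continuousOn_const)
  exact Real.continuousOn_log.mono fun x hx => ne_of_gt hx

lemma continuous_zeta_line {σ : ℝ} (hσ : σ ≠ 1) :
    Continuous fun t : ℝ => riemannZeta (σ + I * t) :=
  continuous_iff_continuousAt.2 fun t =>
    ContinuousAt.comp (f := fun t : ℝ => (σ + I * t : ℂ))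
      (differentiableAt_riemannZeta fun h => hσ (by
        have := congrArg re h
        simpa using this)).continuousAt (by fun_prop)

lemma exists_norm_integral_eTheta_sub_le {δ : ℝ} (hδ : 0 < δ) (hδ' : δ ≤ 1 / 2) :
    ∃ C > 0, ∀ T : ℝ, 100 ≤ T →
      ‖∫ t in T..(2 * T), eTheta t * riemannZeta (1 / 2 + I * t)‖ ≤
      ‖∫ t in T..(2 * T), cphase t * riemannZeta (1 / 2 + I * t)‖ + C * T ^ (1 / 4 + δ / 2) := by
  obtain ⟨C, hC, h⟩ := exists_norm_riemannZeta_strip_le hδ hδ'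
  refine ⟨200 * C, by positivity, fun T hT => ?_⟩
  set κ := exp (I * ((-(Real.pi / 8) : ℝ) : ℂ)) with hκ
  have hκn : ‖κ‖ = 1 := by rw [hκ, mul_comm, norm_exp_ofReal_mul_I]
  have hT0 : 0 < T := by linarith
  have hmem : ∀ t ∈ Set.uIcc T (2 * T), T ≤ t ∧ t ≤ 2 * T := fun t ht => by
    rwa [uIcc_of_le (by linarith)] at ht
  have hphc : ContinuousOn (fun t : ℝ => cphase t) (uIcc T (2 * T)) := by
    refine (continuousOn_phase.mono fun t ht => ?_).congr fun t ht => cphase_ofReal ?_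
    · exact lt_of_lt_of_le hT0 (hmem t ht).1
    · exact lt_of_lt_of_le hT0 (hmem t ht).1
  have hi1 : IntervalIntegrable (fun t : ℝ => eTheta t * riemannZeta (1 / 2 + I * t)) volume
      T (2 * T) := (continuous_eTheta.mul continuous_zeta_half).intervalIntegrable _ _
  have hi2 : IntervalIntegrable (fun t : ℝ => κ * (cphase t * riemannZeta (1 / 2 + I * t))) volume
      T (2 * T) := (continuousOn_const.mul
        (hphc.mul continuous_zeta_half.continuousOn)).intervalIntegrable
  have h1 : ‖∫ t in T..(2 * T), (eTheta t * riemannZeta (1 / 2 + I * t) -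
      κ * (cphase t * riemannZeta (1 / 2 + I * t)))‖ ≤
      100 / T * (C * (2 * T) ^ (1 / 4 + δ / 2)) * |2 * T - T| := by
    refine intervalIntegral.norm_integral_le_of_norm_le_const fun t ht => ?_
    rw [uIoc_of_le (by linarith)] at ht
    have ht1 : 0 < t := by linarith [ht.1]
    have e1 := h t (by linarith [ht.1]) (1 / 2) (by linarith) (by linarith)
    have e2 := norm_eTheta_sub_le t (by linarith [ht.1])
    rw [← hκ, ← cphase_ofReal ht1] at e2
    push_cast at e1
    rw [← mul_assoc, ← sub_mul, norm_mul]
    have e3 : 100 / t ≤ 100 / T := by gcongr; exact ht.1.le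
    have e4 : t ^ ((1 + δ - 1 / 2) / 2) ≤ (2 * T) ^ (1 / 4 + δ / 2) := by
      rw [show (1 + δ - 1 / 2) / 2 = 1 / 4 + δ / 2 by ring]
      gcongr
      exact ht.2
    exact mul_le_mul (e2.trans e3) (e1.trans (by gcongr)) (norm_nonneg _) (by positivity)
  have h2 : (2 * T) ^ (1 / 4 + δ / 2) ≤ 2 * T ^ (1 / 4 + δ / 2) := by
    rw [Real.mul_rpow (by norm_num) hT0.le]
    have := Real.rpow_le_rpow_of_exponent_le (x := 2) (by norm_num)
      (show 1 / 4 + δ / 2 ≤ 1 by linarith)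
    rw [Real.rpow_one] at this
    gcongr
  have h3 : 100 / T * (C * (2 * T) ^ (1 / 4 + δ / 2)) * |2 * T - T| ≤
      200 * C * T ^ (1 / 4 + δ / 2) := by
    rw [show 2 * T - T = T by ring, abs_of_pos hT0]
    calc _ ≤ 100 / T * (C * (2 * T ^ (1 / 4 + δ / 2))) * T := by gcongr
      _ = _ := by field_simp; norm_num
  rw [intervalIntegral.integral_sub hi1 hi2, intervalIntegral.integral_const_mul] at h1
  have h4 := norm_sub_norm_le (∫ t in T..(2 * T), eTheta t * riemannZeta (1 / 2 + I * t))
    (κ * ∫ t in T..(2 * T), cphase t * riemannZeta (1 / 2 + I * t))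
  rw [norm_mul, hκn, one_mul] at h4
  linarith

lemma exists_norm_integral_horizontal_le {δ : ℝ} (hδ : 0 < δ) (hδ' : δ ≤ 1 / 2) :
    ∃ C > 0, ∀ T : ℝ, 2 ≤ T →
      ‖∫ x in (1 / 2 : ℝ)..(1 + δ), cphase (-I * ((x + T * I : ℂ) - 1 / 2)) *
        riemannZeta (x + T * I)‖ ≤ C * T ^ (1 / 4 + δ / 2) := by
  obtain ⟨C, hC, h⟩ := exists_norm_riemannZeta_strip_le hδ hδ'
  refine ⟨3 * C, by positivity, fun T hT => ?_⟩
  have hT0 : 0 < T := by linarith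
  have h1 : ‖∫ x in (1 / 2 : ℝ)..(1 + δ), cphase (-I * ((x + T * I : ℂ) - 1 / 2)) *
        riemannZeta (x + T * I)‖ ≤ 3 * C * T ^ (1 / 4 + δ / 2) * |1 + δ - 1 / 2| := by
    refine intervalIntegral.norm_integral_le_of_norm_le_const fun x hx => ?_
    rw [uIoc_of_le (by linarith)] at hx
    have e1 := h T (by linarith) x (by linarith [hx.1]) hx.2
    have e2 := norm_cphase_le (η := x - 1 / 2) hT (by linarith [hx.1]) (by linarith [hx.2])
    rw [show -I * ((x + T * I : ℂ) - 1 / 2) = T - I * ((x - 1 / 2 : ℝ) : ℂ) by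
      push_cast; linear_combination (-T : ℂ) * I_mul_I, norm_mul, mul_comm (T : ℂ) I]
    calc _ ≤ 3 * T ^ ((x - 1 / 2) / 2) * (C * T ^ ((1 + δ - x) / 2)) := by gcongr
      _ = 3 * C * (T ^ ((x - 1 / 2) / 2) * T ^ ((1 + δ - x) / 2)) := by ring
      _ = _ := by rw [← Real.rpow_add hT0]; congr 2; ring
  refine h1.trans (mul_le_of_le_one_right (by positivity) ?_)
  rw [abs_of_nonneg] <;> linarith

lemma exists_norm_integral_cphase_le {δ : ℝ} (hδ : 0 < δ) (hδ' : δ ≤ 1 / 2) :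
    ∃ C > 0, ∀ T : ℝ, 2 ≤ T →
      ‖∫ t in T..(2 * T), cphase t * riemannZeta (1 / 2 + I * t)‖ ≤
      ‖∫ t in T..(2 * T), cphase (t - I * (1 / 2 + δ : ℝ)) * riemannZeta ((1 + δ : ℝ) + I * t)‖ +
        C * T ^ (1 / 4 + δ / 2) := by
  obtain ⟨C, hC, h⟩ := exists_norm_integral_horizontal_le hδ hδ'
  refine ⟨3 * C, by positivity, fun T hT => ?_⟩
  have hT0 : 0 < T := by linarith
  set f : ℂ → ℂ := fun s => cphase (-I * (s - 1 / 2)) * riemannZeta s with hf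
  have hrect := integral_boundary_rect_eq_zero_of_differentiableOn f ((1 / 2 : ℝ) + T * I)
    ((1 + δ : ℝ) + (2 * T : ℝ) * I) (fun s hs => by
      rw [mem_reProdIm] at hs
      simp only [add_re, ofReal_re, mul_re, I_re, mul_zero, ofReal_im, I_im, mul_one, sub_self,
        add_zero, add_im, mul_im, zero_add] at hs
      rw [uIcc_of_le (by linarith), uIcc_of_le (by linarith)] at hs
      obtain ⟨⟨h1, h2⟩, h3, h4⟩ := hs
      have him : 0 < s.im := by linarith
      refine DifferentiableAt.differentiableWithinAt (DifferentiableAt.mul ?_ ?_)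
      · unfold cphase
        have hsl : -I * (s - 1 / 2) ∈ slitPlane := Or.inl (by simpa using him)
        refine DifferentiableAt.cexp (DifferentiableAt.const_mul (DifferentiableAt.mul
          (by fun_prop) (DifferentiableAt.sub_const ?_ _)) _)
        exact DifferentiableAt.clog (by fun_prop) hsl
      · refine differentiableAt_riemannZeta fun h => ?_
        rw [h] at him
        simp at him)
  simp only [add_re, ofReal_re, mul_re, I_re, mul_zero, ofReal_im, I_im, mul_one, sub_self,
        add_zero, add_im, mul_im, zero_add] at hrect
  have hl : (∫ y in T..(2 * T), f ((1 / 2 : ℝ) + y * I)) =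
      ∫ t in T..(2 * T), cphase t * riemannZeta (1 / 2 + I * t) := by
    refine intervalIntegral.integral_congr fun t _ => ?_
    simp only [hf]
    congr 2
    · push_cast; linear_combination (-t : ℂ) * I_mul_I
    · push_cast; ring
  have hr : (∫ y in T..(2 * T), f ((1 + δ : ℝ) + y * I)) =
      ∫ t in T..(2 * T), cphase (t - I * (1 / 2 + δ : ℝ)) * riemannZeta ((1 + δ : ℝ) + I * t) := by
    refine intervalIntegral.integral_congr fun t _ => ?_
    simp only [hf]
    congr 2
    · push_cast; linear_combination (-t : ℂ) * I_mul_I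
    · push_cast; ring
  rw [hl, hr] at hrect
  have hb1 := h T hT
  have hb2 := h (2 * T) (by linarith)
  have h2 : (2 * T) ^ (1 / 4 + δ / 2) ≤ 2 * T ^ (1 / 4 + δ / 2) := by
    rw [Real.mul_rpow (by norm_num) hT0.le]
    have := Real.rpow_le_rpow_of_exponent_le (x := 2) (by norm_num)
      (show 1 / 4 + δ / 2 ≤ 1 by linarith)
    rw [Real.rpow_one] at this
    gcongr
  have hb2' := hb2.trans (mul_le_mul_of_nonneg_left h2 hC.le)
  change ‖∫ x in (1 / 2 : ℝ)..(1 + δ), f (x + T * I)‖ ≤ _ at hb1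
  change ‖∫ x in (1 / 2 : ℝ)..(1 + δ), f (x + (2 * T : ℝ) * I)‖ ≤ _ at hb2'
  generalize (∫ x in (1 / 2 : ℝ)..(1 + δ), f (x + T * I)) = A at *
  generalize (∫ x in (1 / 2 : ℝ)..(1 + δ), f (x + (2 * T : ℝ) * I)) = B at *
  generalize (∫ t in T..(2 * T), cphase t * riemannZeta (1 / 2 + I * t)) = D at *
  generalize (∫ t in T..(2 * T), cphase (t - I * (1 / 2 + δ : ℝ)) *
    riemannZeta ((1 + δ : ℝ) + I * t)) = R at *
  have hD : D = R - I * (A - B) := by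
    simp only [smul_eq_mul] at hrect
    linear_combination I * hrect + (D - R) * I_mul_I
  rw [hD]
  have e1 := norm_sub_le R (I * (A - B))
  have e2 := norm_sub_le A B
  rw [norm_mul, norm_I, one_mul] at e1
  linarith

lemma exists_norm_integral_right_le {δ : ℝ} (hδ : 0 < δ) (hδ' : δ ≤ 1 / 2) :
    ∃ C > 0, ∀ T : ℝ, 2 ≤ T →
      ‖∫ t in T..(2 * T), cphase (t - I * (1 / 2 + δ : ℝ)) * riemannZeta ((1 + δ : ℝ) + I * t)‖ ≤
      ‖∫ t in T..(2 * T), phase t * (((t / (2 * Real.pi)) ^ (1 / 4 + δ / 2) : ℝ) : ℂ) *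
        riemannZeta ((1 + δ : ℝ) + I * t)‖ + C * T ^ (1 / 4 + δ / 2) := by
  obtain ⟨C, hC, h⟩ := exists_norm_riemannZeta_right_le hδ
  refine ⟨8 * C, by positivity, fun T hT => ?_⟩
  have hT0 : 0 < T := by linarith
  have hmem : ∀ t ∈ Set.uIcc T (2 * T), T ≤ t ∧ t ≤ 2 * T := fun t ht => by
    rwa [uIcc_of_le (by linarith)] at ht
  have hzc := (continuous_zeta_line (σ := 1 + δ) (by linarith)).continuousOn (s := uIcc T (2 * T))
  have hi1 : IntervalIntegrable (fun t : ℝ => cphase (t - I * (1 / 2 + δ : ℝ)) *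
      riemannZeta ((1 + δ : ℝ) + I * t)) volume T (2 * T) := by
    refine (ContinuousOn.mul ?_ hzc).intervalIntegrable
    unfold cphase
    refine ContinuousOn.cexp (continuousOn_const.mul (ContinuousOn.mul (by fun_prop)
      (ContinuousOn.sub (ContinuousOn.clog (by fun_prop) fun t ht => Or.inl ?_)
        continuousOn_const)))
    have := (hmem t ht).1
    simp
    linarith
  have hi2 : IntervalIntegrable (fun t : ℝ => phase t *
      (((t / (2 * Real.pi)) ^ (1 / 4 + δ / 2) : ℝ) : ℂ) *
        riemannZeta ((1 + δ : ℝ) + I * t)) volume T (2 * T) := by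
    refine (ContinuousOn.mul (ContinuousOn.mul ?_ ?_) hzc).intervalIntegrable
    · exact continuousOn_phase.mono fun t ht => lt_of_lt_of_le hT0 (hmem t ht).1
    · refine Continuous.comp_continuousOn continuous_ofReal (ContinuousOn.rpow_const (by fun_prop)
        fun t ht => Or.inr (by linarith))
  have h1 : ‖∫ t in T..(2 * T), (cphase (t - I * (1 / 2 + δ : ℝ)) *
      riemannZeta ((1 + δ : ℝ) + I * t) - phase t *
      (((t / (2 * Real.pi)) ^ (1 / 4 + δ / 2) : ℝ) : ℂ) * riemannZeta ((1 + δ : ℝ) + I * t))‖ ≤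
      (2 * T) ^ (1 / 4 + δ / 2) * (4 / T) * C * |2 * T - T| := by
    refine intervalIntegral.norm_integral_le_of_norm_le_const fun t ht => ?_
    rw [uIoc_of_le (by linarith)] at ht
    have ht1 : 0 < t := by linarith [ht.1]
    have e1 := h ((1 + δ : ℝ) + I * t) (by simp)
    have e2 := norm_cphase_sub_le (t := t) (η := 1 / 2 + δ) (by linarith [ht.1]) (by linarith)
      (by linarith)
    rw [show (1 / 2 + δ) / 2 = 1 / 4 + δ / 2 by ring] at e2
    rw [← sub_mul, norm_mul]
    have e3 : 4 / t ≤ 4 / T := by gcongr; exact ht.1.le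
    have e4 : t ^ (1 / 4 + δ / 2) ≤ (2 * T) ^ (1 / 4 + δ / 2) := by
      gcongr
      exact ht.2
    exact mul_le_mul (e2.trans (by gcongr)) e1 (norm_nonneg _) (by positivity)
  have h2 : (2 * T) ^ (1 / 4 + δ / 2) ≤ 2 * T ^ (1 / 4 + δ / 2) := by
    rw [Real.mul_rpow (by norm_num) hT0.le]
    have := Real.rpow_le_rpow_of_exponent_le (x := 2) (by norm_num)
      (show 1 / 4 + δ / 2 ≤ 1 by linarith)
    rw [Real.rpow_one] at this
    gcongr
  have h3 : (2 * T) ^ (1 / 4 + δ / 2) * (4 / T) * C * |2 * T - T| ≤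
      8 * C * T ^ (1 / 4 + δ / 2) := by
    rw [show 2 * T - T = T by ring, abs_of_pos hT0]
    calc _ ≤ 2 * T ^ (1 / 4 + δ / 2) * (4 / T) * C * T := by gcongr
      _ = _ := by field_simp; norm_num
  rw [intervalIntegral.integral_sub hi1 hi2] at h1
  have h4 := norm_sub_norm_le (∫ t in T..(2 * T), cphase (t - I * (1 / 2 + δ : ℝ)) *
      riemannZeta ((1 + δ : ℝ) + I * t)) (∫ t in T..(2 * T), phase t *
      (((t / (2 * Real.pi)) ^ (1 / 4 + δ / 2) : ℝ) : ℂ) * riemannZeta ((1 + δ : ℝ) + I * t))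
  linarith

end ContourShift

section Oscillatory

open Complex Set Filter Topology

/-- The normalized phase function: `t (log t - 1) + 1` at `t = exp u`. -/
noncomputable def psi (u : ℝ) : ℝ := Real.exp u * (u - 1) + 1

lemma hasDerivAt_psi (u : ℝ) : HasDerivAt psi (u * Real.exp u) u := by
  have := ((Real.hasDerivAt_exp u).mul ((hasDerivAt_id u).sub_const 1)).add_const 1
  convert! this using 1
  simp only [id]
  ring

lemma psi_pos {u : ℝ} (hu : u ≠ 0) : 0 < psi u := by
  have h1 := Real.add_one_lt_exp (neg_ne_zero.2 hu)
  have h2 : Real.exp u * Real.exp (-u) = 1 := by rw [← Real.exp_add]; simp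
  rw [psi]
  nlinarith [Real.exp_pos u]

lemma exists_psi_eq_sq_mul : ∃ p : ℝ → ℝ, ContDiff ℝ 3 p ∧ (∀ u, psi u = u ^ 2 * p u) ∧
    (∀ u, 0 < p u) ∧ ∀ u, 2 * p u + u * deriv p u = Real.exp u := by
  set F : ℂ → ℂ := fun z => exp z * (z - 1) + 1 with hF
  have hFd : Differentiable ℂ F := by rw [hF]; fun_prop
  set Q := dslope F 0
  have hQd : Differentiable ℂ Q := by
    rw [← differentiableOn_univ] at hFd ⊢
    exact (differentiableOn_dslope univ_mem).2 hFd
  set P := dslope Q 0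
  have hPd : Differentiable ℂ P := by
    rw [← differentiableOn_univ] at hQd ⊢
    exact (differentiableOn_dslope univ_mem).2 hQd
  have hF0 : F 0 = 0 := by simp [hF]
  have hQ0 : Q 0 = 0 := by
    have h : HasDerivAt F (exp 0 * (0 - 1) + exp 0 * 1) 0 :=
      ((hasDerivAt_exp 0).mul ((hasDerivAt_id (0 : ℂ)).sub_const 1)).add_const 1
    simp only [Q, dslope_same, h.deriv]
    simp
  have hFQ : ∀ z, F z = z ^ 2 * P z := fun z => by
    have h1 := sub_smul_dslope F 0 z
    have h2 := sub_smul_dslope Q 0 z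
    rw [hF0, sub_zero, sub_zero, smul_eq_mul] at h1
    rw [hQ0, sub_zero, sub_zero, smul_eq_mul] at h2
    rw [← h1, pow_two, mul_assoc]
    congr 1
    exact h2.symm
  have hpc : ContDiff ℝ 3 (fun u : ℝ => (P u).re) := (hPd.contDiff (n := 3)).real_of_complex
  have hpsi : ∀ u : ℝ, psi u = u ^ 2 * (P u).re := fun u => by
    have h1 : (psi u : ℂ) = F u := by simp [psi, hF]
    have h2 := hFQ u
    rw [← h1] at h2
    have h3 := congrArg re h2
    rw [ofReal_re, ← ofReal_pow, re_ofReal_mul] at h3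
    exact h3
  set p : ℝ → ℝ := fun u => (P u).re with hp
  have hpd : Differentiable ℝ p := hpc.differentiable (by norm_num)
  have hode : ∀ u, 2 * p u + u * deriv p u = Real.exp u := by
    have hc1 : Continuous fun u => 2 * p u + u * deriv p u :=
      (continuous_const.mul hpd.continuous).add
        (continuous_id.mul (hpc.continuous_deriv (by norm_num)))
    have := hc1.ext_on (dense_compl_singleton (0 : ℝ)) Real.continuous_exp (fun u hu => by
      have hu : u ≠ 0 := hu
      have h1 := hasDerivAt_psi u
      have h2 : HasDerivAt psi (2 * u * p u + u ^ 2 * deriv p u) u := by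
        rw [show psi = fun u => u ^ 2 * p u from funext hpsi]
        have := (hasDerivAt_pow 2 u).mul (hpd u).hasDerivAt
        convert! this using 1
        norm_num
      have h3 := h1.unique h2
      apply mul_left_cancel₀ hu
      linear_combination -h3)
    exact fun u => congrFun this u
  refine ⟨p, hpc, hpsi, fun u => ?_, hode⟩
  rcases eq_or_ne u 0 with rfl | hu
  · have := hode 0
    rw [Real.exp_zero] at this
    linarith
  · have h1 := psi_pos hu
    rw [hpsi u] at h1
    exact pos_of_mul_pos_right h1 (sq_nonneg u)

lemma norm_exp_I_mul (x : ℝ) : ‖exp (I * x)‖ = 1 := by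
  rw [mul_comm, norm_exp_ofReal_mul_I]

/-- First derivative test for oscillatory integrals. -/
lemma norm_integral_mul_exp_le {a b N : ℝ} (hab : a ≤ b) (hN : 0 < N) {q q' φ φ' : ℝ → ℝ}
    (hq : ∀ u ∈ Icc a b, HasDerivAt q (q' u) u) (hφ : ∀ u ∈ Icc a b, HasDerivAt φ (φ' u) u)
    (hq' : ContinuousOn q' (Icc a b)) (hφ' : ContinuousOn φ' (Icc a b)) :
    ‖∫ u in a..b, ((q u * φ' u : ℝ) : ℂ) * exp (I * ((N * φ u : ℝ) : ℂ))‖ ≤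
      (|q a| + |q b| + ∫ u in a..b, |q' u|) / N := by
  have hIN : I * (N : ℂ) ≠ 0 := mul_ne_zero I_ne_zero (by exact_mod_cast hN.ne')
  have hu : uIcc a b = Icc a b := uIcc_of_le hab
  have hqc : ContinuousOn q (Icc a b) := fun u h => (hq u h).continuousAt.continuousWithinAt
  have hφc : ContinuousOn φ (Icc a b) := fun u h => (hφ u h).continuousAt.continuousWithinAt
  have hec : ContinuousOn (fun u => exp (I * ((N * φ u : ℝ) : ℂ))) (Icc a b) :=
    ContinuousOn.cexp (continuousOn_const.mul
      (continuous_ofReal.comp_continuousOn (continuousOn_const.mul hφc)))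
  have hV : ∀ u ∈ uIcc a b, HasDerivAt (fun u => exp (I * ((N * φ u : ℝ) : ℂ)) / (I * N))
      ((φ' u : ℂ) * exp (I * ((N * φ u : ℝ) : ℂ))) u := fun u h => by
    rw [hu] at h
    have h1 := ((((hφ u h).const_mul N).ofReal_comp.const_mul I).cexp).div_const (I * N)
    convert! h1 using 1
    rw [eq_div_iff hIN]
    push_cast
    ring
  have hU : ∀ u ∈ uIcc a b, HasDerivAt (fun u => (q u : ℂ)) (q' u : ℂ) u := fun u h =>
    (hq u (hu ▸ h)).ofReal_comp
  have hparts := intervalIntegral.integral_mul_deriv_eq_deriv_mul hU hV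
    (by
      refine ContinuousOn.intervalIntegrable ?_
      rw [hu]
      exact continuous_ofReal.comp_continuousOn hq')
    (by
      refine ContinuousOn.intervalIntegrable ?_
      rw [hu]
      exact (continuous_ofReal.comp_continuousOn hφ').mul hec)
  have hV1 : ∀ u, ‖exp (I * ((N * φ u : ℝ) : ℂ)) / (I * N)‖ = 1 / N := fun u => by
    rw [norm_div, norm_exp_I_mul, norm_mul, norm_I, one_mul, norm_real, Real.norm_of_nonneg hN.le]
  have hI : ‖∫ u in a..b, (q' u : ℂ) * (exp (I * ((N * φ u : ℝ) : ℂ)) / (I * N))‖ ≤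
      ∫ u in a..b, |q' u| * (1 / N) := by
    refine intervalIntegral.norm_integral_le_of_norm_le hab (Eventually.of_forall fun u _ => ?_) ?_
    · rw [norm_mul, hV1, norm_real, Real.norm_eq_abs]
    · refine ContinuousOn.intervalIntegrable ?_
      rw [hu]
      exact hq'.abs.mul continuousOn_const
  rw [intervalIntegral.integral_mul_const] at hI
  have hre : (∫ u in a..b, ((q u * φ' u : ℝ) : ℂ) * exp (I * ((N * φ u : ℝ) : ℂ))) =
      ∫ u in a..b, (q u : ℂ) * ((φ' u : ℂ) * exp (I * ((N * φ u : ℝ) : ℂ))) := by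
    congr 1
    ext u
    push_cast
    ring
  rw [hre, hparts]
  refine (norm_sub_le _ _).trans ((add_le_add (norm_sub_le _ _) hI).trans (le_of_eq ?_))
  rw [norm_mul, norm_mul, hV1, hV1, norm_real, norm_real, Real.norm_eq_abs, Real.norm_eq_abs]
  ring

end Oscillatory

section Saddle

open Complex Set Filter Topology

lemma norm_integral_tail_le {a N α : ℝ} (ha : 0 ≤ a) (ha' : a ≤ 1) (hN : 0 < N)
    (hα : 1 ≤ α ∨ α ≤ -2) :
    ‖∫ u in α..(α + Real.log 2), ((Real.exp ((1 + a) * u) : ℝ) : ℂ) *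
      exp (I * ((N * psi u : ℝ) : ℂ))‖ ≤ 7 * Real.exp (a * α) / N := by
  have hl1 := Real.log_two_lt_d9
  have hl0 := Real.log_two_gt_d9
  have habs : ∀ u ∈ Icc α (α + Real.log 2), 1 ≤ |u| := fun u hu => by
    rcases hα with h | h
    · exact (h.trans hu.1).trans (le_abs_self u)
    · have := neg_le_abs u
      linarith [hu.2]
  have hne : ∀ u ∈ Icc α (α + Real.log 2), u ≠ 0 := fun u hu h => by
    have := habs u hu
    rw [h, abs_zero] at this
    linarith
  have hexp : ∀ u ∈ Icc α (α + Real.log 2), Real.exp (a * u) ≤ 2 * Real.exp (a * α) :=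
    fun u hu => by
      have h2 : 2 * Real.exp (a * α) = Real.exp (Real.log 2 + a * α) := by
        rw [Real.exp_add, Real.exp_log two_pos]
      rw [h2, Real.exp_le_exp]
      have := hu.2
      nlinarith
  have hq : ∀ u ∈ Icc α (α + Real.log 2), HasDerivAt (fun u => Real.exp (a * u) / u)
      (Real.exp (a * u) * ((a * u - 1) / u ^ 2)) u := fun u hu => by
    have h1 : HasDerivAt (fun u : ℝ => a * u) a u := by
      simpa using (hasDerivAt_id u).const_mul a
    have := h1.exp.div (hasDerivAt_id u) (hne u hu)
    convert! this using 1
    simp only [id]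
    ring
  have hq'c : ContinuousOn (fun u => Real.exp (a * u) * ((a * u - 1) / u ^ 2))
      (Icc α (α + Real.log 2)) :=
    ContinuousOn.mul (by fun_prop) (ContinuousOn.div (by fun_prop) (by fun_prop)
      fun u hu => pow_ne_zero 2 (hne u hu))
  have key := norm_integral_mul_exp_le (b := α + Real.log 2) (by linarith) hN hq
    (fun u _ => hasDerivAt_psi u) hq'c (by fun_prop)
  have hcongr : (∫ u in α..(α + Real.log 2), ((Real.exp ((1 + a) * u) : ℝ) : ℂ) *
      exp (I * ((N * psi u : ℝ) : ℂ))) = ∫ u in α..(α + Real.log 2),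
      ((Real.exp (a * u) / u * (u * Real.exp u) : ℝ) : ℂ) * exp (I * ((N * psi u : ℝ) : ℂ)) := by
    refine intervalIntegral.integral_congr fun u hu => ?_
    rw [uIcc_of_le (by linarith)] at hu
    have := hne u hu
    congr 2
    rw [add_mul, one_mul, Real.exp_add]
    field_simp
  rw [hcongr]
  refine key.trans ?_
  have hE := Real.exp_pos (a * α)
  have hq0 : ∀ u ∈ Icc α (α + Real.log 2), |Real.exp (a * u) / u| ≤ Real.exp (a * u) :=
    fun u hu => by
      rw [abs_div, Real.abs_exp]
      exact div_le_self (Real.exp_pos _).le (habs u hu)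
  have b1 := hq0 α ⟨le_rfl, by linarith⟩
  have b2 := (hq0 (α + Real.log 2) ⟨by linarith, le_rfl⟩).trans
    (hexp (α + Real.log 2) ⟨by linarith, le_rfl⟩)
  have b3 : ‖∫ u in α..(α + Real.log 2), |Real.exp (a * u) * ((a * u - 1) / u ^ 2)|‖ ≤
      4 * Real.exp (a * α) * |α + Real.log 2 - α| := by
    refine intervalIntegral.norm_integral_le_of_norm_le_const fun u hu => ?_
    rw [uIoc_of_le (by linarith)] at hu
    have hu' := Ioc_subset_Icc_self hu
    have h1 := habs u hu'
    rw [Real.norm_eq_abs, abs_abs, abs_mul, Real.abs_exp]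
    have h2 : |(a * u - 1) / u ^ 2| ≤ 2 := by
      rw [abs_div, abs_pow, div_le_iff₀ (by positivity)]
      refine (abs_sub _ _).trans ?_
      rw [abs_mul, abs_of_nonneg ha, abs_one]
      nlinarith
    calc _ ≤ 2 * Real.exp (a * α) * 2 := by
          gcongr
          exact hexp u hu'
      _ = _ := by ring
  have b4 := (le_abs_self _).trans b3
  rw [add_sub_cancel_left, abs_of_pos (by linarith)] at b4
  gcongr
  nlinarith

/-- The complex Fresnel integral. -/
noncomputable def fresnel (y : ℝ) : ℂ := ∫ v in (0 : ℝ)..y, exp (I * ((v ^ 2 : ℝ) : ℂ))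

lemma continuous_fresnel_integrand : Continuous fun v : ℝ => exp (I * ((v ^ 2 : ℝ) : ℂ)) := by
  fun_prop

lemma fresnel_neg (y : ℝ) : fresnel (-y) = -fresnel y := by
  have := intervalIntegral.integral_comp_neg (a := 0) (b := y)
    fun v : ℝ => exp (I * ((v ^ 2 : ℝ) : ℂ))
  simp only [neg_sq, neg_zero] at this
  rw [fresnel, intervalIntegral.integral_symm, ← this, fresnel]

lemma norm_fresnel_sub_le {y z : ℝ} (hy : 0 < y) (hyz : y ≤ z) :
    ‖fresnel z - fresnel y‖ ≤ 1 / y := by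
  have hi := fun b c => continuous_fresnel_integrand.intervalIntegrable (μ := volume) b c
  rw [fresnel, fresnel, intervalIntegral.integral_interval_sub_left (hi _ _) (hi _ _)]
  have hpos : ∀ v ∈ Icc y z, 0 < v := fun v hv => lt_of_lt_of_le hy hv.1
  have hq : ∀ v ∈ Icc y z, HasDerivAt (fun v : ℝ => (2 * v)⁻¹) (-(2 / (2 * v) ^ 2)) v :=
    fun v hv => by
      have h1 : HasDerivAt (fun v : ℝ => 2 * v) 2 v := by
        simpa using (hasDerivAt_id v).const_mul 2
      have h2 := hpos v hv
      have := h1.inv (by positivity)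
      convert! this using 1
      ring
  have hφ : ∀ v ∈ Icc y z, HasDerivAt (fun v : ℝ => v ^ 2) (2 * v) v := fun v _ => by
    simpa using hasDerivAt_pow 2 v
  have hc : ContinuousOn (fun v : ℝ => -(2 / (2 * v) ^ 2)) (Icc y z) :=
    (ContinuousOn.div (by fun_prop) (by fun_prop) fun v hv => by
      have := hpos v hv
      positivity).neg
  have key := norm_integral_mul_exp_le hyz one_pos hq hφ hc (by fun_prop)
  have e1 : ∫ v in y..z, |-(2 / (2 * v) ^ 2)| = (2 * y)⁻¹ - (2 * z)⁻¹ := by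
    have h1 : ∫ v in y..z, |-(2 / (2 * v) ^ 2)| = ∫ v in y..z, -(-(2 / (2 * v) ^ 2)) := by
      refine intervalIntegral.integral_congr fun v _ => ?_
      simp only [abs_neg, neg_neg]
      exact abs_of_nonneg (by positivity)
    rw [h1, intervalIntegral.integral_neg, intervalIntegral.integral_eq_sub_of_hasDerivAt
      (fun v hv => hq v (uIcc_of_le hyz ▸ hv))]
    · ring
    · refine ContinuousOn.intervalIntegrable ?_
      rwa [uIcc_of_le hyz]
  have e2 : (∫ v in y..z, exp (I * ((v ^ 2 : ℝ) : ℂ))) =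
      ∫ v in y..z, (((2 * v)⁻¹ * (2 * v) : ℝ) : ℂ) * exp (I * ((1 * v ^ 2 : ℝ) : ℂ)) := by
    refine intervalIntegral.integral_congr fun v hv => ?_
    have := hpos v (uIcc_of_le hyz ▸ hv)
    simp only [one_mul]
    rw [inv_mul_cancel₀ (by positivity), ofReal_one, one_mul]
  have hz : 0 < z := lt_of_lt_of_le hy hyz
  rw [e2]
  refine key.trans (le_of_eq ?_)
  rw [e1, abs_of_pos (by positivity), abs_of_pos (by positivity)]
  field_simp
  ring

lemma exists_norm_fresnel_sub_le : ∃ c : ℂ, ∀ y : ℝ,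
    ‖fresnel y - Real.sign y * c‖ ≤ (‖c‖ + 4) / (1 + |y|) := by
  have hcau : CauchySeq fun n : ℕ => fresnel (n + 1) := by
    refine cauchySeq_of_le_tendsto_0 (fun n : ℕ => 2 * (1 / ((n : ℝ) + 1))) ?_ ?_
    · intro n m k hn hm
      have h1 : ∀ n : ℕ, k ≤ n → ‖fresnel (n + 1) - fresnel (k + 1)‖ ≤ 1 / ((k : ℝ) + 1) :=
        fun n hn => norm_fresnel_sub_le (by positivity) (by gcongr)
      have h2 := h1 n hn
      have h3 := h1 m hm
      have h4 := dist_triangle_right (fresnel (n + 1)) (fresnel (m + 1)) (fresnel (k + 1))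
      rw [dist_eq_norm (fresnel (n + 1)) (fresnel (k + 1)),
        dist_eq_norm (fresnel (m + 1)) (fresnel (k + 1))] at h4
      linarith
    · simpa using (tendsto_one_div_add_atTop_nhds_zero_nat (𝕜 := ℝ)).const_mul 2
  obtain ⟨c, hc⟩ := cauchySeq_tendsto_of_complete hcau
  refine ⟨c, ?_⟩
  have h1 : ∀ y : ℝ, 0 < y → ‖fresnel y - c‖ ≤ 1 / y := fun y hy => by
    refine le_of_tendsto ((tendsto_const_nhds.sub hc).norm) ?_
    filter_upwards [eventually_ge_atTop ⌈y⌉₊] with n hn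
    rw [norm_sub_rev]
    refine norm_fresnel_sub_le hy ?_
    have := Nat.ceil_le.1 hn
    linarith
  have h2 : ∀ y : ℝ, 0 < y → ‖fresnel y - c‖ ≤ (‖c‖ + 4) / (1 + y) := fun y hy => by
    rw [le_div_iff₀ (by linarith)]
    rcases le_total 1 y with h | h
    · have h3 := h1 y hy
      rw [le_div_iff₀ hy] at h3
      have := norm_nonneg c
      nlinarith [norm_nonneg (fresnel y - c)]
    · have h3 : ‖fresnel y‖ ≤ 1 := by
        have : ‖fresnel y‖ ≤ 1 * |y - 0| :=
          intervalIntegral.norm_integral_le_of_norm_le_const fun v _ => (norm_exp_I_mul _).le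
        rw [sub_zero, abs_of_pos hy] at this
        linarith
      have h4 : ‖c‖ ≤ 2 := by
        have h5 : ‖fresnel 1‖ ≤ 1 := by
          have : ‖fresnel 1‖ ≤ 1 * |(1 : ℝ) - 0| :=
            intervalIntegral.norm_integral_le_of_norm_le_const fun v _ => (norm_exp_I_mul _).le
          simpa using this
        have h6 := h1 1 one_pos
        have h7 := norm_sub_norm_le c (fresnel 1)
        rw [norm_sub_rev] at h7
        linarith
      have h5 := norm_sub_le (fresnel y) c
      nlinarith [norm_nonneg c, norm_nonneg (fresnel y - c)]
  intro y
  rcases lt_trichotomy y 0 with hy | rfl | hy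
  · have h3 := h2 (-y) (by linarith)
    rw [fresnel_neg] at h3
    rw [Real.sign_of_neg hy, abs_of_neg hy, ← norm_neg]
    have e : -(fresnel y - ((-1 : ℝ) : ℂ) * c) = -fresnel y - c := by
      push_cast
      ring
    rwa [e]
  · simp [fresnel, Real.sign_zero]
    positivity
  · rw [Real.sign_of_pos hy, abs_of_pos hy, ofReal_one, one_mul]
    exact h2 y hy

end Saddle

section Middle

open Complex Set Filter Topology

lemma continuous_psi : Continuous psi :=
  continuous_iff_continuousAt.2 fun u => (hasDerivAt_psi u).continuousAt

lemma exists_norm_integral_vanishing_le {g g' g'' : ℝ → ℝ} (hg : ∀ u, HasDerivAt g (g' u) u)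
    (hg' : ∀ u, HasDerivAt g' (g'' u) u) (hg'' : Continuous g'') (h0 : g 0 = 0) :
    ∃ C > 0, ∀ N > 0, ∀ x : ℝ, |x| ≤ 2 → ‖∫ u in (0 : ℝ)..x, ((g u * Real.exp u : ℝ) : ℂ) *
      exp (I * ((N * psi u : ℝ) : ℂ))‖ ≤ C / N := by
  have hgc : Continuous g := continuous_iff_continuousAt.2 fun u => (hg u).continuousAt
  have hgc' : Continuous g' := continuous_iff_continuousAt.2 fun u => (hg' u).continuousAt
  obtain ⟨M₁, hM₁⟩ := (isCompact_Icc (a := (-2 : ℝ)) (b := 2)).exists_bound_of_continuousOn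
    hgc'.continuousOn
  obtain ⟨M₂, hM₂⟩ := (isCompact_Icc (a := (-2 : ℝ)) (b := 2)).exists_bound_of_continuousOn
    hg''.continuousOn
  have hM₁0 : 0 ≤ M₁ := (norm_nonneg _).trans (hM₁ 0 (by norm_num))
  have hM₂0 : 0 ≤ M₂ := (norm_nonneg _).trans (hM₂ 0 (by norm_num))
  have hsub : ∀ u ∈ Icc (-2 : ℝ) 2, uIcc 0 u ⊆ Icc (-2 : ℝ) 2 := fun u hu =>
    uIcc_subset_Icc (by norm_num) hu
  have hq : ∀ u ∈ Icc (-2 : ℝ) 2, |g u| ≤ M₁ * |u| := fun u hu => by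
    have := (convex_uIcc (0 : ℝ) u).norm_image_sub_le_of_norm_hasDerivWithin_le
      (fun v _ => (hg v).hasDerivWithinAt) (fun v hv => hM₁ v (hsub u hu hv)) left_mem_uIcc
      right_mem_uIcc
    simpa [h0] using this
  have hk : ∀ u ∈ Icc (-2 : ℝ) 2, |g' u * u - g u| ≤ M₂ * u ^ 2 := fun u hu => by
    have := (convex_uIcc (0 : ℝ) u).norm_image_sub_le_of_norm_hasDerivWithin_le
      (C := M₂ * |u|) (f := fun v => g' v * v - g v) (f' := fun v => g'' v * v)
      (fun v _ => by
        have := ((hg' v).mul (hasDerivAt_id v)).sub (hg v)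
        refine HasDerivAt.hasDerivWithinAt ?_
        convert! this using 1
        simp) (fun v hv => by
        rw [norm_mul]
        refine mul_le_mul (hM₂ v (hsub u hu hv)) ?_ (norm_nonneg _) hM₂0
        have := abs_sub_left_of_mem_uIcc hv
        simpa using this) left_mem_uIcc right_mem_uIcc
    simp only [h0, mul_zero, sub_zero, Real.norm_eq_abs] at this
    rwa [mul_assoc, ← sq, sq_abs] at this
  have main : ∀ N > 0, ∀ α β : ℝ, -2 ≤ α → α ≤ β → β ≤ 2 → (0 < α ∨ β < 0) →
      ‖∫ u in α..β, ((g u * Real.exp u : ℝ) : ℂ) * exp (I * ((N * psi u : ℝ) : ℂ))‖ ≤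
        (2 * M₁ + 4 * M₂) / N := by
    intro N hN α β hα hαβ hβ h
    have hne : ∀ u ∈ Icc α β, u ≠ 0 := fun u hu hu0 => by
      rcases h with h | h <;> linarith [hu.1, hu.2]
    have hmem : ∀ u ∈ Icc α β, u ∈ Icc (-2 : ℝ) 2 := fun u hu => ⟨hα.trans hu.1, hu.2.trans hβ⟩
    have hd : ∀ u ∈ Icc α β, HasDerivAt (fun u => g u / u) ((g' u * u - g u) / u ^ 2) u :=
      fun u hu => by
        have := (hg u).div (hasDerivAt_id u) (hne u hu)
        convert! this using 1
        simp
    have hc : ContinuousOn (fun u => (g' u * u - g u) / u ^ 2) (Icc α β) :=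
      ContinuousOn.div (by fun_prop) (by fun_prop) fun u hu => pow_ne_zero 2 (hne u hu)
    have key := norm_integral_mul_exp_le hαβ hN hd (fun u _ => hasDerivAt_psi u) hc (by fun_prop)
    have hcongr : (∫ u in α..β, ((g u * Real.exp u : ℝ) : ℂ) * exp (I * ((N * psi u : ℝ) : ℂ))) =
        ∫ u in α..β, ((g u / u * (u * Real.exp u) : ℝ) : ℂ) *
          exp (I * ((N * psi u : ℝ) : ℂ)) := by
      refine intervalIntegral.integral_congr fun u hu => ?_
      rw [uIcc_of_le hαβ] at hu
      have := hne u hu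
      congr 2
      field_simp
    rw [hcongr]
    refine key.trans ?_
    have hb : ∀ u ∈ Icc α β, |g u / u| ≤ M₁ := fun u hu => by
      rw [abs_div, div_le_iff₀ (abs_pos.2 (hne u hu))]
      exact hq u (hmem u hu)
    have b1 := hb α ⟨le_rfl, hαβ⟩
    have b2 := hb β ⟨hαβ, le_rfl⟩
    have b3 : ‖∫ u in α..β, |(g' u * u - g u) / u ^ 2|‖ ≤ M₂ * |β - α| := by
      refine intervalIntegral.norm_integral_le_of_norm_le_const fun u hu => ?_
      rw [uIoc_of_le hαβ] at hu
      have hu' := Ioc_subset_Icc_self hu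
      have := hne u hu'
      rw [Real.norm_eq_abs, abs_abs, abs_div, abs_of_nonneg (sq_nonneg u),
        div_le_iff₀ (by positivity)]
      exact hk u (hmem u hu')
    have b4 := (le_abs_self _).trans b3
    rw [abs_of_nonneg (by linarith)] at b4
    refine div_le_div_of_nonneg_right ?_ hN.le
    nlinarith
  refine ⟨2 * M₁ + 4 * M₂ + 1, by positivity, fun N hN x hx => ?_⟩
  rw [abs_le] at hx
  have hcont : Continuous fun u => ((g u * Real.exp u : ℝ) : ℂ) *
      exp (I * ((N * psi u : ℝ) : ℂ)) := by
    have := continuous_psi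
    fun_prop
  have hprim := intervalIntegral.continuous_primitive (μ := volume)
    (fun b c => hcont.intervalIntegrable b c) x
  have hlim : Tendsto (fun s : ℝ => ‖∫ u in x..(s * x), ((g u * Real.exp u : ℝ) : ℂ) *
      exp (I * ((N * psi u : ℝ) : ℂ))‖) (𝓝[>] 0) (𝓝 ‖∫ u in x..(0 : ℝ),
      ((g u * Real.exp u : ℝ) : ℂ) * exp (I * ((N * psi u : ℝ) : ℂ))‖) := by
    have h1 : Continuous fun s : ℝ => ‖∫ u in x..(s * x), ((g u * Real.exp u : ℝ) : ℂ) *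
      exp (I * ((N * psi u : ℝ) : ℂ))‖ := (hprim.comp (continuous_mul_const x)).norm
    have h2 := (h1.tendsto 0).mono_left (nhdsWithin_le_nhds (s := Ioi 0))
    simpa only [zero_mul] using h2
  rw [intervalIntegral.integral_symm, norm_neg]
  refine (le_of_tendsto hlim (b := (2 * M₁ + 4 * M₂) / N) ?_).trans
    (div_le_div_of_nonneg_right (by linarith) hN.le)
  filter_upwards [Ioo_mem_nhdsGT (zero_lt_one' ℝ)] with s hs
  rcases lt_trichotomy x 0 with h | h | h
  · exact main N hN x (s * x) hx.1 (by nlinarith [hs.2]) (by nlinarith [hs.1])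
      (Or.inr (mul_neg_of_pos_of_neg hs.1 h))
  · rw [h, mul_zero, intervalIntegral.integral_same, norm_zero]
    positivity
  · rw [intervalIntegral.integral_symm, norm_neg]
    exact main N hN (s * x) x (by nlinarith [mul_pos hs.1 h]) (by nlinarith [hs.2]) hx.2
      (Or.inl (mul_pos hs.1 h))

lemma exists_norm_integral_middle_le (a : ℝ) : ∃ c : ℂ, ∃ C > 0, ∀ N ≥ 1, ∀ x : ℝ, |x| ≤ 2 →
    ‖(∫ u in (0 : ℝ)..x, ((Real.exp ((1 + a) * u) : ℝ) : ℂ) * exp (I * ((N * psi u : ℝ) : ℂ))) -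
      Real.sign x * c / √N‖ ≤ C / (√N * (1 + √N * |x|)) := by
  obtain ⟨p, hp, hpsi, hpos, hpd⟩ := exists_psi_eq_sq_mul
  obtain ⟨c, hc⟩ := exists_norm_fresnel_sub_le
  have hr : ContDiff ℝ 3 fun u => √(p u) := hp.sqrt fun u => (hpos u).ne'
  have hrpos : ∀ u, 0 < √(p u) := fun u => Real.sqrt_pos.2 (hpos u)
  set g : ℝ → ℝ := fun u => Real.exp (a * u) - √(p 0) / √(p u) with hgdef
  have hg : ContDiff ℝ 2 g := by
    refine ContDiff.sub ?_ (contDiff_const.div (hr.of_le (by norm_num)) fun u => (hrpos u).ne')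
    exact Real.contDiff_exp.comp (contDiff_const.mul contDiff_id)
  have hg2 : ContDiff ℝ 1 (deriv g) := ((contDiff_succ_iff_deriv (n := 1)).1 hg).2.2
  obtain ⟨C₁, hC₁, hbd⟩ := exists_norm_integral_vanishing_le
    (fun u => (hg.differentiable (by norm_num) u).hasDerivAt)
    (fun u => (hg2.differentiable (by norm_num) u).hasDerivAt)
    (hg2.continuous_deriv le_rfl) (by simp [hgdef, (hrpos 0).ne'])
  obtain ⟨u₀, -, hu₀⟩ := (isCompact_Icc (a := (-2 : ℝ)) (b := 2)).exists_isMinOn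
    ⟨0, by norm_num⟩ hr.continuous.continuousOn
  set m := min 1 √(p u₀)
  have hm : 0 < m := lt_min one_pos (hrpos _)
  have hG : ∀ u, HasDerivAt (fun u => u * √(p u)) (Real.exp u / (2 * √(p u))) u := fun u => by
    have h1 := (hp.differentiable (by norm_num) u).hasDerivAt
    have h2 := (hasDerivAt_id u).mul (h1.sqrt (hpos u).ne')
    convert! h2 using 1
    have h3 := hrpos u
    rw [← hpd u]
    simp only [id]
    field_simp
    rw [Real.sq_sqrt (hpos u).le]
  refine ⟨2 * √(p 0) * c, 2 * √(p 0) * ((‖c‖ + 4) / m) + 3 * C₁,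
    by have := hrpos 0; positivity, fun N hN x hx => ?_⟩
  have hN0 : 0 < N := by linarith
  have hsN : 0 < √N := Real.sqrt_pos.2 hN0
  have hsN2 : √N * √N = N := Real.mul_self_sqrt hN0.le
  have hsub : (∫ u in (0 : ℝ)..x, ((√N * (Real.exp u / (2 * √(p u))) : ℝ) : ℂ) *
      exp (I * ((N * psi u : ℝ) : ℂ))) = fresnel (√N * (x * √(p x))) := by
    have h1 := intervalIntegral.integral_deriv_smul_comp (a := 0) (b := x)
      (f := fun u => √N * (u * √(p u))) (f' := fun u => √N * (Real.exp u / (2 * √(p u))))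
      (fun u _ => (hG u).const_mul _)
      (ContinuousOn.mul (by fun_prop) (ContinuousOn.div (by fun_prop)
        (continuousOn_const.mul hr.continuous.continuousOn) fun u _ => by
          have := hrpos u
          positivity)) continuous_fresnel_integrand
    simp only [zero_mul, mul_zero] at h1
    rw [fresnel, ← h1]
    refine intervalIntegral.integral_congr fun u _ => ?_
    simp only [Function.comp_apply, real_smul]
    rw [hpsi, mul_pow, mul_pow, Real.sq_sqrt hN0.le, Real.sq_sqrt (hpos u).le]
  have hpc := continuous_psi
  have hrc := hr.continuous
  have hdiv : ∀ u, 2 * √(p u) ≠ 0 := fun u => by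
    have := hrpos u
    positivity
  have hsplit : (∫ u in (0 : ℝ)..x, ((Real.exp ((1 + a) * u) : ℝ) : ℂ) *
      exp (I * ((N * psi u : ℝ) : ℂ))) = ((2 * √(p 0) / √N : ℝ) : ℂ) *
        fresnel (√N * (x * √(p x))) + ∫ u in (0 : ℝ)..x, ((g u * Real.exp u : ℝ) : ℂ) *
      exp (I * ((N * psi u : ℝ) : ℂ)) := by
    rw [← hsub, ← intervalIntegral.integral_const_mul, ← intervalIntegral.integral_add]
    · refine intervalIntegral.integral_congr fun u _ => ?_
      rw [← mul_assoc, ← add_mul, ← ofReal_mul, ← ofReal_add]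
      congr 2
      have := hrpos u
      rw [hgdef, add_mul, one_mul, Real.exp_add]
      field_simp
      ring
    · refine Continuous.intervalIntegrable ?_ _ _
      have : Continuous fun u => Real.exp u / (2 * √(p u)) :=
        Continuous.div (by fun_prop) (by fun_prop) hdiv
      fun_prop
    · refine Continuous.intervalIntegrable ?_ _ _
      have := hg.continuous
      fun_prop
  have hsign : Real.sign (√N * (x * √(p x))) = Real.sign x := by
    have := hrpos x
    rcases lt_trichotomy x 0 with h | h | h
    · rw [Real.sign_of_neg h, Real.sign_of_neg]
      exact mul_neg_of_pos_of_neg hsN (mul_neg_of_neg_of_pos h this)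
    · simp [h]
    · rw [Real.sign_of_pos h, Real.sign_of_pos]
      positivity
  have hfr := hc (√N * (x * √(p x)))
  rw [hsign] at hfr
  have hmx : m ≤ √(p x) := (min_le_right _ _).trans (hu₀ (abs_le.1 hx))
  have hm1 : m ≤ 1 := min_le_left _ _
  have hden : m * (1 + √N * |x|) ≤ 1 + |√N * (x * √(p x))| := by
    rw [abs_mul, abs_mul, abs_of_pos hsN, abs_of_pos (hrpos x)]
    have := mul_le_mul_of_nonneg_left hmx (mul_nonneg hsN.le (abs_nonneg x))
    linarith
  have hD : 0 < 1 + √N * |x| := by positivity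
  have hfr' : ‖fresnel (√N * (x * √(p x))) - Real.sign x * c‖ ≤
      (‖c‖ + 4) / (m * (1 + √N * |x|)) := hfr.trans (by gcongr)
  have hg1 := hbd N hN0 x hx
  have hN3 : C₁ / N ≤ 3 * C₁ / (√N * (1 + √N * |x|)) := by
    rw [div_le_div_iff₀ hN0 (by positivity)]
    have h1 : √N ≤ N := by
      rw [Real.sqrt_le_left hN0.le]
      nlinarith
    have h2 : √N * (1 + √N * |x|) ≤ 3 * N := by
      rw [mul_add, ← mul_assoc, hsN2]
      nlinarith
    nlinarith
  rw [hsplit]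
  have e : ((2 * √(p 0) / √N : ℝ) : ℂ) * fresnel (√N * (x * √(p x))) +
      (∫ u in (0 : ℝ)..x, ((g u * Real.exp u : ℝ) : ℂ) * exp (I * ((N * psi u : ℝ) : ℂ))) -
      Real.sign x * (2 * √(p 0) * c) / √N =
      ((2 * √(p 0) / √N : ℝ) : ℂ) * (fresnel (√N * (x * √(p x))) - Real.sign x * c) +
      (∫ u in (0 : ℝ)..x, ((g u * Real.exp u : ℝ) : ℂ) * exp (I * ((N * psi u : ℝ) : ℂ))) := by
    push_cast
    ring
  rw [e]
  refine (norm_add_le _ _).trans ?_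
  rw [norm_mul, norm_real, Real.norm_eq_abs, abs_of_nonneg (by positivity), add_div]
  refine add_le_add ?_ (hg1.trans hN3)
  calc _ ≤ 2 * √(p 0) / √N * ((‖c‖ + 4) / (m * (1 + √N * |x|))) := by gcongr
    _ = _ := by field_simp

end Middle

section Term

open Complex Set Filter Topology

/-- The `n`-th term of the Dirichlet series of `ζ`, integrated against the phase on the line
`Re s = 1 + δ`. -/
noncomputable def seriesTerm (δ T : ℝ) (n : ℕ) : ℂ :=
  ∫ t in T..(2 * T), phase t * (((t / (2 * Real.pi)) ^ (1 / 4 + δ / 2) : ℝ) : ℂ) *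
    (1 / (n : ℂ) ^ (((1 + δ : ℝ) : ℂ) + I * t))

lemma exp_neg_I_mul_pi_mul_sq (n : ℕ) : exp (-(I * (Real.pi * (n : ℂ) ^ 2))) = (-1) ^ n := by
  have h1 : exp (-(I * (Real.pi * (n : ℂ) ^ 2))) = exp (-(Real.pi * I)) ^ (n ^ 2) := by
    rw [← Complex.exp_nat_mul]
    congr 1
    push_cast
    ring
  rw [h1, Complex.exp_neg, exp_pi_mul_I]
  rcases Nat.even_or_odd n with h | h
  · rw [h.neg_one_pow, show ((-1 : ℂ)⁻¹) = -1 by norm_num,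
      (h.pow_of_ne_zero two_ne_zero).neg_one_pow]
  · rw [h.neg_one_pow, show ((-1 : ℂ)⁻¹) = -1 by norm_num, h.pow.neg_one_pow]

lemma seriesTerm_eq {δ T : ℝ} (hT : 0 < T) {n : ℕ} (hn : n ≠ 0) :
    seriesTerm δ T n = ((2 * Real.pi * (n * √n) : ℝ) : ℂ) * (-1) ^ n *
      ∫ u in Real.log (T / (2 * Real.pi * n ^ 2))..(Real.log (T / (2 * Real.pi * n ^ 2)) +
        Real.log 2), ((Real.exp ((1 + (1 / 4 + δ / 2)) * u) : ℝ) : ℂ) *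
          exp (I * ((Real.pi * n ^ 2 * psi u : ℝ) : ℂ)) := by
  have hpi := Real.pi_pos
  have hn0 : (0 : ℝ) < n := by positivity
  set A : ℝ := 2 * Real.pi * n ^ 2 with hA
  have hA0 : 0 < A := by positivity
  have hTA : 0 < T / A := by positivity
  have hf : ∀ u : ℝ, HasDerivAt (fun u => A * Real.exp u) (A * Real.exp u) u := fun u =>
    (Real.hasDerivAt_exp u).const_mul A
  have hg : ContinuousOn (fun t : ℝ => phase t * (((t / (2 * Real.pi)) ^ (1 / 4 + δ / 2) : ℝ) : ℂ) *
      (1 / (n : ℂ) ^ (((1 + δ : ℝ) : ℂ) + I * t))) (Ioi 0) := by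
    refine ContinuousOn.mul (continuousOn_phase.mul ?_) ?_
    · refine continuous_ofReal.comp_continuousOn ?_
      refine ContinuousOn.rpow_const (by fun_prop) fun t ht => Or.inl ?_
      have : 0 < t := ht
      positivity
    · have hnc : (n : ℂ) ≠ 0 := by exact_mod_cast hn
      refine Continuous.continuousOn (continuous_const.div ?_ fun t => ?_)
      · exact Continuous.const_cpow (by fun_prop) (Or.inl hnc)
      · simp [cpow_eq_zero_iff, hnc]
  have hsub := intervalIntegral.integral_deriv_smul_comp' (a := Real.log (T / A))
    (b := Real.log (T / A) + Real.log 2) (fun u _ => hf u) (by fun_prop)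
    (hg.mono (by
      rintro _ ⟨u, -, rfl⟩
      exact mul_pos hA0 (Real.exp_pos u)))
  have e1 : A * Real.exp (Real.log (T / A)) = T := by
    rw [Real.exp_log hTA]
    field_simp
  have e2 : A * Real.exp (Real.log (T / A) + Real.log 2) = 2 * T := by
    rw [Real.exp_add, ← mul_assoc, e1, Real.exp_log two_pos, mul_comm]
  rw [e1, e2] at hsub
  rw [seriesTerm, ← hsub, ← intervalIntegral.integral_const_mul]
  refine intervalIntegral.integral_congr fun u _ => ?_
  simp only [Function.comp_apply, real_smul]
  set L := Real.log n with hL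
  have hnL : (n : ℝ) = Real.exp L := (Real.exp_log hn0).symm
  have hsq : √(n : ℝ) = Real.exp (L / 2) := by
    rw [hnL, Real.exp_half]
  have hlog : Real.log (A * Real.exp u) = Real.log (2 * Real.pi) + (2 * L + u) := by
    rw [hA, Real.log_mul (by positivity) (Real.exp_pos u).ne', Real.log_exp,
      Real.log_mul (by positivity) (by positivity), Real.log_pow]
    push_cast
    ring
  have hrpow : (A * Real.exp u / (2 * Real.pi)) ^ (1 / 4 + δ / 2) =
      Real.exp ((1 / 4 + δ / 2) * (2 * L + u)) := by
    have : A * Real.exp u / (2 * Real.pi) = Real.exp (2 * L + u) := by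
      rw [hA, Real.exp_add, two_mul L, Real.exp_add, ← hnL]
      field_simp
    rw [this, ← Real.exp_mul, mul_comm]
  have hcpow : 1 / (n : ℂ) ^ (((1 + δ : ℝ) : ℂ) + I * ((A * Real.exp u : ℝ) : ℂ)) =
      ((Real.exp (-(1 + δ) * L) : ℝ) : ℂ) * exp (-(I * ((A * Real.exp u * L : ℝ) : ℂ))) := by
    have hlc : log (n : ℂ) = (L : ℂ) := by rw [hL, ofReal_log hn0.le, ofReal_natCast]
    rw [cpow_def_of_ne_zero (by exact_mod_cast hn), one_div, ← Complex.exp_neg, ofReal_exp,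
      ← Complex.exp_add, hlc]
    congr 1
    push_cast
    ring
  have hph : phase (A * Real.exp u) * exp (-(I * ((A * Real.exp u * L : ℝ) : ℂ))) =
      (-1) ^ n * exp (I * ((Real.pi * n ^ 2 * psi u : ℝ) : ℂ)) := by
    rw [phase, hlog, ← exp_neg_I_mul_pi_mul_sq, ← Complex.exp_add, ← Complex.exp_add, hA, psi]
    congr 1
    push_cast
    ring
  have hreal : A * Real.exp u * (Real.exp ((1 / 4 + δ / 2) * (2 * L + u)) *
      Real.exp (-(1 + δ) * L)) = 2 * Real.pi * (n * √n) *
        Real.exp ((1 + (1 / 4 + δ / 2)) * u) := by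
    rw [hA, hsq, hnL, sq]
    have : Real.exp L * Real.exp L * Real.exp u * (Real.exp ((1 / 4 + δ / 2) * (2 * L + u)) *
        Real.exp (-(1 + δ) * L)) = Real.exp L * Real.exp (L / 2) *
        Real.exp ((1 + (1 / 4 + δ / 2)) * u) := by
      simp only [← Real.exp_add]
      congr 1
      ring
    linear_combination 2 * Real.pi * this
  rw [hrpow, hcpow]
  have hreal' := congrArg (fun x : ℝ => (x : ℂ)) hreal
  simp only [ofReal_mul, ofReal_ofNat, ofReal_natCast] at hreal' hph ⊢
  linear_combination (exp (-(I * ((A : ℂ) * (Real.exp u : ℂ) * (L : ℂ)))) *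
    phase (A * Real.exp u)) * hreal' + (2 * Real.pi * ((n : ℂ) * (√n : ℂ)) *
      (Real.exp ((1 + (1 / 4 + δ / 2)) * u) : ℂ)) * hph

lemma norm_seriesTerm_le_of_tail {δ T : ℝ} (hδ : 0 < δ) (hδ' : δ ≤ 1 / 2) (hT : 0 < T) {n : ℕ}
    (hn : n ≠ 0) (h : 1 ≤ Real.log (T / (2 * Real.pi * n ^ 2)) ∨
      Real.log (T / (2 * Real.pi * n ^ 2)) ≤ -2) :
    ‖seriesTerm δ T n‖ ≤ 14 * T ^ (1 / 4 + δ / 2) * (n : ℝ) ^ (-(1 + δ)) := by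
  have hpi := Real.pi_gt_three
  have hn0 : (0 : ℝ) < n := by positivity
  have key := norm_integral_tail_le (a := 1 / 4 + δ / 2) (N := Real.pi * n ^ 2) (by positivity)
    (by linarith) (by positivity) h
  rw [seriesTerm_eq hT hn, norm_mul, norm_mul, norm_pow, norm_neg, norm_one, one_pow, mul_one,
    norm_real, Real.norm_eq_abs, abs_of_nonneg (by positivity)]
  have h1 : Real.exp ((1 / 4 + δ / 2) * Real.log (T / (2 * Real.pi * n ^ 2))) ≤
      T ^ (1 / 4 + δ / 2) * (n : ℝ) ^ (-(1 / 2 + δ)) := by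
    rw [mul_comm, ← Real.rpow_def_of_pos (by positivity)]
    have : (n : ℝ) ^ (-(1 / 2 + δ)) = ((n ^ 2 : ℝ)⁻¹) ^ (1 / 4 + δ / 2) := by
      rw [Real.inv_rpow (by positivity), ← Real.rpow_natCast, ← Real.rpow_mul hn0.le,
        ← Real.rpow_neg hn0.le]
      congr 1
      push_cast
      ring
    rw [this, ← Real.mul_rpow hT.le (by positivity)]
    refine Real.rpow_le_rpow (by positivity) ?_ (by positivity)
    rw [← div_eq_mul_inv]
    gcongr
    nlinarith [sq_nonneg (n : ℝ)]
  have h2 : (n : ℝ) ^ (-(1 + δ)) = (n : ℝ) ^ (-(1 / 2 + δ)) * (√n / n) := by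
    rw [Real.sqrt_eq_rpow, ← Real.rpow_sub_one hn0.ne', ← Real.rpow_add hn0]
    congr 1
    ring
  calc _ ≤ 2 * Real.pi * (n * √n) *
        (7 * (T ^ (1 / 4 + δ / 2) * (n : ℝ) ^ (-(1 / 2 + δ))) / (Real.pi * n ^ 2)) := by
        gcongr
        refine key.trans ?_
        gcongr
    _ = _ := by
        rw [h2]
        field_simp
        ring

end Term

section TermAsymptotic

open Complex Set Filter Topology

lemma abs_sub_le_sqrt_mul_abs_log {r : ℝ} (hr : 0 < r) {n : ℕ} (hn : n ≠ 0)
    (h : 2 * Real.log (r / n) ≤ 2) :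
    |n - r| ≤ √(Real.pi * n ^ 2) * |2 * Real.log (r / n)| := by
  have hn0 : (0 : ℝ) < n := by positivity
  have hpi := Real.pi_gt_three
  have hspi : 1.7 ≤ √Real.pi := Real.le_sqrt_of_sq_le (by norm_num; linarith)
  rw [Real.sqrt_mul (by positivity), Real.sqrt_sq hn0.le]
  rcases le_total r n with hrn | hrn
  · have h1 := Real.log_le_sub_one_of_pos (div_pos hr hn0)
    have h2 : r / n * n = r := div_mul_cancel₀ _ hn0.ne'
    have h3 : n - r ≤ n * |2 * Real.log (r / n)| := by
      have := neg_le_abs (2 * Real.log (r / n))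
      nlinarith [div_le_one_of_le₀ hrn hn0.le]
    rw [abs_of_nonneg (by linarith)]
    nlinarith [mul_nonneg hn0.le (abs_nonneg (2 * Real.log (r / n)))]
  · have h1 := Real.log_le_sub_one_of_pos (div_pos hn0 hr)
    have h2 : n / r * r = n := div_mul_cancel₀ _ hr.ne'
    have h3 : Real.log (n / r) = -Real.log (r / n) := by
      rw [← Real.log_inv, inv_div]
    have h4 : r ≤ 2.7182818286 * n := by
      have h5 : r / n ≤ Real.exp 1 := by
        rw [← Real.exp_log (div_pos hr hn0)]
        exact Real.exp_le_exp.2 (by linarith)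
      rw [div_le_iff₀ hn0] at h5
      nlinarith [Real.exp_one_lt_d9]
    have h5 : 2 * (1 - n / r) ≤ |2 * Real.log (r / n)| := by
      have := le_abs_self (2 * Real.log (r / n))
      linarith
    rw [abs_of_nonpos (by linarith)]
    have h6 : 0 ≤ 1 - n / r := by
      rw [sub_nonneg]
      exact div_le_one_of_le₀ hrn hr.le
    calc -(n - r) = r * (1 - n / r) := by linarith
      _ ≤ 2.7182818286 * n * (1 - n / r) := by gcongr
      _ ≤ 1.7 * n * (2 * (1 - n / r)) := by nlinarith [mul_nonneg hn0.le h6]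
      _ ≤ _ := by gcongr

lemma sign_two_mul_log_div {r : ℝ} (hr : 0 < r) {n : ℕ} (hn : n ≠ 0) :
    Real.sign (2 * Real.log (r / n)) = Real.sign (r - n) := by
  have hn0 : (0 : ℝ) < n := by positivity
  rcases lt_trichotomy r n with h | h | h
  · have := Real.log_neg (div_pos hr hn0) ((div_lt_one hn0).2 h)
    rw [Real.sign_of_neg (by linarith), Real.sign_of_neg (by linarith)]
  · simp [h, hn0.ne']
  · have := Real.log_pos ((one_lt_div hn0).2 h)
    rw [Real.sign_of_pos (by linarith), Real.sign_of_pos (by linarith)]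

lemma mul_sq_lt_of_neg_two_lt_log {T : ℝ} (hT : 0 < T) {n : ℕ} (hn : n ≠ 0)
    (h : -2 < Real.log (T / (2 * Real.pi * n ^ 2))) : 4 / 5 * (n : ℝ) ^ 2 < T := by
  have hn0 : (0 : ℝ) < n := by positivity
  have hpi := Real.pi_gt_d2
  have h1 : Real.exp (-2) < T / (2 * Real.pi * n ^ 2) := by
    rwa [← Real.lt_log_iff_exp_lt (by positivity)]
  rw [lt_div_iff₀ (by positivity)] at h1
  have h2 : Real.exp 2 ≤ 15 / 2 := by
    rw [show (2 : ℝ) = 1 + 1 by norm_num, Real.exp_add]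
    nlinarith [Real.exp_one_lt_d9, Real.exp_pos 1]
  have h3 : 2 / 15 ≤ Real.exp (-2) := by
    rw [Real.exp_neg, show (2 : ℝ) / 15 = (15 / 2)⁻¹ by norm_num]
    exact inv_anti₀ (Real.exp_pos 2) h2
  have h4 : 2 / 15 * (2 * 3.14 * (n : ℝ) ^ 2) ≤ Real.exp (-2) * (2 * Real.pi * n ^ 2) := by
    gcongr
  nlinarith [sq_nonneg (n : ℝ)]

lemma exists_norm_seriesTerm_sub_le {δ : ℝ} (hδ : 0 < δ) (hδ' : δ ≤ 1 / 2) :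
    ∃ c : ℂ, ∃ C > 0, ∀ T ≥ 2, ∀ n : ℕ,
      ‖seriesTerm δ T n - c * (((-1) ^ n * √n *
        (Real.sign (√(T / Real.pi) - n) - Real.sign (√(T / (2 * Real.pi)) - n)) : ℝ) : ℂ)‖ ≤
      14 * T ^ (1 / 4 + δ / 2) * (n : ℝ) ^ (-(1 + δ)) + if (n : ℝ) < T then
        C * T ^ (1 / 4 : ℝ) * (1 / (1 + |n - √(T / Real.pi)|) +
          1 / (1 + |n - √(T / (2 * Real.pi))|)) else 0 := by
  obtain ⟨c, C, hC, hmid⟩ := exists_norm_integral_middle_le (1 / 4 + δ / 2)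
  have hpi := Real.pi_gt_three
  have hpi' := Real.pi_lt_d2
  have hspi : 0 < √Real.pi := Real.sqrt_pos.2 Real.pi_pos
  have hspi2 : √Real.pi * √Real.pi = Real.pi := Real.mul_self_sqrt Real.pi_pos.le
  refine ⟨2 * √Real.pi * c, 4 * √Real.pi * C, by positivity, fun T hT n => ?_⟩
  have hT0 : 0 < T := by linarith
  have hif : 0 ≤ if (n : ℝ) < T then
        4 * √Real.pi * C * T ^ (1 / 4 : ℝ) * (1 / (1 + |n - √(T / Real.pi)|) +
          1 / (1 + |n - √(T / (2 * Real.pi))|)) else 0 := by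
    split_ifs <;> positivity
  rcases eq_or_ne n 0 with rfl | hn
  · have h1 : seriesTerm δ T 0 = 0 := by
      rw [seriesTerm]
      refine intervalIntegral.integral_zero_ae (Eventually.of_forall fun t _ => ?_)
      have : (((1 + δ : ℝ) : ℂ) + I * t) ≠ 0 := fun h => by
        have := congrArg re h
        simp at this
        linarith
      rw [Nat.cast_zero, zero_cpow this, div_zero, mul_zero]
    rw [h1, Nat.cast_zero, Real.sqrt_zero, mul_zero, zero_mul, ofReal_zero, mul_zero, sub_zero,
      norm_zero]
    rw [Nat.cast_zero] at hif
    exact add_nonneg (by positivity) hif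
  have hn0 : (0 : ℝ) < n := by positivity
  set r₀ := √(T / (2 * Real.pi)) with hr₀
  set r₁ := √(T / Real.pi) with hr₁
  have hr₀0 : 0 < r₀ := Real.sqrt_pos.2 (by positivity)
  have hr₁0 : 0 < r₁ := Real.sqrt_pos.2 (by positivity)
  set α := Real.log (T / (2 * Real.pi * n ^ 2)) with hα
  have hα0 : α = 2 * Real.log (r₀ / n) := by
    rw [hα, ← Nat.cast_two (R := ℝ), ← Real.log_pow, div_pow, hr₀, Real.sq_sqrt (by positivity)]
    congr 1
    push_cast
    field_simp
  have hα1 : α + Real.log 2 = 2 * Real.log (r₁ / n) := by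
    rw [hα, ← Real.log_mul (by positivity) two_ne_zero]
    nth_rw 3 [← Nat.cast_two (R := ℝ)]
    rw [← Real.log_pow, div_pow, hr₁, Real.sq_sqrt (by positivity)]
    congr 1
    field_simp
  have hs0 := sign_two_mul_log_div hr₀0 hn
  have hs1 := sign_two_mul_log_div hr₁0 hn
  rw [← hα0] at hs0
  rw [← hα1] at hs1
  rw [← hs0, ← hs1]
  have hl1 := Real.log_two_lt_d9
  have hl0 := Real.log_two_gt_d9
  by_cases htail : 1 ≤ α ∨ α ≤ -2
  · have hs : Real.sign (α + Real.log 2) = Real.sign α := by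
      rcases htail with h | h
      · rw [Real.sign_of_pos (by linarith), Real.sign_of_pos (by linarith)]
      · rw [Real.sign_of_neg (by linarith), Real.sign_of_neg (by linarith)]
    rw [hs, sub_self, mul_zero, ofReal_zero, mul_zero, sub_zero]
    have := norm_seriesTerm_le_of_tail hδ hδ' hT0 hn htail
    linarith
  push Not at htail
  set N := Real.pi * (n : ℝ) ^ 2 with hN
  have hn1 : (1 : ℝ) ≤ n := by exact_mod_cast Nat.one_le_iff_ne_zero.2 hn
  have hN1 : 1 ≤ N := by nlinarith
  have hsN : √N = √Real.pi * n := by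
    rw [hN, Real.sqrt_mul Real.pi_pos.le, Real.sqrt_sq hn0.le]
  have hnT := mul_sq_lt_of_neg_two_lt_log hT0 hn htail.2
  have hnT' : (n : ℝ) < T := by nlinarith
  have hsn : √(n : ℝ) ≤ 2 * T ^ (1 / 4 : ℝ) := by
    have h1 : √(n : ℝ) = ((n : ℝ) ^ 2) ^ (1 / 4 : ℝ) := by
      rw [Real.sqrt_eq_rpow, ← Real.rpow_natCast, ← Real.rpow_mul hn0.le]
      norm_num
    have h2 : (2 : ℝ) = (2 ^ 4 : ℝ) ^ (1 / 4 : ℝ) := by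
      rw [← Real.rpow_natCast, ← Real.rpow_mul (by norm_num)]
      norm_num
    rw [h1, h2, ← Real.mul_rpow (by norm_num) hT0.le]
    exact Real.rpow_le_rpow (by positivity) (by nlinarith) (by norm_num)
  rw [if_pos hnT', seriesTerm_eq hT0 hn, ← hα]
  have hcont : Continuous fun u => ((Real.exp ((1 + (1 / 4 + δ / 2)) * u) : ℝ) : ℂ) *
      exp (I * ((N * psi u : ℝ) : ℂ)) := by
    have := continuous_psi
    fun_prop
  rw [← intervalIntegral.integral_interval_sub_left (hcont.intervalIntegrable 0 _)
    (hcont.intervalIntegrable 0 _)]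
  have hm1 := hmid N hN1 (α + Real.log 2) (by rw [abs_le]; constructor <;> linarith)
  have hm0 := hmid N hN1 α (by rw [abs_le]; constructor <;> linarith)
  set J₁ := ∫ u in (0 : ℝ)..(α + Real.log 2), ((Real.exp ((1 + (1 / 4 + δ / 2)) * u) : ℝ) : ℂ) *
      exp (I * ((N * psi u : ℝ) : ℂ))
  set J₀ := ∫ u in (0 : ℝ)..α, ((Real.exp ((1 + (1 / 4 + δ / 2)) * u) : ℝ) : ℂ) *
      exp (I * ((N * psi u : ℝ) : ℂ))
  have hspic : (√Real.pi : ℂ) * (√Real.pi : ℂ) = Real.pi := by exact_mod_cast hspi2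
  have hspi0 : (√Real.pi : ℂ) ≠ 0 := by exact_mod_cast hspi.ne'
  have hnc : (n : ℂ) ≠ 0 := by exact_mod_cast hn
  have hdecomp : ((2 * Real.pi * (n * √n) : ℝ) : ℂ) * (-1) ^ n * (J₁ - J₀) -
      2 * √Real.pi * c * (((-1) ^ n * √n * (Real.sign (α + Real.log 2) - Real.sign α) : ℝ) : ℂ) =
      ((2 * Real.pi * (n * √n) : ℝ) : ℂ) * (-1) ^ n *
        ((J₁ - Real.sign (α + Real.log 2) * c / √N) - (J₀ - Real.sign α * c / √N)) := by
    rw [hsN]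
    push_cast
    rw [← hspic]
    field_simp
    ring
  rw [hdecomp, norm_mul, norm_mul, norm_pow, norm_neg, norm_one, one_pow, mul_one,
    norm_real, Real.norm_eq_abs, abs_of_nonneg (by positivity)]
  have hb : ∀ r : ℝ, 0 < r → ∀ β : ℝ, β = 2 * Real.log (r / n) → β ≤ 2 →
      2 * Real.pi * (n * √n) * (C / (√N * (1 + √N * |β|))) ≤
        4 * √Real.pi * C * T ^ (1 / 4 : ℝ) * (1 / (1 + |n - r|)) := by
    intro r hr β hβ hβ2
    have h1 := abs_sub_le_sqrt_mul_abs_log hr hn (hβ ▸ hβ2)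
    rw [← hN, ← hβ] at h1
    calc 2 * Real.pi * (n * √n) * (C / (√N * (1 + √N * |β|)))
        = 2 * √Real.pi * C * √n * (1 / (1 + √N * |β|)) := by
          have h2 : 0 < 1 + √N * |β| := by positivity
          generalize 1 + √N * |β| = D at h2
          rw [hsN]
          field_simp
          rw [Real.sq_sqrt Real.pi_pos.le]
      _ ≤ 2 * √Real.pi * C * (2 * T ^ (1 / 4 : ℝ)) * (1 / (1 + |n - r|)) := by gcongr
      _ = _ := by ring
  have hb1 := hb r₁ hr₁0 _ hα1 (by linarith)
  have hb0 := hb r₀ hr₀0 _ hα0 (by linarith)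
  have hP : 0 ≤ 14 * T ^ (1 / 4 + δ / 2) * (n : ℝ) ^ (-(1 + δ)) := by positivity
  calc _ ≤ 2 * Real.pi * (n * √n) * (C / (√N * (1 + √N * |α + Real.log 2|)) +
        C / (√N * (1 + √N * |α|))) := by
        gcongr
        exact (norm_sub_le _ _).trans (add_le_add hm1 hm0)
    _ ≤ 4 * √Real.pi * C * T ^ (1 / 4 : ℝ) * (1 / (1 + |n - r₁|) + 1 / (1 + |n - r₀|)) := by
        linarith
    _ ≤ _ := by linarith

end TermAsymptotic

section Sums

open Complex Set Filter Topology

lemma neg_one_pow_mul_sum_sqrt_mem (k : ℕ) :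
    (-1 : ℝ) ^ k * ∑ n ∈ Finset.range (k + 1), (-1) ^ n * √(n : ℝ) ∈ Icc 0 √(k : ℝ) := by
  induction k with
  | zero => simp
  | succ k ih =>
    rw [Finset.sum_range_succ]
    have h1 : (-1 : ℝ) ^ (k + 1) * (-1) ^ (k + 1) = 1 := by
      rw [← mul_pow]
      norm_num
    have h2 : √(k : ℝ) ≤ √((k + 1 : ℕ) : ℝ) := Real.sqrt_le_sqrt (by push_cast; linarith)
    have h3 : (-1 : ℝ) ^ (k + 1) * (∑ n ∈ Finset.range (k + 1), (-1) ^ n * √(n : ℝ) +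
        (-1) ^ (k + 1) * √((k + 1 : ℕ) : ℝ)) = √((k + 1 : ℕ) : ℝ) -
        (-1 : ℝ) ^ k * ∑ n ∈ Finset.range (k + 1), (-1) ^ n * √(n : ℝ) := by
      rw [mul_add, ← mul_assoc _ _ √((k + 1 : ℕ) : ℝ), h1, pow_succ]
      ring
    rw [h3]
    constructor <;> linarith [ih.1, ih.2]

lemma abs_sum_neg_one_pow_mul_sqrt_le (K : ℕ) :
    |∑ n ∈ Finset.range K, (-1) ^ n * √(n : ℝ)| ≤ √(K : ℝ) := by
  rcases K with - | k
  · simp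
  · have h := neg_one_pow_mul_sum_sqrt_mem k
    have h1 := abs_of_nonneg h.1
    rw [abs_mul, abs_pow, abs_neg, abs_one, one_pow, one_mul] at h1
    rw [h1]
    exact h.2.trans (Real.sqrt_le_sqrt (by push_cast; linarith))

lemma abs_sum_sign_le {r : ℝ} (hr : 0 ≤ r) (K : ℕ) :
    |∑ n ∈ Finset.range K, (-1) ^ n * √(n : ℝ) * (Real.sign (r - n) + 1)| ≤ 2 * √(r + 1) := by
  have h1 : ∀ n : ℕ, (-1) ^ n * √(n : ℝ) * (Real.sign (r - n) + 1) =
      (if n < ⌈r⌉₊ then (-1) ^ n * √(n : ℝ) else 0) +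
        if n < ⌊r⌋₊ + 1 then (-1) ^ n * √(n : ℝ) else 0 := fun n => by
    simp only [Nat.lt_succ_iff, Nat.le_floor_iff hr, Nat.lt_ceil]
    rcases lt_trichotomy (n : ℝ) r with h | h | h
    · rw [Real.sign_of_pos (by linarith), if_pos h, if_pos h.le]
      ring
    · simp [h]
    · rw [Real.sign_of_neg (by linarith), if_neg h.not_gt, if_neg h.not_ge]
      ring
  have h2 : ∀ L : ℕ, (L : ℝ) ≤ r + 1 →
      |∑ n ∈ Finset.range K, if n < L then (-1) ^ n * √(n : ℝ) else 0| ≤ √(r + 1) := by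
    intro L hL
    rw [← Finset.sum_filter]
    have : Finset.filter (fun n => n < L) (Finset.range K) = Finset.range (min K L) := by
      ext n
      simp
    rw [this]
    refine (abs_sum_neg_one_pow_mul_sqrt_le _).trans (Real.sqrt_le_sqrt ?_)
    exact le_trans (by exact_mod_cast min_le_right K L) hL
  rw [Finset.sum_congr rfl fun n _ => h1 n, Finset.sum_add_distrib]
  refine (abs_add_le _ _).trans ?_
  have h3 := h2 ⌈r⌉₊ (Nat.ceil_lt_add_one hr).le
  have h4 := h2 (⌊r⌋₊ + 1) (by push_cast; linarith [Nat.floor_le hr])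
  linarith

lemma sum_inv_one_add_le (n : ℕ) :
    ∑ j ∈ Finset.range n, 1 / (1 + (j : ℝ)) ≤ 1 + Real.log n := by
  refine le_trans (le_of_eq ?_) (harmonic_le_one_add_log n)
  rw [harmonic]
  push_cast
  exact Finset.sum_congr rfl fun j _ => by rw [one_div, add_comm]

lemma sum_inv_one_add_abs_sub_le {r : ℝ} (hr : 0 ≤ r) (K : ℕ) :
    ∑ n ∈ Finset.range K, 1 / (1 + |n - r|) ≤ 2 * (2 + Real.log ⌊r⌋₊ + Real.log K) := by
  set k := ⌊r⌋₊
  have hk : |(k : ℝ) - r| ≤ 1 := by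
    have h1 := Nat.floor_le hr
    have h2 := Nat.lt_floor_add_one r
    rw [abs_le]
    constructor <;> linarith
  calc ∑ n ∈ Finset.range K, 1 / (1 + |n - r|)
      ≤ ∑ n ∈ Finset.range (k + K), 1 / (1 + |n - r|) :=
        Finset.sum_le_sum_of_subset_of_nonneg (Finset.range_mono (Nat.le_add_left _ _))
          fun n _ _ => by positivity
    _ ≤ ∑ n ∈ Finset.range (k + K), 2 * (1 / (1 + |(n : ℝ) - k|)) := by
        refine Finset.sum_le_sum fun n _ => ?_
        have h1 := abs_sub_le (n : ℝ) r k
        rw [abs_sub_comm r] at h1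
        rw [mul_one_div, div_le_div_iff₀ (by positivity) (by positivity)]
        linarith [abs_nonneg ((n : ℝ) - r)]
    _ ≤ 2 * (1 + Real.log k + (1 + Real.log K)) := by
        rw [← Finset.mul_sum, Finset.sum_range_add]
        gcongr
        · refine le_trans ?_ (sum_inv_one_add_le k)
          rw [← Finset.sum_range_reflect]
          refine Finset.sum_le_sum fun j hj => ?_
          have hj' := Finset.mem_range.1 hj
          have h1 : ((k - 1 - j : ℕ) : ℝ) = k - 1 - j := by
            rw [Nat.cast_sub (by omega), Nat.cast_sub (by omega), Nat.cast_one]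
          have h2 : (j : ℝ) + 1 ≤ k := by exact_mod_cast hj'
          rw [h1, show (k : ℝ) - 1 - j - k = -(j + 1) by ring, abs_neg,
            abs_of_nonneg (by positivity)]
          gcongr
          linarith
        · refine le_trans (le_of_eq ?_) (sum_inv_one_add_le K)
          refine Finset.sum_congr rfl fun j _ => ?_
          push_cast
          rw [add_sub_cancel_left, abs_of_nonneg (by positivity)]
    _ = _ := by ring

lemma exists_norm_sum_seriesTerm_le {δ : ℝ} (hδ : 0 < δ) (hδ' : δ ≤ 1 / 2) :
    ∃ C > 0, ∀ T ≥ 2, ∀ M : ℕ,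
      ‖∑ n ∈ Finset.range M, seriesTerm δ T n‖ ≤ C * T ^ (1 / 4 + δ) := by
  obtain ⟨c, C, hC, hterm⟩ := exists_norm_seriesTerm_sub_le hδ hδ'
  have hpi := Real.pi_gt_three
  set S := ∑' n : ℕ, (n : ℝ) ^ (-(1 + δ))
  have hS : Summable fun n : ℕ => (n : ℝ) ^ (-(1 + δ)) := Real.summable_nat_rpow.2 (by linarith)
  have hS0 : 0 ≤ S := tsum_nonneg fun n => by positivity
  refine ⟨‖c‖ * 8 + (14 * S + C * (4 * (2 + 3 / δ))), by positivity, fun T hT M => ?_⟩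
  have hT0 : 0 < T := by linarith
  have hT1 : 1 ≤ T := by linarith
  set r₀ := √(T / (2 * Real.pi)) with hr₀
  set r₁ := √(T / Real.pi) with hr₁
  have hr₀0 : 0 ≤ r₀ := Real.sqrt_nonneg _
  have hr₁0 : 0 ≤ r₁ := Real.sqrt_nonneg _
  have hr₀T : r₀ ≤ √T := Real.sqrt_le_sqrt (div_le_self hT0.le (by linarith))
  have hr₁T : r₁ ≤ √T := Real.sqrt_le_sqrt (div_le_self hT0.le (by linarith))
  have hsT : 1 ≤ √T := Real.one_le_sqrt.2 hT1
  have hsT2 : √T * √T = T := Real.mul_self_sqrt hT0.le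
  have hTδ : 1 ≤ T ^ δ := Real.one_le_rpow hT1 hδ.le
  have hquart : T ^ (1 / 4 : ℝ) * T ^ (1 / 4 : ℝ) = √T := by
    rw [← Real.rpow_add hT0, Real.sqrt_eq_rpow]
    norm_num
  have hq0 : 0 < T ^ (1 / 4 : ℝ) := by positivity
  have hexp : T ^ (1 / 4 : ℝ) * T ^ δ = T ^ (1 / 4 + δ) := (Real.rpow_add hT0 _ _).symm
  have hmain : ∀ r : ℝ, 0 ≤ r → r ≤ √T →
      |∑ n ∈ Finset.range M, (-1) ^ n * √(n : ℝ) * (Real.sign (r - n) + 1)| ≤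
        4 * T ^ (1 / 4 + δ) := fun r hr hrT => by
    refine (abs_sum_sign_le hr M).trans ?_
    have h1 : √(r + 1) ≤ 2 * T ^ (1 / 4 : ℝ) :=
      Real.sqrt_le_iff.2 ⟨by positivity, by nlinarith⟩
    rw [← hexp]
    nlinarith
  have hlog : ∀ r : ℝ, 0 ≤ r → r ≤ √T → ∑ n ∈ Finset.range ⌈T⌉₊, 1 / (1 + |n - r|) ≤
      2 * (2 + 3 / δ) * T ^ δ := fun r hr hrT => by
    refine (sum_inv_one_add_abs_sub_le hr _).trans ?_
    have h1 : Real.log ⌊r⌋₊ ≤ T ^ δ / δ := by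
      refine (Real.log_le_rpow_div (Nat.cast_nonneg _) hδ).trans ?_
      have : (⌊r⌋₊ : ℝ) ≤ T := (Nat.floor_le hr).trans (by nlinarith)
      gcongr
    have h2 : Real.log ⌈T⌉₊ ≤ 2 * T ^ δ / δ := by
      refine (Real.log_le_rpow_div (Nat.cast_nonneg _) hδ).trans ?_
      have h3 : (⌈T⌉₊ : ℝ) ≤ 2 * T := by linarith [Nat.ceil_lt_add_one hT0.le]
      have h4 : (2 : ℝ) ^ δ ≤ 2 := by
        simpa using Real.rpow_le_rpow_of_exponent_le one_le_two (show δ ≤ 1 by linarith)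
      gcongr
      calc (⌈T⌉₊ : ℝ) ^ δ ≤ (2 * T) ^ δ := by gcongr
        _ = 2 ^ δ * T ^ δ := Real.mul_rpow (by norm_num) hT0.le
        _ ≤ _ := by gcongr
    have h5 : 2 * (2 + 3 / δ) * T ^ δ = 2 * (2 * T ^ δ + T ^ δ / δ + 2 * T ^ δ / δ) := by ring
    rw [h5]
    linarith
  have hind : ∀ f : ℕ → ℝ, (∀ n, 0 ≤ f n) →
      ∑ n ∈ Finset.range M, (if (n : ℝ) < T then f n else 0) ≤ ∑ n ∈ Finset.range ⌈T⌉₊, f n :=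
    fun f hf => by
      rw [← Finset.sum_filter]
      refine Finset.sum_le_sum_of_subset_of_nonneg (fun n hn => ?_) fun n _ _ => hf n
      rw [Finset.mem_range, Nat.lt_ceil]
      exact (Finset.mem_filter.1 hn).2
  have hsplit : ∑ n ∈ Finset.range M, seriesTerm δ T n =
      c * ((∑ n ∈ Finset.range M, (-1) ^ n * √(n : ℝ) * (Real.sign (r₁ - n) + 1) -
        ∑ n ∈ Finset.range M, (-1) ^ n * √(n : ℝ) * (Real.sign (r₀ - n) + 1) : ℝ) : ℂ) +
      ∑ n ∈ Finset.range M, (seriesTerm δ T n - c * (((-1) ^ n * √n *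
        (Real.sign (r₁ - n) - Real.sign (r₀ - n)) : ℝ) : ℂ)) := by
    rw [Finset.sum_sub_distrib, ← Finset.mul_sum, ← ofReal_sum, ← Finset.sum_sub_distrib]
    have : ∀ n : ℕ, (-1) ^ n * √(n : ℝ) * (Real.sign (r₁ - n) + 1) -
        (-1) ^ n * √(n : ℝ) * (Real.sign (r₀ - n) + 1) =
        (-1) ^ n * √n * (Real.sign (r₁ - n) - Real.sign (r₀ - n)) := fun n => by ring
    rw [Finset.sum_congr rfl fun n _ => this n]
    ring
  rw [hsplit]
  refine (norm_add_le _ _).trans ?_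
  rw [add_mul]
  refine add_le_add ?_ ?_
  · rw [norm_mul, norm_real, Real.norm_eq_abs, mul_assoc]
    refine mul_le_mul_of_nonneg_left ?_ (norm_nonneg c)
    refine (abs_sub _ _).trans ?_
    have h1 := hmain r₁ hr₁0 hr₁T
    have h0 := hmain r₀ hr₀0 hr₀T
    linarith
  · refine (norm_sum_le _ _).trans ((Finset.sum_le_sum fun n _ => hterm T hT n).trans ?_)
    rw [Finset.sum_add_distrib, add_mul, ← Finset.mul_sum]
    refine add_le_add ?_ ?_
    · have h1 : ∑ n ∈ Finset.range M, (n : ℝ) ^ (-(1 + δ)) ≤ S :=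
        hS.sum_le_tsum _ fun n _ => by positivity
      have h2 : T ^ (1 / 4 + δ / 2) ≤ T ^ (1 / 4 + δ) :=
        Real.rpow_le_rpow_of_exponent_le hT1 (by linarith)
      calc _ ≤ 14 * T ^ (1 / 4 + δ) * S := by gcongr
        _ = _ := by ring
    · refine (hind _ fun n => by positivity).trans ?_
      rw [← Finset.mul_sum, Finset.sum_add_distrib]
      have h1 := hlog r₁ hr₁0 hr₁T
      have h0 := hlog r₀ hr₀0 hr₀T
      calc _ ≤ C * T ^ (1 / 4 : ℝ) * (2 * (2 + 3 / δ) * T ^ δ + 2 * (2 + 3 / δ) * T ^ δ) := by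
            gcongr
        _ = C * (4 * (2 + 3 / δ)) * (T ^ (1 / 4 : ℝ) * T ^ δ) := by ring
        _ = _ := by rw [hexp]

lemma hasSum_seriesTerm {δ T : ℝ} (hδ : 0 < δ) (hT : 0 < T) :
    HasSum (seriesTerm δ T) (∫ t in T..(2 * T), phase t *
      (((t / (2 * Real.pi)) ^ (1 / 4 + δ / 2) : ℝ) : ℂ) *
        riemannZeta (((1 + δ : ℝ) : ℂ) + I * t)) := by
  have hpi := Real.pi_gt_three
  have hre : ∀ t : ℝ, (((1 + δ : ℝ) : ℂ) + I * t).re = 1 + δ := fun t => by simp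
  have hS : Summable fun n : ℕ => T ^ (1 / 4 + δ / 2) * (n : ℝ) ^ (-(1 + δ)) :=
    (Real.summable_nat_rpow.2 (by linarith)).mul_left _
  have hsub : uIoc T (2 * T) ⊆ Ioi 0 := by
    rw [uIoc_of_le (by linarith)]
    exact fun t ht => hT.trans ht.1
  refine intervalIntegral.hasSum_integral_of_dominated_convergence
    (fun n _ => T ^ (1 / 4 + δ / 2) * (n : ℝ) ^ (-(1 + δ))) (fun n => ?_) (fun n => ?_) ?_ ?_ ?_
  · refine ContinuousOn.aestronglyMeasurable ?_ measurableSet_uIoc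
    refine ContinuousOn.mul ((continuousOn_phase.mono hsub).mul ?_) ?_
    · refine continuous_ofReal.comp_continuousOn ?_
      refine ContinuousOn.rpow_const (by fun_prop) fun t ht => Or.inl ?_
      have : 0 < t := hsub ht
      positivity
    · rcases eq_or_ne n 0 with rfl | hn
      · refine (continuousOn_const (c := 0)).congr fun t _ => ?_
        have : (((1 + δ : ℝ) : ℂ) + I * t) ≠ 0 := fun h => by
          have := congrArg re h
          rw [hre, zero_re] at this
          linarith
        rw [Nat.cast_zero, zero_cpow this, div_zero]
      · have hnc : (n : ℂ) ≠ 0 := by exact_mod_cast hn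
        refine Continuous.continuousOn (continuous_const.div ?_ fun t => ?_)
        · exact Continuous.const_cpow (by fun_prop) (Or.inl hnc)
        · simp [cpow_eq_zero_iff, hnc]
  · refine Eventually.of_forall fun t ht => ?_
    have ht0 : 0 < t := hsub ht
    rw [uIoc_of_le (by linarith)] at ht
    rw [norm_mul, norm_mul, norm_phase, one_mul, norm_real, Real.norm_eq_abs,
      abs_of_nonneg (by positivity)]
    gcongr
    · rw [div_le_iff₀ (by positivity)]
      nlinarith [ht.2]
    · rcases eq_or_ne n 0 with rfl | hn
      · have : (((1 + δ : ℝ) : ℂ) + I * t) ≠ 0 := fun h => by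
          have := congrArg re h
          rw [hre, zero_re] at this
          linarith
        rw [Nat.cast_zero, zero_cpow this, div_zero, norm_zero]
        positivity
      · rw [norm_div, norm_one, norm_natCast_cpow_of_pos (Nat.pos_of_ne_zero hn), hre,
          Real.rpow_neg (Nat.cast_nonneg n), one_div]
  · exact Eventually.of_forall fun t _ => hS
  · exact intervalIntegrable_const
  · refine Eventually.of_forall fun t _ => ?_
    have h1 : 1 < (((1 + δ : ℝ) : ℂ) + I * t).re := by rw [hre]; linarith
    rw [zeta_eq_tsum_one_div_nat_cpow h1]
    exact (summable_one_div_nat_cpow.2 h1).hasSum.mul_left _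

lemma exists_norm_integral_eTheta_mul_zeta_le {δ : ℝ} (hδ : 0 < δ) (hδ' : δ ≤ 1 / 2) :
    ∃ C > 0, ∀ T ≥ 100, ‖∫ t in T..(2 * T), eTheta t * riemannZeta (1 / 2 + I * t)‖ ≤
      C * T ^ (1 / 4 + δ) := by
  obtain ⟨C₁, hC₁, h1⟩ := exists_norm_integral_eTheta_sub_le hδ hδ'
  obtain ⟨C₂, hC₂, h2⟩ := exists_norm_integral_cphase_le hδ hδ'
  obtain ⟨C₃, hC₃, h3⟩ := exists_norm_integral_right_le hδ hδ'
  obtain ⟨C₄, hC₄, h4⟩ := exists_norm_sum_seriesTerm_le hδ hδ'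
  refine ⟨C₁ + C₂ + C₃ + C₄, by positivity, fun T hT => ?_⟩
  have b1 := h1 T hT
  have b2 := h2 T (by linarith)
  have b3 := h3 T (by linarith)
  have b4 := le_of_tendsto (hasSum_seriesTerm hδ (by linarith)).tendsto_sum_nat.norm
    (Eventually.of_forall (h4 T (by linarith)))
  have b5 : T ^ (1 / 4 + δ / 2) ≤ T ^ (1 / 4 + δ) :=
    Real.rpow_le_rpow_of_exponent_le (by linarith) (by linarith)
  nlinarith

end Sums

end HardyFirstMoment

theorem neg_Iminus_asymptotic :
    ∀ ε > (0 : ℝ), ∃ C > (0 : ℝ), ∃ T₀ : ℝ, ∀ T ≥ T₀,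
      |(-Iminus T) - (1 / 2) * ∫ t in T..(2 * T), ‖riemannZeta (1 / 2 + Complex.I * (t : ℂ))‖| ≤
        C * T ^ ((1 : ℝ) / 4 + ε) := by
  intro ε hε
  obtain ⟨C, hC, h⟩ := HardyFirstMoment.exists_norm_integral_eTheta_mul_zeta_le
    (δ := min ε (1 / 2)) (lt_min hε (by norm_num)) (min_le_right _ _)
  refine ⟨C, hC, 100, fun T hT => ?_⟩
  refine (HardyFirstMoment.abs_neg_Iminus_sub_le (by linarith)).trans ((h T hT).trans ?_)
  gcongr
  · linarith
  · exact min_le_left _ _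
end

section
/- As T → ∞, ∫_0^T F_1(t) dt = O(T^{3/4}). -/
open MeasureTheory

/-- `K(x) = 2π` for `1/4 < x < 3/4` and `K(x) = 0` otherwise. -/
noncomputable def Kfun (x : ℝ) : ℝ := if 1 / 4 < x ∧ x < 3 / 4 then 2 * Real.pi else 0

/-- `F₁(T) = (T/(2π))^{1/4} (-1)^{⌊√(T/(2π))⌋} K({√(T/(2π))})`. -/
noncomputable def F1 (T : ℝ) : ℝ :=
  (T / (2 * Real.pi)) ^ ((1 : ℝ) / 4) * (-1 : ℝ) ^ ⌊Real.sqrt (T / (2 * Real.pi))⌋ *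
    Kfun (Int.fract (Real.sqrt (T / (2 * Real.pi))))

lemma Kfun_nonneg (x : ℝ) : 0 ≤ Kfun x := by
  unfold Kfun; split_ifs <;> positivity

lemma Kfun_le (x : ℝ) : Kfun x ≤ 2 * Real.pi := by
  unfold Kfun; split_ifs
  · exact le_rfl
  · positivity

lemma measurable_Kfun : Measurable Kfun :=
  Measurable.ite (measurableSet_Ioo (a := (1 / 4 : ℝ)) (b := 3 / 4)) measurable_const
    measurable_const

/-- The integrand obtained from `F1` by the substitution `t = 2πu²`, up to the factor `4π`. -/
noncomputable def signedKernel (u : ℝ) : ℝ :=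
  (-1 : ℝ) ^ ⌊u⌋ * Kfun (Int.fract u) * u ^ ((3 : ℝ) / 2)

lemma measurable_signedKernel : Measurable signedKernel := by
  have h : Measurable fun u : ℝ => (-1 : ℝ) ^ ⌊u⌋ :=
    (measurable_from_top (f := fun n : ℤ => (-1 : ℝ) ^ n)).comp Int.measurable_floor
  exact (h.mul (measurable_Kfun.comp measurable_fract)).mul (by fun_prop)

lemma abs_signedKernel_le {u b : ℝ} (hu : 0 ≤ u) (hub : u ≤ b) :
    |signedKernel u| ≤ 2 * Real.pi * b ^ ((3 : ℝ) / 2) := by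
  rw [signedKernel, abs_mul, abs_mul, abs_neg_one_zpow, one_mul, abs_of_nonneg (Kfun_nonneg _),
    abs_of_nonneg (Real.rpow_nonneg hu _)]
  gcongr
  exact Kfun_le _

lemma intervalIntegrable_signedKernel {a b : ℝ} (ha : 0 ≤ a) (hb : 0 ≤ b) :
    IntervalIntegrable signedKernel volume a b := by
  refine (intervalIntegrable_const (c := 2 * Real.pi * (max a b) ^ ((3 : ℝ) / 2))).mono_fun
    measurable_signedKernel.aestronglyMeasurable ?_
  refine (ae_restrict_iff' measurableSet_uIoc).2 (.of_forall fun u hu => ?_)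
  have hu0 : 0 ≤ u := (le_min ha hb).trans hu.1.le
  exact (abs_signedKernel_le hu0 hu.2).trans (le_abs_self _)

lemma abs_integral_signedKernel_le {a b : ℝ} (ha : 0 ≤ a) (hab : a ≤ b) :
    |∫ u in a..b, signedKernel u| ≤ 2 * Real.pi * b ^ ((3 : ℝ) / 2) * (b - a) := by
  have := intervalIntegral.norm_integral_le_of_norm_le_const (f := signedKernel) (a := a) (b := b)
    (C := 2 * Real.pi * b ^ ((3 : ℝ) / 2)) fun u hu => by
      rw [Set.uIoc_of_le hab] at hu
      exact abs_signedKernel_le (ha.trans hu.1.le) hu.2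
  rwa [Real.norm_eq_abs, abs_of_nonneg (sub_nonneg.2 hab)] at this

lemma integral_F1_eq {b : ℝ} (hb : 0 ≤ b) :
    ∫ t in (0 : ℝ)..2 * Real.pi * b ^ 2, F1 t =
      4 * Real.pi * ∫ u in (0 : ℝ)..b, signedKernel u := by
  have hpi := Real.pi_pos
  have himage : (fun u : ℝ => 2 * Real.pi * u ^ 2) '' Set.Ioc 0 b =
      Set.Ioc 0 (2 * Real.pi * b ^ 2) := by
    ext t
    constructor
    · rintro ⟨u, ⟨hu0, hub⟩, rfl⟩
      exact ⟨by positivity, mul_le_mul_of_nonneg_left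
        (pow_le_pow_left₀ hu0.le hub 2) (by positivity)⟩
    · rintro ⟨ht0, htb⟩
      refine ⟨√(t / (2 * Real.pi)), ⟨by positivity, ?_⟩, ?_⟩
      · rw [Real.sqrt_le_left hb, div_le_iff₀ (by positivity)]
        linarith
      · have : √(t / (2 * Real.pi)) ^ 2 = t / (2 * Real.pi) := Real.sq_sqrt (by positivity)
        simp only [this]
        field_simp
  have hinj : Set.InjOn (fun u : ℝ => 2 * Real.pi * u ^ 2) (Set.Ioc 0 b) := by
    intro u hu v hv huv
    have : u ^ 2 = v ^ 2 := mul_left_cancel₀ (by positivity) huv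
    exact (pow_left_inj₀ hu.1.le hv.1.le two_ne_zero).1 this
  have hderiv : ∀ u ∈ Set.Ioc 0 b, HasDerivWithinAt (fun u : ℝ => 2 * Real.pi * u ^ 2)
      (4 * Real.pi * u) (Set.Ioc 0 b) u := fun u _ => by
    refine ((hasDerivAt_pow 2 u).const_mul (2 * Real.pi)).hasDerivWithinAt.congr_deriv ?_
    push_cast
    ring
  rw [intervalIntegral.integral_of_le (by positivity), intervalIntegral.integral_of_le hb,
    ← himage, integral_image_eq_integral_abs_deriv_smul measurableSet_Ioc hderiv hinj,
    ← integral_const_mul]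
  refine setIntegral_congr_fun measurableSet_Ioc fun u hu => ?_
  have hu0 : 0 < u := hu.1
  have hdiv : 2 * Real.pi * u ^ 2 / (2 * Real.pi) = u ^ 2 := by field_simp
  have hpow : u * (u ^ 2) ^ ((1 : ℝ) / 4) = u ^ ((3 : ℝ) / 2) := by
    rw [← Real.rpow_natCast, ← Real.rpow_mul hu0.le, ← Real.rpow_one_add' hu0.le (by norm_num)]
    norm_num
  simp only [F1, signedKernel, hdiv, Real.sqrt_sq hu0.le, smul_eq_mul]
  rw [abs_of_pos (by positivity), ← hpow]
  ring

/-- The absolute value of the integral of `signedKernel` over `[n, n + 1]`. -/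
noncomputable def blockIntegral (n : ℕ) : ℝ :=
  ∫ v in (0 : ℝ)..1, Kfun v * (v + n) ^ ((3 : ℝ) / 2)

lemma integral_signedKernel_block (n : ℕ) :
    ∫ u in (n : ℝ)..(n + 1), signedKernel u = (-1) ^ n * blockIntegral n := by
  have h := intervalIntegral.integral_comp_add_right (a := 0) (b := 1) signedKernel (n : ℝ)
  rw [zero_add, add_comm (1 : ℝ)] at h
  rw [← h, blockIntegral, ← intervalIntegral.integral_const_mul]
  refine intervalIntegral.integral_congr fun v hv => ?_
  rw [Set.uIcc_of_le zero_le_one] at hv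
  simp only [signedKernel, Int.floor_add_natCast, Int.fract_add_natCast]
  rcases hv.2.lt_or_eq with h1 | rfl
  · rw [Int.floor_eq_zero_iff.2 ⟨hv.1, h1⟩, Int.fract_eq_self.2 ⟨hv.1, h1⟩, zero_add,
      zpow_natCast, mul_assoc]
  · norm_num [Kfun]

lemma blockIntegral_nonneg (n : ℕ) : 0 ≤ blockIntegral n :=
  intervalIntegral.integral_nonneg zero_le_one fun v hv =>
    mul_nonneg (Kfun_nonneg v) (Real.rpow_nonneg (add_nonneg hv.1 n.cast_nonneg) _)

lemma blockIntegral_mono : Monotone blockIntegral := by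
  have hint (n : ℕ) : IntervalIntegrable (fun v : ℝ => Kfun v * (v + n) ^ ((3 : ℝ) / 2))
      volume 0 1 := by
    refine (intervalIntegrable_const (c := 2 * Real.pi * (1 + n : ℝ) ^ ((3 : ℝ) / 2))).mono_fun
      (measurable_Kfun.mul (by fun_prop)).aestronglyMeasurable ?_
    refine (ae_restrict_iff' measurableSet_uIoc).2 (.of_forall fun v hv => ?_)
    rw [Set.uIoc_of_le zero_le_one] at hv
    have hv0 : 0 ≤ v := hv.1.le
    have hv1 : v ≤ 1 := hv.2
    beta_reduce
    rw [Real.norm_of_nonneg (mul_nonneg (Kfun_nonneg v) (by positivity)),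
      Real.norm_of_nonneg (by positivity)]
    gcongr
    exact Kfun_le v
  intro m n hmn
  refine intervalIntegral.integral_mono_on zero_le_one (hint m) (hint n) fun v hv => ?_
  have hv0 : 0 ≤ v := hv.1
  have := Kfun_nonneg v
  gcongr

lemma blockIntegral_le (n : ℕ) :
    blockIntegral n ≤ 2 * Real.pi * (n + 1 : ℝ) ^ ((3 : ℝ) / 2) := by
  have h := abs_integral_signedKernel_le (n.cast_nonneg (α := ℝ))
    (le_add_of_nonneg_right zero_le_one)
  rwa [integral_signedKernel_block, abs_mul, abs_pow, abs_neg, abs_one, one_pow, one_mul,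
    abs_of_nonneg (blockIntegral_nonneg n), add_sub_cancel_left, mul_one] at h

lemma abs_alternating_sum_le {a : ℕ → ℝ} (h0 : ∀ n, 0 ≤ a n) (ha : Monotone a) (n : ℕ) :
    |∑ k ∈ Finset.range n, (-1) ^ k * a k| ≤ a n := by
  have key : 0 ≤ -((-1) ^ n * ∑ k ∈ Finset.range n, (-1) ^ k * a k) ∧
      -((-1) ^ n * ∑ k ∈ Finset.range n, (-1) ^ k * a k) ≤ a n := by
    induction n with
    | zero => simpa using h0 0
    | succ n ih =>
      have hs : ((-1 : ℝ) ^ n) * (-1) ^ n = 1 := by rw [← mul_pow]; norm_num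
      have h : -((-1) ^ (n + 1) * ∑ k ∈ Finset.range (n + 1), (-1) ^ k * a k) =
          a n - -((-1) ^ n * ∑ k ∈ Finset.range n, (-1) ^ k * a k) := by
        rw [Finset.sum_range_succ, pow_succ]
        linear_combination a n * hs
      rw [h]
      have := ha n.le_succ
      constructor <;> linarith [ih.1, ih.2]
  calc _ = |-((-1) ^ n * ∑ k ∈ Finset.range n, (-1) ^ k * a k)| := by
        rw [abs_neg, abs_mul, abs_pow, abs_neg, abs_one, one_pow, one_mul]
    _ ≤ a n := by rw [abs_of_nonneg key.1]; exact key.2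

lemma integral_signedKernel_natCast (n : ℕ) :
    ∫ u in (0 : ℝ)..n, signedKernel u = ∑ k ∈ Finset.range n, (-1) ^ k * blockIntegral k := by
  have h := intervalIntegral.sum_integral_adjacent_intervals (f := signedKernel) (μ := volume)
    (a := fun k : ℕ => (k : ℝ)) (n := n)
    fun k _ => intervalIntegrable_signedKernel k.cast_nonneg (k + 1).cast_nonneg
  rw [Nat.cast_zero] at h
  rw [← h]
  refine Finset.sum_congr rfl fun k _ => ?_
  rw [Nat.cast_succ, integral_signedKernel_block]

lemma abs_integral_signedKernel_zero_le {b : ℝ} (hb : 1 ≤ b) :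
    |∫ u in (0 : ℝ)..b, signedKernel u| ≤ 4 * Real.pi * (2 * b) ^ ((3 : ℝ) / 2) := by
  have hb0 : 0 ≤ b := zero_le_one.trans hb
  have hpi := Real.pi_pos
  set n := ⌊b⌋₊
  have hn : (n : ℝ) ≤ b := Nat.floor_le hb0
  have hn' : b < n + 1 := Nat.lt_floor_add_one b
  rw [← intervalIntegral.integral_add_adjacent_intervals
    (intervalIntegrable_signedKernel le_rfl n.cast_nonneg)
    (intervalIntegrable_signedKernel n.cast_nonneg hb0)]
  have h1 : |∫ u in (0 : ℝ)..n, signedKernel u| ≤ 2 * Real.pi * (2 * b) ^ ((3 : ℝ) / 2) := by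
    rw [integral_signedKernel_natCast]
    refine (abs_alternating_sum_le blockIntegral_nonneg blockIntegral_mono n).trans
      ((blockIntegral_le n).trans ?_)
    gcongr
    linarith
  have h2 : |∫ u in (n : ℝ)..b, signedKernel u| ≤ 2 * Real.pi * (2 * b) ^ ((3 : ℝ) / 2) := by
    refine (abs_integral_signedKernel_le n.cast_nonneg hn).trans ?_
    refine (mul_le_of_le_one_right (by positivity) (by linarith)).trans ?_
    gcongr
    linarith
  linarith [abs_add_le (∫ u in (0 : ℝ)..n, signedKernel u) (∫ u in (n : ℝ)..b, signedKernel u)]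

theorem integral_F1_bigO :
    ∃ C > (0 : ℝ), ∃ T₀ : ℝ, ∀ T ≥ T₀,
      |∫ t in (0 : ℝ)..T, F1 t| ≤ C * T ^ ((3 : ℝ) / 4) := by
  have hpi := Real.pi_pos
  refine ⟨4 * Real.pi * (4 * Real.pi * (4 / (2 * Real.pi)) ^ ((3 : ℝ) / 4)), by positivity,
    2 * Real.pi, fun T hT => ?_⟩
  have hT0 : 0 ≤ T := by linarith
  set b := √(T / (2 * Real.pi))
  have hb1 : 1 ≤ b := Real.one_le_sqrt.2 ((one_le_div (by positivity)).2 hT)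
  have hbsq : b ^ 2 = T / (2 * Real.pi) := Real.sq_sqrt (by positivity)
  have hTb : T = 2 * Real.pi * b ^ 2 := by rw [hbsq]; field_simp
  have hpow : (2 * b) ^ ((3 : ℝ) / 2) =
      (4 / (2 * Real.pi)) ^ ((3 : ℝ) / 4) * T ^ ((3 : ℝ) / 4) := by
    rw [← Real.mul_rpow (by positivity) hT0,
      show 4 / (2 * Real.pi) * T = (2 * b) ^ 2 by rw [mul_pow, hbsq]; ring,
      ← Real.rpow_natCast, ← Real.rpow_mul (by positivity)]
    norm_num
  have hF : ∫ t in (0 : ℝ)..T, F1 t = 4 * Real.pi * ∫ u in (0 : ℝ)..b, signedKernel u := by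
    rw [← integral_F1_eq (by positivity), ← hTb]
  calc |∫ t in (0 : ℝ)..T, F1 t|
      = 4 * Real.pi * |∫ u in (0 : ℝ)..b, signedKernel u| := by
        rw [hF, abs_mul, abs_of_pos (by positivity : 0 < 4 * Real.pi)]
    _ ≤ 4 * Real.pi * (4 * Real.pi * (2 * b) ^ ((3 : ℝ) / 2)) := by
        gcongr
        exact abs_integral_signedKernel_zero_le hb1
    _ = _ := by rw [hpow]; ring
end

section
/- As T → ∞, ∫_0^T F_1(t) dt = −16 (T/(2π))^{3/4} Σ_{k=1}^∞ (a(2k−1)/(2k−1)^2) cos(π(2k−1)√(T/(2π))) + O(T^{1/4}), where the series converges absolutely. -/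
open MeasureTheory

/-- `a(n) = cos(πn/4) - cos(3πn/4)`. -/
noncomputable def aCoeff (n : ℕ) : ℝ :=
  Real.cos (Real.pi * n / 4) - Real.cos (3 * Real.pi * n / 4)

section

open Set

/-- The trigonometric series `∑ a(n) / n² cos(π n u)` over odd `n`. -/
noncomputable def oddCosSeries (u : ℝ) : ℝ :=
  ∑' k : ℕ, aCoeff (2 * k + 1) / ((2 * k + 1 : ℕ) : ℝ) ^ 2 *
    Real.cos (Real.pi * ((2 * k + 1 : ℕ) : ℝ) * u)

lemma summable_two_div_odd_sq : Summable (fun k : ℕ => 2 / ((2 * k + 1 : ℕ) : ℝ) ^ 2) := by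
  have h := (hasSum_zeta_two.summable.mul_left 2).comp_injective
    (i := fun k : ℕ => 2 * k + 1) (fun a b h => by simpa using h)
  refine h.congr fun k => ?_
  simp [div_eq_mul_inv]

lemma norm_oddCosSeries_term_le (k : ℕ) (u : ℝ) :
    ‖aCoeff (2 * k + 1) / ((2 * k + 1 : ℕ) : ℝ) ^ 2 *
      Real.cos (Real.pi * ((2 * k + 1 : ℕ) : ℝ) * u)‖ ≤ 2 / ((2 * k + 1 : ℕ) : ℝ) ^ 2 := by
  have ha : |aCoeff (2 * k + 1)| ≤ 2 := by
    unfold aCoeff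
    refine (abs_sub _ _).trans ?_
    linarith [Real.abs_cos_le_one (Real.pi * ((2 * k + 1 : ℕ) : ℝ) / 4),
      Real.abs_cos_le_one (3 * Real.pi * ((2 * k + 1 : ℕ) : ℝ) / 4)]
  rw [norm_mul, norm_div, Real.norm_eq_abs, Real.norm_eq_abs, Real.norm_eq_abs,
    abs_of_nonneg (by positivity : (0 : ℝ) ≤ ((2 * k + 1 : ℕ) : ℝ) ^ 2)]
  calc _ ≤ 2 / ((2 * k + 1 : ℕ) : ℝ) ^ 2 * 1 := by
        gcongr
        exact Real.abs_cos_le_one _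
    _ = _ := mul_one _

lemma continuous_oddCosSeries : Continuous oddCosSeries :=
  continuous_tsum (fun _ => by fun_prop) summable_two_div_odd_sq norm_oddCosSeries_term_le

lemma cos_odd_mul_pi_add (k : ℕ) (x : ℝ) :
    Real.cos (Real.pi * ((2 * k + 1 : ℕ) : ℝ) + x) = -Real.cos x := by
  have h : Real.pi * ((2 * k + 1 : ℕ) : ℝ) + x = x + Real.pi + k * (2 * Real.pi) := by
    push_cast; ring
  rw [h, Real.cos_add_nat_mul_two_pi, Real.cos_add_pi]

lemma oddCosSeries_antiperiodic : Function.Antiperiodic oddCosSeries 1 := by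
  intro u
  unfold oddCosSeries
  rw [← tsum_neg]
  congr 1 with k
  rw [← mul_neg, ← cos_odd_mul_pi_add k]
  ring_nf

lemma hasSum_cos_div_sq {x : ℝ} (hx : x ∈ Icc (0 : ℝ) 1) :
    HasSum (fun n : ℕ => 1 / (n : ℝ) ^ 2 * Real.cos (2 * Real.pi * n * x))
      (Real.pi ^ 2 * (x ^ 2 - x + 1 / 6)) := by
  have h := bernoulliFun_two x
  have hs := hasSum_one_div_nat_pow_mul_cos one_ne_zero hx
  unfold bernoulliFun at h
  rw [mul_one, h] at hs
  convert hs using 1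
  norm_num only [Nat.factorial]
  ring

/-- The Fourier series of the triangle wave. -/
lemma hasSum_odd_cos_div_sq {y : ℝ} (hy : |y| ≤ 1) :
    HasSum (fun k : ℕ => 1 / ((2 * k + 1 : ℕ) : ℝ) ^ 2 *
      Real.cos (Real.pi * ((2 * k + 1 : ℕ) : ℝ) * y)) (Real.pi ^ 2 / 8 * (1 - 2 * |y|)) := by
  have hodd : ∀ z ∈ Icc (0 : ℝ) 1, HasSum (fun k : ℕ => 1 / ((2 * k + 1 : ℕ) : ℝ) ^ 2 *
      Real.cos (Real.pi * ((2 * k + 1 : ℕ) : ℝ) * z)) (Real.pi ^ 2 / 8 * (1 - 2 * z)) := by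
    intro z hz
    have h1 := hasSum_cos_div_sq (x := z / 2) ⟨by linarith [hz.1], by linarith [hz.2]⟩
    have h2 := (hasSum_cos_div_sq hz).mul_left (1 / 4)
    have ho := (h1.summable.comp_injective
      (i := fun k : ℕ => 2 * k + 1) (fun a b h => by simpa using h)).hasSum
    have he : HasSum (fun k : ℕ => 1 / ((2 * k : ℕ) : ℝ) ^ 2 *
        Real.cos (2 * Real.pi * ((2 * k : ℕ) : ℝ) * (z / 2)))
        (1 / 4 * (Real.pi ^ 2 * (z ^ 2 - z + 1 / 6))) := by
      convert! h2 using 1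
      ext k
      push_cast
      rw [show 2 * Real.pi * (2 * (k : ℝ)) * (z / 2) = 2 * Real.pi * k * z by ring, mul_pow,
        ← mul_assoc, one_div_mul_one_div]
      norm_num
    have hsum := h1.unique (HasSum.even_add_odd he ho)
    convert! ho using 1
    · ext k
      simp only [Function.comp]
      ring_nf
    · linear_combination hsum
  convert hodd |y| ⟨abs_nonneg y, hy⟩ using 3 with k
  rcases abs_choice y with h | h <;> rw [h]
  rw [mul_neg, Real.cos_neg]

lemma aCoeff_mul_cos (k : ℕ) (u : ℝ) :
    aCoeff (2 * k + 1) * Real.cos (Real.pi * ((2 * k + 1 : ℕ) : ℝ) * u) =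
      Real.cos (Real.pi * ((2 * k + 1 : ℕ) : ℝ) * (u + 1 / 4)) +
        Real.cos (Real.pi * ((2 * k + 1 : ℕ) : ℝ) * (u - 1 / 4)) := by
  have h : Real.cos (3 * Real.pi * ((2 * k + 1 : ℕ) : ℝ) / 4) =
      -Real.cos (Real.pi * ((2 * k + 1 : ℕ) : ℝ) / 4) := by
    rw [← Real.cos_neg (Real.pi * ((2 * k + 1 : ℕ) : ℝ) / 4), ← cos_odd_mul_pi_add k]
    ring_nf
  unfold aCoeff
  rw [h, mul_add, mul_sub, Real.cos_add, Real.cos_sub,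
    show Real.pi * ((2 * k + 1 : ℕ) : ℝ) * (1 / 4) = Real.pi * ((2 * k + 1 : ℕ) : ℝ) / 4 by ring]
  ring

lemma oddCosSeries_eq_of_hasSum {u a b : ℝ}
    (ha : HasSum (fun k : ℕ => 1 / ((2 * k + 1 : ℕ) : ℝ) ^ 2 *
      Real.cos (Real.pi * ((2 * k + 1 : ℕ) : ℝ) * (u + 1 / 4))) a)
    (hb : HasSum (fun k : ℕ => 1 / ((2 * k + 1 : ℕ) : ℝ) ^ 2 *
      Real.cos (Real.pi * ((2 * k + 1 : ℕ) : ℝ) * (u - 1 / 4))) b) :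
    oddCosSeries u = a + b := by
  rw [← (ha.add hb).tsum_eq]
  unfold oddCosSeries
  congr 1 with k
  rw [← mul_add, ← aCoeff_mul_cos]
  ring

lemma oddCosSeries_of_le_quarter {u : ℝ} (h0 : 0 ≤ u) (h1 : u ≤ 1 / 4) :
    oddCosSeries u = Real.pi ^ 2 / 8 := by
  rw [oddCosSeries_eq_of_hasSum
    (hasSum_odd_cos_div_sq (abs_le.2 ⟨by linarith, by linarith⟩))
    (hasSum_odd_cos_div_sq (abs_le.2 ⟨by linarith, by linarith⟩)),
    abs_of_nonneg (by linarith), abs_of_nonpos (by linarith)]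
  ring

lemma oddCosSeries_of_quarter_le {u : ℝ} (h0 : 1 / 4 ≤ u) (h1 : u ≤ 3 / 4) :
    oddCosSeries u = Real.pi ^ 2 / 2 * (1 / 2 - u) := by
  rw [oddCosSeries_eq_of_hasSum
    (hasSum_odd_cos_div_sq (abs_le.2 ⟨by linarith, by linarith⟩))
    (hasSum_odd_cos_div_sq (abs_le.2 ⟨by linarith, by linarith⟩)),
    abs_of_nonneg (by linarith), abs_of_nonneg (by linarith)]
  ring

lemma oddCosSeries_of_three_quarters_le {u : ℝ} (h0 : 3 / 4 ≤ u) (h1 : u ≤ 1) :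
    oddCosSeries u = -(Real.pi ^ 2 / 8) := by
  have h := oddCosSeries_antiperiodic (u - 1)
  rw [sub_add_cancel] at h
  rw [h, oddCosSeries_eq_of_hasSum
    (hasSum_odd_cos_div_sq (abs_le.2 ⟨by linarith, by linarith⟩))
    (hasSum_odd_cos_div_sq (abs_le.2 ⟨by linarith, by linarith⟩)),
    abs_of_nonneg (by linarith), abs_of_nonpos (by linarith)]
  ring

lemma oddCosSeries_hasDerivAt_of_mem_Ioo {u : ℝ} (h0 : 0 < u) (h1 : u < 1)
    (hq : u ≠ 1 / 4) (hq' : u ≠ 3 / 4) :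
    HasDerivAt oddCosSeries (-(Real.pi / 4) * Kfun u) u := by
  rcases lt_or_gt_of_ne hq with h | h
  · rw [Kfun, if_neg (fun hc => by linarith [hc.1]), mul_zero]
    refine (hasDerivAt_const u (Real.pi ^ 2 / 8)).congr_of_eventuallyEq ?_
    filter_upwards [Ioo_mem_nhds h0 h] with v hv
    exact oddCosSeries_of_le_quarter hv.1.le hv.2.le
  rcases lt_or_gt_of_ne hq' with h' | h'
  · rw [Kfun, if_pos ⟨h, h'⟩]
    have hd := ((hasDerivAt_id u).const_sub (1 / 2)).const_mul (Real.pi ^ 2 / 2)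
    refine (hd.congr_of_eventuallyEq ?_).congr_deriv (by ring)
    filter_upwards [Ioo_mem_nhds h h'] with v hv
    exact oddCosSeries_of_quarter_le hv.1.le hv.2.le
  · rw [Kfun, if_neg (fun hc => by linarith [hc.2]), mul_zero]
    refine (hasDerivAt_const u (-(Real.pi ^ 2 / 8))).congr_of_eventuallyEq ?_
    filter_upwards [Ioo_mem_nhds h' h1] with v hv
    exact oddCosSeries_of_three_quarters_le hv.1.le hv.2.le

lemma oddCosSeries_eq_sub_int (n : ℤ) (v : ℝ) :
    oddCosSeries v = (-1 : ℝ) ^ n * oddCosSeries (v - n) := by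
  have h := oddCosSeries_antiperiodic.add_int_mul_eq (x := v - n) n
  rw [mul_one, sub_add_cancel] at h
  rw [h]
  rw [Int.cast_negOnePow]

/-- The multiples of `1/4`, off which the series is differentiable. -/
def quarterIntegers : Set ℝ := range fun m : ℤ => (m : ℝ) / 4

lemma oddCosSeries_hasDerivAt {u : ℝ} (hu : u ∉ quarterIntegers) :
    HasDerivAt oddCosSeries
      (-(Real.pi / 4) * ((-1 : ℝ) ^ ⌊u⌋ * Kfun (Int.fract u))) u := by
  have hne : ∀ m : ℤ, Int.fract u ≠ (m : ℝ) / 4 := by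
    intro m hm
    refine hu ⟨4 * ⌊u⌋ + m, ?_⟩
    push_cast
    linarith [Int.floor_add_fract u]
  have hd := oddCosSeries_hasDerivAt_of_mem_Ioo (u := Int.fract u)
    (lt_of_le_of_ne (Int.fract_nonneg u) (by simpa using (hne 0).symm)) (Int.fract_lt_one u)
    (by simpa using hne 1) (by simpa using hne 3)
  have hd' := ((hd.comp_sub_const (x := u) (a := (⌊u⌋ : ℝ)))).const_mul ((-1 : ℝ) ^ ⌊u⌋)
  refine (hd'.congr_of_eventuallyEq (.of_forall fun v => ?_)).congr_deriv (by ring)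
  exact oddCosSeries_eq_sub_int ⌊u⌋ v

/-- The primitive of the series vanishing at the origin. -/
noncomputable def oddCosPrimitive (u : ℝ) : ℝ := ∫ v in (0 : ℝ)..u, oddCosSeries v

lemma oddCosPrimitive_hasDerivAt (u : ℝ) : HasDerivAt oddCosPrimitive (oddCosSeries u) u :=
  continuous_oddCosSeries.integral_hasStrictDerivAt 0 u |>.hasDerivAt

lemma continuous_oddCosPrimitive : Continuous oddCosPrimitive :=
  continuous_iff_continuousAt.2 fun u => (oddCosPrimitive_hasDerivAt u).continuousAt

lemma oddCosPrimitive_periodic : Function.Periodic oddCosPrimitive 2 := by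
  intro u
  have hi : ∀ a b, IntervalIntegrable oddCosSeries volume a b :=
    fun a b => continuous_oddCosSeries.intervalIntegrable a b
  have h1 : oddCosPrimitive (u + 2) =
      oddCosPrimitive u + ((∫ v in u..u + 1, oddCosSeries v) +
        ∫ v in u + 1..u + 1 + 1, oddCosSeries v) := by
    unfold oddCosPrimitive
    rw [intervalIntegral.integral_add_adjacent_intervals (hi _ _) (hi _ _),
      intervalIntegral.integral_add_adjacent_intervals (hi _ _) (hi _ _)]
    ring_nf
  have h2 : ∫ v in u + 1..u + 1 + 1, oddCosSeries v = -∫ v in u..u + 1, oddCosSeries v := by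
    rw [← intervalIntegral.integral_comp_add_right, ← intervalIntegral.integral_neg]
    simp_rw [oddCosSeries_antiperiodic _]
  rw [h1, h2]
  ring

lemma exists_abs_oddCosPrimitive_le : ∃ M > 0, ∀ u, |oddCosPrimitive u| ≤ M := by
  obtain ⟨M, hM⟩ := isCompact_Icc.exists_bound_of_continuousOn
    (continuous_oddCosPrimitive.continuousOn (s := Icc 0 2))
  refine ⟨max M 1, by positivity, fun u => ?_⟩
  obtain ⟨v, hv, huv⟩ := oddCosPrimitive_periodic.exists_mem_Ico₀ two_pos u
  rw [huv]
  exact (hM v ⟨hv.1, hv.2.le⟩).trans (le_max_left _ _)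

/-- A primitive of `F1` up to an error of lower order. -/
noncomputable def F1Approx (t : ℝ) : ℝ :=
  -16 * (t / (2 * Real.pi)) ^ ((3 : ℝ) / 4) * oddCosSeries (Real.sqrt (t / (2 * Real.pi))) +
    24 * (t / (2 * Real.pi)) ^ ((1 : ℝ) / 4) * oddCosPrimitive (Real.sqrt (t / (2 * Real.pi)))

lemma continuous_F1Approx : Continuous F1Approx := by
  unfold F1Approx
  have h1 := continuous_oddCosSeries
  have h2 := continuous_oddCosPrimitive
  have h3 : Continuous fun t : ℝ => (t / (2 * Real.pi)) ^ ((3 : ℝ) / 4) :=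
    (continuous_id.div_const _).rpow_const fun _ => Or.inr (by norm_num)
  have h4 : Continuous fun t : ℝ => (t / (2 * Real.pi)) ^ ((1 : ℝ) / 4) :=
    (continuous_id.div_const _).rpow_const fun _ => Or.inr (by norm_num)
  fun_prop

lemma F1Approx_hasDerivAt {t : ℝ} (ht : 0 < t)
    (hu : Real.sqrt (t / (2 * Real.pi)) ∉ quarterIntegers) :
    HasDerivAt F1Approx (F1 t + 3 / Real.pi * ((t / (2 * Real.pi)) ^ (-(3 : ℝ) / 4) *
      oddCosPrimitive (Real.sqrt (t / (2 * Real.pi))))) t := by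
  have hy : 0 < t / (2 * Real.pi) := by positivity
  have hdy : HasDerivAt (fun t : ℝ => t / (2 * Real.pi)) (1 / (2 * Real.pi)) t :=
    (hasDerivAt_id t).div_const _
  have hsq := hdy.sqrt hy.ne'
  have hS := (oddCosSeries_hasDerivAt hu).comp t hsq
  have hQ := (oddCosPrimitive_hasDerivAt (Real.sqrt (t / (2 * Real.pi)))).comp t hsq
  have h3 := hdy.rpow_const (p := (3 : ℝ) / 4) (Or.inl hy.ne')
  have h1 := hdy.rpow_const (p := (1 : ℝ) / 4) (Or.inl hy.ne')
  have hd := ((h3.const_mul (-16)).mul hS).add ((h1.const_mul 24).mul hQ)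
  refine hd.congr_deriv ?_
  unfold F1
  simp only [Function.comp]
  generalize (-1 : ℝ) ^ ⌊Real.sqrt (t / (2 * Real.pi))⌋ = e
  generalize Kfun (Int.fract (Real.sqrt (t / (2 * Real.pi)))) = K
  generalize oddCosSeries (Real.sqrt (t / (2 * Real.pi))) = S
  generalize oddCosPrimitive (Real.sqrt (t / (2 * Real.pi))) = Q
  generalize t / (2 * Real.pi) = y at hy
  obtain ⟨r, hr, rfl⟩ : ∃ r : ℝ, 0 < r ∧ r ^ 4 = y :=
    ⟨y ^ ((1 : ℝ) / 4), by positivity, by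
      rw [← Real.rpow_natCast, ← Real.rpow_mul hy.le]; norm_num⟩
  have hp : ∀ p : ℝ, (r ^ 4) ^ p = r ^ (4 * p) := fun p => by
    rw [← Real.rpow_natCast, ← Real.rpow_mul hr.le]; norm_num
  have hsr : Real.sqrt (r ^ 4) = r ^ 2 := by
    rw [show r ^ 4 = (r ^ 2) ^ 2 by ring, Real.sqrt_sq (by positivity)]
  have e1 : r ^ (4 * ((3 : ℝ) / 4)) = r ^ 3 := by rw [← Real.rpow_natCast]; norm_num
  have e2 : r ^ (4 * ((1 : ℝ) / 4)) = r := by norm_num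
  have e3 : r ^ (4 * ((3 : ℝ) / 4 - 1)) = r⁻¹ := by
    rw [← Real.rpow_neg_one]; norm_num
  have e4 : r ^ (4 * ((1 : ℝ) / 4 - 1)) = (r ^ 3)⁻¹ := by
    rw [← Real.rpow_natCast, ← Real.rpow_neg hr.le]; norm_num
  have e5 : r ^ (4 * (-(3 : ℝ) / 4)) = (r ^ 3)⁻¹ := by
    rw [← Real.rpow_natCast, ← Real.rpow_neg hr.le]; norm_num
  rw [hp, hp, hp, hp, hp, hsr, e1, e2, e3, e4, e5]
  field_simp
  ring

lemma measurable_signed_Kfun :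
    Measurable fun u : ℝ => (-1 : ℝ) ^ ⌊u⌋ * Kfun (Int.fract u) := by
  have hK : Measurable Kfun :=
    Measurable.ite measurableSet_Ioo measurable_const measurable_const
  exact ((measurable_from_top (f := fun n : ℤ => (-1 : ℝ) ^ n)).comp Int.measurable_floor).mul
    (hK.comp measurable_fract)

lemma F1_intervalIntegrable (a b : ℝ) : IntervalIntegrable F1 volume a b := by
  have hc : Continuous fun t : ℝ => (t / (2 * Real.pi)) ^ ((1 : ℝ) / 4) :=
    (continuous_id.div_const _).rpow_const fun _ => Or.inr (by norm_num)
  have hm : Measurable fun t : ℝ => (-1 : ℝ) ^ ⌊Real.sqrt (t / (2 * Real.pi))⌋ *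
      Kfun (Int.fract (Real.sqrt (t / (2 * Real.pi)))) :=
    measurable_signed_Kfun.comp (by fun_prop)
  have hb : ∀ t : ℝ, ‖(-1 : ℝ) ^ ⌊Real.sqrt (t / (2 * Real.pi))⌋ *
      Kfun (Int.fract (Real.sqrt (t / (2 * Real.pi))))‖ ≤ 2 * Real.pi := by
    intro t
    rw [norm_mul, norm_zpow, norm_neg, norm_one, one_zpow, one_mul, Kfun, Real.norm_eq_abs]
    split_ifs
    · exact (abs_of_pos (by positivity)).le
    · simpa using Real.pi_pos.le
  have hi : IntervalIntegrable (fun t : ℝ => (-1 : ℝ) ^ ⌊Real.sqrt (t / (2 * Real.pi))⌋ *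
      Kfun (Int.fract (Real.sqrt (t / (2 * Real.pi))))) volume a b :=
    (intervalIntegrable_const (c := 2 * Real.pi)).mono_fun hm.aestronglyMeasurable
      (.of_forall fun t => (hb t).trans (le_abs_self _))
  refine (hi.continuousOn_mul hc.continuousOn).congr fun t _ => ?_
  simp only [F1, mul_assoc]

lemma div_two_pi_rpow_intervalIntegrable (a b : ℝ) :
    IntervalIntegrable (fun t : ℝ => (t / (2 * Real.pi)) ^ (-(3 : ℝ) / 4)) volume a b := by
  have h := (intervalIntegral.intervalIntegrable_rpow' (r := -(3 : ℝ) / 4)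
    (a := a / (2 * Real.pi)) (b := b / (2 * Real.pi)) (by norm_num)).comp_mul_right
      (c := (2 * Real.pi)⁻¹)
  have hp : (2 * Real.pi) ≠ 0 := by positivity
  simpa only [div_inv_eq_mul, div_mul_cancel₀ _ hp, ← div_eq_mul_inv] using h

lemma integral_div_two_pi_rpow (T : ℝ) :
    ∫ t in (0 : ℝ)..T, (t / (2 * Real.pi)) ^ (-(3 : ℝ) / 4) =
      8 * Real.pi * (T / (2 * Real.pi)) ^ ((1 : ℝ) / 4) := by
  rw [intervalIntegral.integral_comp_div (fun y : ℝ => y ^ (-(3 : ℝ) / 4))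
    (by positivity : (2 * Real.pi) ≠ 0), integral_rpow (Or.inl (by norm_num))]
  norm_num
  ring

lemma countable_sqrt_preimage :
    ({t : ℝ | 0 < t ∧ Real.sqrt (t / (2 * Real.pi)) ∈ quarterIntegers}).Countable := by
  refine (((countable_range _ : quarterIntegers.Countable).image
    fun u => 2 * Real.pi * u ^ 2)).mono ?_
  rintro t ⟨ht, hu⟩
  refine ⟨_, hu, ?_⟩
  simp only
  rw [Real.sq_sqrt (by positivity)]
  field_simp

lemma integral_F1_eq_s6 {T : ℝ} (hT : 0 ≤ T) :
    ∫ t in (0 : ℝ)..T, F1 t = F1Approx T - 3 / Real.pi *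
      ∫ t in (0 : ℝ)..T, (t / (2 * Real.pi)) ^ (-(3 : ℝ) / 4) *
        oddCosPrimitive (Real.sqrt (t / (2 * Real.pi))) := by
  have hQ : IntervalIntegrable (fun t : ℝ => (t / (2 * Real.pi)) ^ (-(3 : ℝ) / 4) *
      oddCosPrimitive (Real.sqrt (t / (2 * Real.pi)))) volume 0 T :=
    (div_two_pi_rpow_intervalIntegrable 0 T).mul_continuousOn
      (continuous_oddCosPrimitive.comp (by fun_prop)).continuousOn
  have h := integral_eq_of_hasDerivAt_off_countable_of_le F1Approx _ hT
    countable_sqrt_preimage continuous_F1Approx.continuousOn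
    (fun t ht => F1Approx_hasDerivAt ht.1.1 fun hu => ht.2 ⟨ht.1.1, hu⟩)
    ((F1_intervalIntegrable 0 T).add (hQ.const_mul (3 / Real.pi)))
  rw [intervalIntegral.integral_add (F1_intervalIntegrable 0 T) (hQ.const_mul _),
    intervalIntegral.integral_const_mul] at h
  have h0 : F1Approx 0 = 0 := by
    simp [F1Approx, Real.zero_rpow]
  linarith

end

theorem integral_F1_asymptotic :
    (∀ T : ℝ, Summable (fun k : ℕ =>
      |aCoeff (2 * k + 1) / ((2 * k + 1 : ℕ) : ℝ) ^ 2 *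
        Real.cos (Real.pi * ((2 * k + 1 : ℕ) : ℝ) * Real.sqrt (T / (2 * Real.pi)))|)) ∧
    ∃ C > (0 : ℝ), ∃ T₀ : ℝ, ∀ T ≥ T₀,
      |(∫ t in (0 : ℝ)..T, F1 t) -
          (-16 * (T / (2 * Real.pi)) ^ ((3 : ℝ) / 4) *
            ∑' k : ℕ, aCoeff (2 * k + 1) / ((2 * k + 1 : ℕ) : ℝ) ^ 2 *
              Real.cos (Real.pi * ((2 * k + 1 : ℕ) : ℝ) * Real.sqrt (T / (2 * Real.pi))))| ≤
        C * T ^ ((1 : ℝ) / 4) := by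
  refine ⟨fun T => ?_, ?_⟩
  · exact (summable_two_div_odd_sq.of_norm_bounded
      fun k => norm_oddCosSeries_term_le k (Real.sqrt (T / (2 * Real.pi)))).abs
  obtain ⟨M, hM0, hM⟩ := exists_abs_oddCosPrimitive_le
  refine ⟨48 * M, by positivity, 0, fun T hT => ?_⟩
  change |_ - -16 * (T / (2 * Real.pi)) ^ ((3 : ℝ) / 4) *
    oddCosSeries (Real.sqrt (T / (2 * Real.pi)))| ≤ _
  have hle : (T / (2 * Real.pi)) ^ ((1 : ℝ) / 4) ≤ T ^ ((1 : ℝ) / 4) :=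
    Real.rpow_le_rpow (by positivity)
      (div_le_self hT (by linarith [Real.pi_gt_three])) (by norm_num)
  have hint : ‖∫ t in (0 : ℝ)..T, (t / (2 * Real.pi)) ^ (-(3 : ℝ) / 4) *
      oddCosPrimitive (Real.sqrt (t / (2 * Real.pi)))‖ ≤
      ∫ t in (0 : ℝ)..T, (t / (2 * Real.pi)) ^ (-(3 : ℝ) / 4) * M := by
    refine intervalIntegral.norm_integral_le_of_norm_le hT (.of_forall fun t ht => ?_)
      ((div_two_pi_rpow_intervalIntegrable 0 T).mul_const M)
    have hp : 0 ≤ (t / (2 * Real.pi)) ^ (-(3 : ℝ) / 4) :=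
      Real.rpow_nonneg (div_nonneg ht.1.le (by positivity)) _
    rw [norm_mul, Real.norm_of_nonneg hp]
    exact mul_le_mul_of_nonneg_left (hM _) hp
  rw [intervalIntegral.integral_mul_const, integral_div_two_pi_rpow, Real.norm_eq_abs] at hint
  rw [integral_F1_eq_s6 hT, F1Approx]
  set I := ∫ t in (0 : ℝ)..T, (t / (2 * Real.pi)) ^ (-(3 : ℝ) / 4) *
    oddCosPrimitive (Real.sqrt (t / (2 * Real.pi)))
  set r := (T / (2 * Real.pi)) ^ ((1 : ℝ) / 4)
  have hr : 0 ≤ r := Real.rpow_nonneg (by positivity) _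
  calc _ = |24 * r * oddCosPrimitive (Real.sqrt (T / (2 * Real.pi))) - 3 / Real.pi * I| := by
        congr 1; ring
    _ ≤ |24 * r * oddCosPrimitive (Real.sqrt (T / (2 * Real.pi)))| + |3 / Real.pi * I| :=
        abs_sub _ _
    _ = 24 * r * |oddCosPrimitive (Real.sqrt (T / (2 * Real.pi)))| + 3 / Real.pi * |I| := by
        rw [abs_mul, abs_mul (3 / Real.pi), abs_of_nonneg (by positivity : 0 ≤ 24 * r),
          abs_of_nonneg (by positivity : 0 ≤ 3 / Real.pi)]
    _ ≤ 24 * r * M + 3 / Real.pi * (8 * Real.pi * r * M) := by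
        gcongr
        exact hM _
    _ = 48 * M * r := by field_simp; ring
    _ ≤ _ := by gcongr
end
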